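/- arXiv:math/0608410 — 5 statements merged into one kernel-verified Lean document; each statement's English description precedes it below -/
import Mathlib

section
/- Let φ ∈ ℝ, η ∈ (0, π/2), C > 0, ν > 0, and let Y be analytic on the open set U = {p ∈ ℂ : p ≠ 0 and |arg(p e^{−iφ})| < η} ∪ {p : |p| < η}, with |Y(p)| ≤ C·exp(ν·|p|) for all p ∈ U. Then for every x ∈ ℂ with Re(x e^{iφ}) > ν and every r ∈ ℕ, the integrals below converge absolutely and ∫_0^{∞e^{iφ}} Y(p) e^{−xp} dp = ∑_{k=0}^{r} Y⁽ᵏ⁾(0) x^{−k−1} + x^{−r−1} ∫_0^{∞e^{iφ}} Y⁽ʳ⁺¹⁾(p) e^{−xp} dp. -/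
open MeasureTheory

lemma geom_aux (φ η : ℝ) (hη : 0 < η) : ∃ δ : ℝ, 0 < δ ∧ ∀ t : ℝ, 0 ≤ t → ∀ p : ℂ,
    ‖p - t * Complex.exp (Complex.I * φ)‖ ≤ δ →
    p ∈ {p : ℂ | p ≠ 0 ∧
        |Complex.arg (p * Complex.exp (-Complex.I * φ))| < η} ∪
        {p : ℂ | ‖p‖ < η} := by
  have h1 : ContinuousAt Complex.arg 1 := Complex.continuousAt_arg (by simp)
  obtain ⟨ε, hε, h⟩ := Metric.continuousAt_iff.1 h1 η hη
  have he : ‖Complex.exp (Complex.I * φ)‖ = 1 := by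
    rw [mul_comm]; exact Complex.norm_exp_ofReal_mul_I φ
  have he' : ‖Complex.exp (-Complex.I * φ)‖ = 1 := by
    have := Complex.norm_exp_ofReal_mul_I (-φ)
    rw [← this]; congr 2; push_cast; ring
  have hee : Complex.exp (Complex.I * φ) * Complex.exp (-Complex.I * φ) = 1 := by
    rw [← Complex.exp_add]; simp
  have hm : 0 < min ε 1 := lt_min hε one_pos
  refine ⟨η * min ε 1 / 4, by positivity, ?_⟩
  intro t ht p hp
  have hm1 : min ε 1 ≤ 1 := min_le_right _ _
  have hm2 : min ε 1 ≤ ε := min_le_left _ _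
  have hd : η * min ε 1 / 4 ≤ η / 4 := by nlinarith
  have hte : ‖(t : ℂ) * Complex.exp (Complex.I * φ)‖ = t := by
    rw [norm_mul, he, mul_one, Complex.norm_real, Real.norm_of_nonneg ht]
  by_cases hlt : t < η / 2
  · right
    show ‖p‖ < η
    have := norm_sub_norm_le p (t * Complex.exp (Complex.I * φ))
    linarith
  · left
    have ht2 : η / 2 ≤ t := not_lt.1 hlt
    have ht0 : 0 < t := by linarith
    constructor
    · rintro rfl
      rw [zero_sub, norm_neg, hte] at hp
      linarith
    · have htc : (t : ℂ) ≠ 0 := by exact_mod_cast ht0.ne'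
      have hz : dist (((t⁻¹ : ℝ) : ℂ) * (p * Complex.exp (-Complex.I * φ))) 1 < ε := by
        have : ((t⁻¹ : ℝ) : ℂ) * (p * Complex.exp (-Complex.I * φ)) - 1
            = ((t⁻¹ : ℝ) : ℂ) * ((p - t * Complex.exp (Complex.I * φ)) *
              Complex.exp (-Complex.I * φ)) := by
          rw [sub_mul, mul_assoc (t : ℂ), hee, mul_sub]
          push_cast
          field_simp
        rw [dist_eq_norm, this, norm_mul, norm_mul, he', mul_one, Complex.norm_real,
          Real.norm_of_nonneg (by positivity), inv_mul_lt_iff₀ ht0]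
        nlinarith
      have := h hz
      rw [Complex.arg_real_mul _ (by positivity), Complex.arg_one, Real.dist_eq, sub_zero] at this
      exact this

/-- Repeated integration by parts for Laplace integrals along the ray
`arg p = φ`: for `Y` analytic and exponentially bounded on a sector around
this ray, and `Re(x e^{iφ}) > ν`,
`∫_0^{∞e^{iφ}} Y(p)e^{-xp}dp = ∑_{k=0}^r Y⁽ᵏ⁾(0) x^{-k-1}
  + x^{-r-1} ∫_0^{∞e^{iφ}} Y⁽ʳ⁺¹⁾(p) e^{-xp} dp`. -/
theorem stmt_2 (φ η : ℝ) (hη : η ∈ Set.Ioo 0 (Real.pi / 2))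
    (C ν : ℝ) (hC : 0 < C) (hν : 0 < ν) (Y : ℂ → ℂ)
    (U : Set ℂ)
    (hU : U = {p : ℂ | p ≠ 0 ∧
        |Complex.arg (p * Complex.exp (-Complex.I * φ))| < η} ∪
        {p : ℂ | ‖p‖ < η})
    (hY : DifferentiableOn ℂ Y U)
    (hbound : ∀ p ∈ U, ‖Y p‖ ≤ C * Real.exp (ν * ‖p‖)) :
    ∀ x : ℂ, ν < (x * Complex.exp (Complex.I * φ)).re → ∀ r : ℕ,
      IntegrableOn (fun t : ℝ =>
        Y (t * Complex.exp (Complex.I * φ)) *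
          Complex.exp (-x * (t * Complex.exp (Complex.I * φ))) *
          Complex.exp (Complex.I * φ)) (Set.Ioi 0) ∧
      IntegrableOn (fun t : ℝ =>
        iteratedDeriv (r + 1) Y (t * Complex.exp (Complex.I * φ)) *
          Complex.exp (-x * (t * Complex.exp (Complex.I * φ))) *
          Complex.exp (Complex.I * φ)) (Set.Ioi 0) ∧
      (∫ t in Set.Ioi (0 : ℝ),
          Y (t * Complex.exp (Complex.I * φ)) *
            Complex.exp (-x * (t * Complex.exp (Complex.I * φ))) *
            Complex.exp (Complex.I * φ)) =
        (∑ k ∈ Finset.range (r + 1), iteratedDeriv k Y 0 / x ^ (k + 1)) +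
          (x ^ (r + 1))⁻¹ *
            ∫ t in Set.Ioi (0 : ℝ),
              iteratedDeriv (r + 1) Y (t * Complex.exp (Complex.I * φ)) *
                Complex.exp (-x * (t * Complex.exp (Complex.I * φ))) *
                Complex.exp (Complex.I * φ) := by
  intro x hx
  obtain ⟨δ, hδ, hgeo⟩ := geom_aux φ η hη.1
  rw [← hU] at hgeo
  have he : ‖Complex.exp (Complex.I * φ)‖ = 1 := by
    rw [mul_comm]; exact Complex.norm_exp_ofReal_mul_I φ
  set e : ℂ := Complex.exp (Complex.I * φ) with hedef
  clear_value e
  have hx0 : x ≠ 0 := by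
    rintro rfl
    simp at hx; linarith
  have hnorm : ∀ t : ℝ, 0 ≤ t → ‖(t : ℂ) * e‖ = t := by
    intro t ht
    rw [norm_mul, he, mul_one, Complex.norm_real, Real.norm_of_nonneg ht]
  have hsub : ∀ t : ℝ, 0 ≤ t → Metric.closedBall ((t : ℂ) * e) δ ⊆ U := by
    intro t ht p hp
    exact hgeo t ht p (by simpa [dist_eq_norm] using hp)
  have han : ∀ t : ℝ, 0 ≤ t → AnalyticAt ℂ Y (t * e) := fun t ht =>
    hY.analyticAt (Filter.mem_of_superset (Metric.closedBall_mem_nhds _ hδ) (hsub t ht))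
  have hder : ∀ n : ℕ, ∀ t : ℝ, 0 ≤ t →
      HasDerivAt (iteratedDeriv n Y) (iteratedDeriv (n + 1) Y (t * e)) (t * e) := by
    intro n t ht
    rw [iteratedDeriv_succ]
    have : AnalyticAt ℂ (iteratedDeriv n Y) (t * e) := by
      rw [iteratedDeriv_eq_iterate]
      exact (han t ht).iterated_deriv n
    exact this.differentiableAt.hasDerivAt
  have hbd : ∀ n : ℕ, ∃ K : ℝ, ∀ t : ℝ, 0 ≤ t →
      ‖iteratedDeriv n Y (t * e)‖ ≤ K * Real.exp (ν * t) := by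
    intro n
    refine ⟨n.factorial * (C * Real.exp (ν * δ)) / δ ^ n, fun t ht => ?_⟩
    have hdc : DiffContOnCl ℂ Y (Metric.ball ((t : ℂ) * e) δ) :=
      (hY.mono (hsub t ht)).diffContOnCl_ball subset_rfl
    have := Complex.norm_iteratedDeriv_le_of_forall_mem_sphere_norm_le
      (C := C * Real.exp (ν * (t + δ))) n hδ hdc (by
        intro z hz
        refine (hbound z (hsub t ht (Metric.sphere_subset_closedBall hz))).trans ?_
        have h1 : ‖z - t * e‖ = δ := by simpa [dist_eq_norm] using hz
        have h2 := norm_sub_norm_le z (t * e)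
        rw [hnorm t ht, h1] at h2
        gcongr
        linarith)
    refine this.trans (le_of_eq ?_)
    rw [mul_add, Real.exp_add]; ring
  let f : ℕ → ℝ → ℂ := fun n t => iteratedDeriv n Y (t * e) * Complex.exp (-x * (t * e))
  have hfd : ∀ n : ℕ, ∀ t : ℝ, 0 ≤ t →
      HasDerivAt (f n) (f (n + 1) t * e - x * (f n t * e)) t := by
    intro n t ht
    have h0 : HasDerivAt (fun t : ℝ => (t : ℂ) * e) e t := by
      simpa using (Complex.ofRealCLM.hasDerivAt (x := t)).mul_const e
    have h1 := (hder n t ht).comp t h0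
    have h2 := (h0.const_mul (-x)).cexp
    refine (h1.mul h2).congr_deriv ?_
    simp only [f, Function.comp]; ring
  have hfb : ∀ n : ℕ, ∃ K : ℝ, ∀ t : ℝ, 0 ≤ t →
      ‖f n t‖ ≤ K * Real.exp (-((x * e).re - ν) * t) := by
    intro n
    obtain ⟨K, hK⟩ := hbd n
    refine ⟨K, fun t ht => ?_⟩
    have : (-x * (t * e)).re = -(x * e).re * t := by
      have : -x * (t * e) = ((-t : ℝ) : ℂ) * (x * e) := by push_cast; ring
      rw [this, Complex.re_ofReal_mul]; ring
    simp only [f]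
    rw [norm_mul, Complex.norm_exp, this]
    refine (mul_le_mul_of_nonneg_right (hK t ht) (Real.exp_pos _).le).trans (le_of_eq ?_)
    rw [mul_assoc, ← Real.exp_add]; congr 2; ring
  have hpos : 0 < (x * e).re - ν := by linarith
  have hint : ∀ n : ℕ, IntegrableOn (fun t => f n t * e) (Set.Ioi 0) := by
    intro n
    obtain ⟨K, hK⟩ := hfb n
    refine Integrable.mul_const ?_ e
    refine Integrable.mono' ((integrableOn_exp_mul_Ioi (a := -((x * e).re - ν))
      (by linarith) 0).const_mul K) ?_ ?_
    · refine ContinuousOn.aestronglyMeasurable ?_ measurableSet_Ioi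
      exact fun t ht => (hfd n t (le_of_lt ht)).continuousAt.continuousWithinAt
    · exact (ae_restrict_iff' measurableSet_Ioi).2
        (Filter.Eventually.of_forall fun t ht => hK t (le_of_lt ht))
  have hlim : ∀ n : ℕ, Filter.Tendsto (f n) Filter.atTop (nhds 0) := by
    intro n
    obtain ⟨K, hK⟩ := hfb n
    refine squeeze_zero_norm' (a := fun t => K * Real.exp (-((x * e).re - ν) * t)) ?_ ?_
    · filter_upwards [Filter.eventually_ge_atTop 0] with t ht using hK t ht
    · have h1 : Filter.Tendsto (fun t : ℝ => -((x * e).re - ν) * t) Filter.atTop Filter.atBot :=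
        Filter.tendsto_id.const_mul_atTop_of_neg (by linarith)
      simpa using (Real.tendsto_exp_atBot.comp h1).const_mul K
  have hstep : ∀ n : ℕ, (∫ t in Set.Ioi (0 : ℝ), f n t * e) =
      iteratedDeriv n Y 0 / x + x⁻¹ * ∫ t in Set.Ioi (0 : ℝ), f (n + 1) t * e := by
    intro n
    have h := integral_Ioi_of_hasDerivAt_of_tendsto' (a := (0 : ℝ)) (hfd n)
      ((hint (n + 1)).sub ((hint n).const_mul x)) (hlim n)
    rw [integral_sub (hint (n + 1)) ((hint n).const_mul x), integral_const_mul] at h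
    have h0 : f n 0 = iteratedDeriv n Y 0 := by simp [f]
    rw [h0] at h
    generalize (∫ t in Set.Ioi (0 : ℝ), f (n + 1) t * e) = A at h ⊢
    generalize (∫ t in Set.Ioi (0 : ℝ), f n t * e) = B at h ⊢
    field_simp
    linear_combination -h
  intro r
  refine ⟨?_, hint (r + 1), ?_⟩
  · simpa [f] using hint 0
  · change _ = _ + _ * ∫ t in Set.Ioi (0 : ℝ), f (r + 1) t * e
    have hz : (∫ t in Set.Ioi (0 : ℝ), Y (t * e) * Complex.exp (-x * (t * e)) * e) =
        ∫ t in Set.Ioi (0 : ℝ), f 0 t * e := by simp [f]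
    rw [hz]
    induction r with
    | zero => rw [hstep 0]; simp
    | succ r ih =>
      rw [ih, hstep (r + 1), Finset.sum_range_succ _ (r + 1)]
      generalize (∫ t in Set.Ioi (0 : ℝ), f (r + 1 + 1) t * e) = A
      generalize (∑ k ∈ Finset.range (r + 1), iteratedDeriv k Y 0 / x ^ (k + 1)) = S
      field_simp
      ring
end

section
/- Suppose f has standard singularity data (λ_j, β_j, A_j, B_j, ε, δ) with N singular points. Then there exist C > 0 and r₀ ∈ ℕ such that for every integer r ≥ r₀, f⁽ʳ⁾(0) = ∑_{j=1}^{N} λ_j^{−r} · (Γ(r − β_j + 1)/Γ(1 − β_j)) · (A_j(λ_j) + E_j(r)), where the E_j(r) ∈ ℂ satisfy |E_j(r)| ≤ C/r. -/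
open Filter Topology Asymptotics

lemma aux_slit {l p : ℂ} (hl : ‖l‖ = 1) (hp : ‖p‖ ≤ 1) (hne : p ≠ l) :
    1 - p / l ∈ Complex.slitPlane := by
  have hl0 : l ≠ 0 := by rintro rfl; simp at hl
  set w := p / l with hw
  have hw1 : ‖w‖ ≤ 1 := by rw [hw, norm_div, hl]; simpa
  have hwne : w ≠ 1 := by
    intro h; apply hne; rw [hw, div_eq_one_iff_eq hl0] at h; exact h
  left
  have h1 : w.re ≤ 1 := (Complex.re_le_norm w).trans hw1
  rcases h1.lt_or_eq with h | h
  · simpa using h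
  · exfalso; apply hwne
    have h2 : w.re * w.re + w.im * w.im ≤ 1 := by
      have := Complex.normSq_apply w
      rw [← this, Complex.normSq_eq_norm_sq]
      nlinarith [norm_nonneg w]
    apply Complex.ext
    · simpa using h
    · simp; nlinarith [mul_self_nonneg w.im]

lemma aux_deriv {l p : ℂ} (γ : ℂ) (h : 1 - p / l ∈ Complex.slitPlane) :
    HasDerivAt (fun q : ℂ => (1 - q / l) ^ γ) (-γ / l * (1 - p / l) ^ (γ - 1)) p := by
  have h1 : HasDerivAt (fun q : ℂ => 1 - q / l) (-(1 / l)) p := by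
    simpa using ((hasDerivAt_id p).div_const l).const_sub 1
  have := h1.cpow_const (c := γ) h
  convert this using 1
  ring

lemma aux_an {l p : ℂ} (γ : ℂ) (h : 1 - p / l ∈ Complex.slitPlane) :
    AnalyticAt ℂ (fun q : ℂ => (1 - q / l) ^ γ) p := by
  have h1 : AnalyticAt ℂ (fun q : ℂ => 1 - q / l) p :=
    analyticAt_const.sub (analyticAt_id.div_const)
  exact AnalyticAt.cpow h1 analyticAt_const h

lemma aux_main {l : ℂ} (hl : ‖l‖ = 1) (γ : ℂ) (r : ℕ) : ∀ p : ℂ, ‖p‖ < 1 →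
    iteratedDeriv r (fun q : ℂ => (1 - q / l) ^ γ) p =
      (∏ i ∈ Finset.range r, (-γ + i)) * l ^ (-(r : ℤ)) * (1 - p / l) ^ (γ - r) := by
  have hl0 : l ≠ 0 := by rintro rfl; simp at hl
  induction r with
  | zero => intro p hp; simp
  | succ r ih =>
    intro p hp
    have hs : 1 - p / l ∈ Complex.slitPlane :=
      aux_slit hl hp.le (by rintro rfl; linarith)
    have : iteratedDeriv r (fun q : ℂ => (1 - q / l) ^ γ) =ᶠ[𝓝 p] fun p =>
        (∏ i ∈ Finset.range r, (-γ + i)) * l ^ (-(r : ℤ)) * (1 - p / l) ^ (γ - r) := by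
      have : ∀ᶠ q : ℂ in 𝓝 p, ‖q‖ < 1 := (continuous_norm.tendsto p).eventually_lt_const hp
      filter_upwards [this] with q hq using ih q hq
    rw [iteratedDeriv_succ, this.deriv_eq, ((aux_deriv (γ - r) hs).const_mul _).deriv,
      Finset.prod_range_succ]
    push_cast
    rw [neg_add, zpow_add₀ hl0, zpow_neg_one, sub_add_eq_sub_sub]
    field_simp
    ring

lemma aux_sing {l : ℂ} (hl : ‖l‖ = 1) (γ : ℂ) (g R H : ℂ → ℂ) (hR : AnalyticAt ℂ R l)
    (hH : AnalyticAt ℂ H l)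
    (hg : ∀ᶠ p in 𝓝 l, ‖p‖ < 1 → g p = (1 - p / l) ^ γ * R p + H p) (m : ℕ) :
    ∃ R' H' : ℂ → ℂ, AnalyticAt ℂ R' l ∧ AnalyticAt ℂ H' l ∧
      ∀ᶠ p in 𝓝 l, ‖p‖ < 1 → iteratedDeriv m g p = (1 - p / l) ^ (γ - m) * R' p + H' p := by
  induction m with
  | zero => exact ⟨R, H, hR, hH, by simpa using hg⟩
  | succ m ih =>
    obtain ⟨R', H', hR', hH', h⟩ := ih
    refine ⟨fun p => -(γ - m) / l * R' p + (1 - p / l) * deriv R' p, deriv H', ?_, hH'.deriv, ?_⟩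
    · exact (analyticAt_const.mul hR').add
        ((analyticAt_const.sub analyticAt_id.div_const).mul hR'.deriv)
    · filter_upwards [h.eventually_nhds, hR'.eventually_analyticAt, hH'.eventually_analyticAt]
        with p hp hRp hHp hp1
      have hs : 1 - p / l ∈ Complex.slitPlane :=
        aux_slit hl hp1.le (by rintro rfl; linarith)
      have : iteratedDeriv m g =ᶠ[𝓝 p] fun p => (1 - p / l) ^ (γ - m) * R' p + H' p := by
        have : ∀ᶠ q : ℂ in 𝓝 p, ‖q‖ < 1 := (continuous_norm.tendsto p).eventually_lt_const hp1
        filter_upwards [this, hp] with q hq h using h hq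
      rw [iteratedDeriv_succ, this.deriv_eq]
      have hd := ((aux_deriv (γ - m) hs).mul hRp.differentiableAt.hasDerivAt).add
        hHp.differentiableAt.hasDerivAt
      refine hd.deriv.trans ?_
      have h0 : (1 - p / l) ≠ 0 := Complex.slitPlane_ne_zero hs
      have : (1 - p / l) ^ (γ - m) = (1 - p / l) ^ (γ - m - 1) * (1 - p / l) := by
        rw [Complex.cpow_sub _ 1 h0, Complex.cpow_one]; field_simp
      rw [this]
      push_cast
      rw [sub_add_eq_sub_sub]
      ring

lemma aux_bdd {l : ℂ} (hl : ‖l‖ = 1) (γ : ℂ) (hγ : 0 ≤ γ.re) (R H : ℂ → ℂ)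
    (hR : AnalyticAt ℂ R l) (hH : AnalyticAt ℂ H l) :
    ∃ M : ℝ, ∀ᶠ p in 𝓝 l, ‖(1 - p / l) ^ γ * R p + H p‖ ≤ M := by
  have hl0 : l ≠ 0 := by rintro rfl; simp at hl
  refine ⟨Real.exp (Real.pi * |γ.im|) * (‖R l‖ + 1) + (‖H l‖ + 1), ?_⟩
  have e1 : ∀ᶠ p in 𝓝 l, ‖R p‖ < ‖R l‖ + 1 :=
    hR.continuousAt.norm.eventually_lt_const (by linarith)
  have e2 : ∀ᶠ p in 𝓝 l, ‖H p‖ < ‖H l‖ + 1 :=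
    hH.continuousAt.norm.eventually_lt_const (by linarith)
  have e3 : ∀ᶠ p in 𝓝 l, ‖1 - p / l‖ < 1 := by
    have : ContinuousAt (fun p : ℂ => ‖1 - p / l‖) l := by fun_prop
    exact this.eventually_lt_const (by simp [hl0])
  filter_upwards [e1, e2, e3] with p h1 h2 h3
  refine (norm_add_le _ _).trans (add_le_add ?_ h2.le)
  rw [norm_mul]
  refine mul_le_mul ?_ h1.le (norm_nonneg _) (Real.exp_pos _).le
  refine (Complex.norm_cpow_le _ _).trans ?_
  rw [div_eq_mul_inv, ← Real.exp_neg]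
  have h4 : ‖1 - p / l‖ ^ γ.re ≤ 1 := Real.rpow_le_one (norm_nonneg _) h3.le hγ
  have h5 : -(Complex.arg (1 - p / l) * γ.im) ≤ Real.pi * |γ.im| := by
    refine (neg_le_abs _).trans ?_
    rw [abs_mul]
    gcongr
    exact Complex.abs_arg_le_pi _
  calc _ ≤ 1 * Real.exp (-(Complex.arg (1 - p / l) * γ.im)) := by gcongr
    _ ≤ _ := by rw [one_mul]; gcongr

lemma aux_taylor {l : ℂ} (hl : ‖l‖ = 1) (A : ℂ → ℂ) (hA : AnalyticAt ℂ A l) (K : ℕ) :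
    ∃ (c : ℕ → ℂ) (R : ℂ → ℂ), c 0 = A l ∧ AnalyticAt ℂ R l ∧
      ∀ p, A p = ∑ k ∈ Finset.range (K + 1), c k * (1 - p / l) ^ k + (1 - p / l) ^ (K + 1) * R p := by
  have hl0 : l ≠ 0 := by rintro rfl; simp at hl
  have step : ∀ F : ℂ → ℂ, AnalyticAt ℂ F l → ∃ R : ℂ → ℂ, AnalyticAt ℂ R l ∧
      ∀ p, F p = F l + (1 - p / l) * R p := by
    intro F ⟨q, hF⟩
    refine ⟨fun p => -l * dslope F l p, analyticAt_const.mul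
      ⟨_, hF.has_fpower_series_dslope_fslope⟩, fun p => ?_⟩
    have := sub_smul_dslope F l p
    rw [smul_eq_mul] at this
    have h2 : (1 - p / l) * (-l * dslope F l p) = (p - l) * dslope F l p := by
      field_simp; ring
    rw [h2, this]; ring
  induction K with
  | zero =>
    obtain ⟨R, hR, h⟩ := step A hA
    exact ⟨fun _ => A l, R, rfl, hR, fun p => by simpa using h p⟩
  | succ K ih =>
    obtain ⟨c, R, hc, hR, h⟩ := ih
    obtain ⟨R', hR', h'⟩ := step R hR
    refine ⟨fun k => if k = K + 1 then R l else c k, R', by simpa using hc, hR', fun p => ?_⟩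
    rw [Finset.sum_range_succ, h p, h' p]
    have : ∑ k ∈ Finset.range (K + 1), (if k = K + 1 then R l else c k) * (1 - p / l) ^ k
        = ∑ k ∈ Finset.range (K + 1), c k * (1 - p / l) ^ k := by
      apply Finset.sum_congr rfl
      intro k hk
      rw [if_neg (by simp at hk; omega)]
    rw [this]; simp; ring

lemma aux_theta (s : ℂ) (hs : ∀ m : ℕ, s ≠ -m) :
    (fun r : ℕ => ∏ i ∈ Finset.range r, (s + i)) =Θ[atTop]
      fun r : ℕ => (r : ℝ) ^ (s.re - 1) * (r.factorial : ℝ) := by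
  have hG := Complex.GammaSeq_tendsto_Gamma s
  have hG0 := Complex.Gamma_ne_zero hs
  have t1 : Complex.GammaSeq s =Θ[atTop] fun _ : ℕ => (1 : ℝ) := by
    refine ⟨hG.isBigO_one ℝ, ?_⟩
    have := (hG.inv₀ hG0).isBigO_one ℝ
    have h2 := this.inv_rev (by
      filter_upwards [hG.eventually_ne hG0] with n hn h; simp [hn] at h)
    simpa using h2
  have t2 : (fun r : ℕ => s + r) =Θ[atTop] fun r : ℕ => (r : ℝ) := by
    have hlit : (fun _ : ℕ => s) =o[atTop] fun r : ℕ => (r : ℂ) := by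
      rw [isLittleO_const_left]; right
      have : (norm ∘ fun r : ℕ => (r : ℂ)) = fun r : ℕ => (r : ℝ) := by ext; simp
      rw [this]; exact tendsto_natCast_atTop_atTop
    have h3 : (fun r : ℕ => s + r) =Θ[atTop] fun r : ℕ => (r : ℂ) := by
      have := hlit.add_isTheta (isTheta_refl (fun r : ℕ => (r : ℂ)) atTop)
      exact this
    refine h3.trans ?_
    exact IsTheta.of_norm_eventuallyEq_norm (by simp)
  have t3 : (fun r : ℕ => (r : ℂ) ^ s) =Θ[atTop] fun r : ℕ => (r : ℝ) ^ s.re := by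
    apply IsTheta.of_norm_eventuallyEq_norm
    filter_upwards [eventually_gt_atTop 0] with r hr
    rw [Complex.norm_natCast_cpow_of_pos hr, Real.norm_of_nonneg (by positivity)]
  have t4 : (fun r : ℕ => (r.factorial : ℂ)) =Θ[atTop] fun r : ℕ => (r.factorial : ℝ) :=
    IsTheta.of_norm_eventuallyEq_norm (by simp)
  have t5 := ((t3.mul t4).div t1).div t2
  have e1 : (fun r : ℕ => ∏ i ∈ Finset.range r, (s + i)) =ᶠ[atTop]
      (fun r : ℕ => (r : ℂ) ^ s * r.factorial / s.GammaSeq r / (s + r)) := by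
    filter_upwards [hG.eventually_ne hG0, eventually_gt_atTop 0] with r hr hr0
    have hp : ∏ i ∈ Finset.range r, (s + i) ≠ 0 := by
      rw [Finset.prod_ne_zero_iff]; intro i _ h
      exact hs i (eq_neg_of_add_eq_zero_left h)
    have hq : s + r ≠ 0 := fun h => hs r (eq_neg_of_add_eq_zero_left h)
    have h1 : (r : ℂ) ^ s ≠ 0 := by
      rw [Complex.cpow_def_of_ne_zero (by exact_mod_cast hr0.ne')]; exact Complex.exp_ne_zero _
    have h2 : (r.factorial : ℂ) ≠ 0 := by exact_mod_cast r.factorial_ne_zero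
    rw [Complex.GammaSeq, Finset.prod_range_succ]
    field_simp
  have e2 : (fun x : ℕ => (x : ℝ) ^ s.re * x.factorial / 1 / (x : ℝ)) =ᶠ[atTop]
      fun r : ℕ => (r : ℝ) ^ (s.re - 1) * (r.factorial : ℝ) := by
    filter_upwards [eventually_gt_atTop 0] with r hr
    have : (0 : ℝ) < r := by exact_mod_cast hr
    rw [Real.rpow_sub_one this.ne']
    ring
  exact (e1.trans_isTheta t5).trans_eventuallyEq e2

lemma aux_gamma (s : ℂ) (hs : ∀ m : ℕ, s ≠ -m) (r : ℕ) :
    Complex.Gamma (s + r) / Complex.Gamma s = ∏ i ∈ Finset.range r, (s + i) := by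
  have h0 := Complex.Gamma_ne_zero hs
  induction r with
  | zero => simp [h0]
  | succ r ih =>
    rw [Finset.prod_range_succ, ← ih]
    push_cast
    rw [← add_assoc, Complex.Gamma_add_one _ (fun h => hs r (eq_neg_of_add_eq_zero_left h))]
    ring

lemma aux_cauchy (g : ℂ → ℂ) (m : ℕ) (M : ℝ) (hg : ∀ p : ℂ, ‖p‖ < 1 → AnalyticAt ℂ g p)
    (hM : ∀ p : ℂ, ‖p‖ < 1 → ‖iteratedDeriv m g p‖ ≤ M) :
    (fun r : ℕ => iteratedDeriv r g 0) =O[atTop]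
      fun r : ℕ => (r : ℝ) ^ (-(m : ℝ)) * (r.factorial : ℝ) := by
  have key : ∀ n : ℕ, ‖iteratedDeriv (n + m) g 0‖ ≤ n.factorial * M := by
    intro n
    have e : iteratedDeriv (n + m) g = iteratedDeriv n (iteratedDeriv m g) := by
      simp only [iteratedDeriv_eq_iterate, Function.iterate_add_apply]
    rw [e]
    have hh : ∀ p : ℂ, ‖p‖ < 1 → AnalyticAt ℂ (iteratedDeriv m g) p := by
      intro p hp
      rw [iteratedDeriv_eq_iterate]
      exact (hg p hp).iterated_deriv m
    have b : ∀ R : ℝ, R ∈ Set.Ioo (0 : ℝ) 1 →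
        ‖iteratedDeriv n (iteratedDeriv m g) 0‖ ≤ n.factorial * M / R ^ n := by
      intro R hR
      apply Complex.norm_iteratedDeriv_le_of_forall_mem_sphere_norm_le n hR.1
      · apply DifferentiableOn.diffContOnCl
        intro z hz
        have : ‖z‖ ≤ R := by
          simpa using Metric.closure_ball_subset_closedBall hz
        exact (hh z (this.trans_lt hR.2)).differentiableAt.differentiableWithinAt
      · intro z hz
        apply hM
        have : ‖z‖ = R := by simpa using hz
        rw [this]; exact hR.2
    have t : Tendsto (fun R : ℝ => n.factorial * M / R ^ n) (𝓝[<] 1) (𝓝 (n.factorial * M)) := by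
      have : ContinuousAt (fun R : ℝ => n.factorial * M / R ^ n) 1 := by
        apply ContinuousAt.div (by fun_prop) (by fun_prop); simp
      have := this.tendsto
      simp only [one_pow, div_one] at this
      exact this.mono_left nhdsWithin_le_nhds
    refine ge_of_tendsto t ?_
    filter_upwards [Ioo_mem_nhdsLT (show (0 : ℝ) < 1 by norm_num)] with R hR using b R hR
  apply IsBigO.of_bound (M * 2 ^ m)
  filter_upwards [eventually_ge_atTop (2 * m + 1)] with r hr
  obtain ⟨n, rfl⟩ : ∃ n, r = n + m := ⟨r - m, by omega⟩
  refine (key n).trans ?_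
  have hM0 : 0 ≤ M := (norm_nonneg _).trans (hM 0 (by simp))
  have h1 : (n : ℝ) ^ m * n.factorial ≤ (n + m).factorial := by
    have h2 := Nat.factorial_mul_pow_le_factorial (n := m) (m := n)
    have h3 : (n.factorial : ℝ) * (n + 1) ^ m ≤ (n + m).factorial := by exact_mod_cast h2
    refine le_trans ?_ h3
    rw [mul_comm]; gcongr; linarith
  have hr0 : (0 : ℝ) < ((n + m : ℕ) : ℝ) := by exact_mod_cast (by omega)
  have h4 : ((n + m : ℕ) : ℝ) ≤ 2 * n := by exact_mod_cast (by omega)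
  rw [Real.norm_of_nonneg (by positivity), Real.rpow_neg hr0.le, Real.rpow_natCast]
  have h5 : ((n + m : ℕ) : ℝ) ^ m ≤ 2 ^ m * (n : ℝ) ^ m := by
    rw [← mul_pow]; gcongr
  have h6 : ((n + m : ℕ) : ℝ) ^ m * n.factorial ≤ 2 ^ m * (n + m).factorial := by
    calc _ ≤ 2 ^ m * (n : ℝ) ^ m * n.factorial := by gcongr
      _ = 2 ^ m * ((n : ℝ) ^ m * n.factorial) := by ring
      _ ≤ _ := by gcongr
  have h7 : (n.factorial : ℝ) ≤ 2 ^ m * ((((n + m : ℕ) : ℝ) ^ m)⁻¹ * (n + m).factorial) := by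
    rw [← mul_assoc, mul_comm (2 ^ m : ℝ), mul_assoc, ← div_eq_inv_mul, le_div_iff₀ (by positivity)]
    linarith
  calc _ = M * n.factorial := mul_comm _ _
    _ ≤ M * (2 ^ m * ((((n + m : ℕ) : ℝ) ^ m)⁻¹ * (n + m).factorial)) := by gcongr
    _ = _ := by ring

lemma aux_compact (h : ℂ → ℂ) (hloc : ∀ p : ℂ, ‖p‖ ≤ 1 → ∃ M : ℝ, ∀ᶠ q in 𝓝 p, ‖q‖ < 1 → ‖h q‖ ≤ M) :
    ∃ M : ℝ, ∀ p : ℂ, ‖p‖ < 1 → ‖h p‖ ≤ M := by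
  have := (isCompact_closedBall (0 : ℂ) 1).induction_on
    (p := fun s => ∃ M : ℝ, ∀ q ∈ s, ‖q‖ < 1 → ‖h q‖ ≤ M) ⟨0, by simp⟩
    (fun s t hst ⟨M, hM⟩ => ⟨M, fun q hq => hM q (hst hq)⟩)
    (fun s t ⟨M, hM⟩ ⟨M', hM'⟩ => ⟨max M M', fun q hq h1 => by
      rcases hq with hq | hq
      · exact (hM q hq h1).trans (le_max_left _ _)
      · exact (hM' q hq h1).trans (le_max_right _ _)⟩)
    (fun x hx => by
      obtain ⟨M, hM⟩ := hloc x (by simpa using hx)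
      exact ⟨_, mem_nhdsWithin_of_mem_nhds hM, M, fun q hq => hq⟩)
  obtain ⟨M, hM⟩ := this
  exact ⟨M, fun p hp => hM p (by simpa using hp.le) hp⟩


lemma aux_ratio (b : ℂ) (hb : ∀ n : ℤ, b ≠ n) (k : ℕ) :
    (fun r : ℕ => (∏ i ∈ Finset.range r, (1 - b - (k + 1 : ℕ) + i)) /
      ∏ i ∈ Finset.range r, (1 - b + i)) =O[atTop] fun r : ℕ => 1 / (r : ℝ) := by
  have t1 := aux_theta (1 - b - (k + 1 : ℕ)) (fun m h => hb (m - k) (by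
    push_cast at h ⊢; linear_combination -h))
  have t2 := aux_theta (1 - b) (fun m h => hb (m + 1) (by push_cast; linear_combination -h))
  refine (t1.div t2).isBigO.trans ?_
  apply IsBigO.of_bound 1
  filter_upwards [eventually_gt_atTop 0] with r hr
  have hr0 : (1 : ℝ) ≤ r := by exact_mod_cast hr
  have hf : (0 : ℝ) < r.factorial := by exact_mod_cast r.factorial_pos
  rw [mul_div_mul_right _ _ hf.ne', ← Real.rpow_sub (by linarith), one_mul,
    Real.norm_of_nonneg (by positivity), Real.norm_of_nonneg (by positivity), one_div,
    ← Real.rpow_neg_one]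
  apply Real.rpow_le_rpow_of_exponent_le hr0
  simp
  linarith [k.cast_nonneg (α := ℝ)]

lemma aux_rem (b : ℂ) (hb : ∀ n : ℤ, b ≠ n) (l : ℂ) (hl : ‖l‖ = 1) (m : ℕ) (hm : b.re + 1 ≤ m)
    (u : ℕ → ℂ) (hu : u =O[atTop] fun r : ℕ => (r : ℝ) ^ (-(m : ℝ)) * (r.factorial : ℝ)) :
    (fun r : ℕ => u r * l ^ (r : ℤ) / ∏ i ∈ Finset.range r, (1 - b + i))
      =O[atTop] fun r : ℕ => 1 / (r : ℝ) := by
  have t2 := aux_theta (1 - b) (fun m h => hb (m + 1) (by push_cast; linear_combination -h))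
  have h1 : (fun r : ℕ => u r * l ^ (r : ℤ)) =O[atTop] 
      fun r : ℕ => (r : ℝ) ^ (-(m : ℝ)) * (r.factorial : ℝ) := by
    refine IsBigO.trans (IsBigO.of_bound 1 ?_) hu
    filter_upwards with r
    simp [hl]
  refine (h1.mul t2.inv.isBigO).trans ?_
  apply IsBigO.of_bound 1
  filter_upwards [eventually_gt_atTop 0] with r hr
  have hr0 : (1 : ℝ) ≤ r := by exact_mod_cast hr
  have hf : (0 : ℝ) < r.factorial := by exact_mod_cast r.factorial_pos
  rw [← div_eq_mul_inv, mul_div_mul_right _ _ hf.ne', ← Real.rpow_sub (by linarith), one_mul,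
    Real.norm_of_nonneg (by positivity), Real.norm_of_nonneg (by positivity), one_div,
    ← Real.rpow_neg_one]
  apply Real.rpow_le_rpow_of_exponent_le hr0
  simp
  linarith

/-- Large-order behavior of Taylor coefficients dictated by the nearest
singularities of the Borel transform: if `f` has standard singularity data
`(l j, β j, A j, B j, ε, δ)` with `N` singular points, then
`f⁽ʳ⁾(0) = ∑_j l_j^{-r} (Γ(r-β_j+1)/Γ(1-β_j)) (A_j(l_j) + E_j(r))`
with `|E_j(r)| ≤ C/r`. -/
theorem stmt_3 (N : ℕ) (hN : 1 ≤ N)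
    (l β : Fin N → ℂ) (A B : Fin N → ℂ → ℂ) (ε δ : ℝ) (f : ℂ → ℂ)
    (hmod : ∀ j, ‖l j‖ = 1) (hinj : Function.Injective l)
    (hε : 0 < ε) (hεδ : ε < δ) (hδ : δ < 1)
    (hβre : ∀ j, 0 < (β j).re) (hβint : ∀ j, ∀ n : ℤ, β j ≠ (n : ℂ))
    (D : Set ℂ)
    (hD : D = {p : ℂ | ‖p‖ < 1 + ε} \
        ⋃ j, {q : ℂ | ∃ t : ℝ, 1 ≤ t ∧ t < 1 + ε ∧ q = (t : ℂ) * l j})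
    (hf : DifferentiableOn ℂ f D)
    (hA : ∀ j, DifferentiableOn ℂ (A j) {p : ℂ | ‖p - l j‖ < δ})
    (hB : ∀ j, DifferentiableOn ℂ (B j) {p : ℂ | ‖p - l j‖ < δ})
    (hloc : ∀ j, ∀ p ∈ D, ‖p - l j‖ < δ →
      f p = (1 - p / l j) ^ (β j - 1) * A j p + B j p) :
    ∃ C : ℝ, 0 < C ∧ ∃ r₀ : ℕ, ∀ r : ℕ, r₀ ≤ r →
      ∃ E : Fin N → ℂ, (∀ j, ‖E j‖ ≤ C / r) ∧
        iteratedDeriv r f 0 =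
          ∑ j, (l j) ^ (-(r : ℤ)) *
            (Complex.Gamma ((r : ℂ) - β j + 1) / Complex.Gamma (1 - β j)) *
            (A j (l j) + E j) := by
  have hl0 : ∀ j, l j ≠ 0 := fun j h => by simpa [h] using hmod j
  have hDmem : ∀ q : ℂ, ‖q‖ < 1 + ε → (∀ j, 1 - q / l j ∈ Complex.slitPlane) → q ∈ D := by
    intro q hq hs
    rw [hD]
    refine ⟨hq, ?_⟩
    simp only [Set.mem_iUnion, Set.mem_ofPred_eq, not_exists, not_and]
    rintro j t ht _ rfl
    have := hs j
    rw [mul_div_cancel_right₀ _ (hl0 j)] at this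
    have h2 : ((1 - t : ℝ) : ℂ) ∈ Complex.slitPlane := by simpa using this
    rw [Complex.ofReal_mem_slitPlane] at h2
    linarith
  have hfan : ∀ p : ℂ, ‖p‖ ≤ 1 → (∀ j, p ≠ l j) → AnalyticAt ℂ f p := by
    intro p hp hne
    apply hf.analyticAt
    have e1 : ∀ᶠ q : ℂ in 𝓝 p, ‖q‖ < 1 + ε :=
      (continuous_norm.tendsto p).eventually_lt_const (by linarith)
    have e2 : ∀ᶠ q : ℂ in 𝓝 p, ∀ j, 1 - q / l j ∈ Complex.slitPlane := by
      rw [eventually_all]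
      intro j
      have : ContinuousAt (fun q : ℂ => 1 - q / l j) p := by fun_prop
      exact this.eventually_mem (Complex.isOpen_slitPlane.mem_nhds (aux_slit (hmod j) hp (hne j)))
    filter_upwards [e1, e2] with q h1 h2 using hDmem q h1 h2
  have hball : ∀ j, {p : ℂ | ‖p - l j‖ < δ} ∈ 𝓝 (l j) := by
    intro j
    have := Metric.ball_mem_nhds (l j) (hε.trans hεδ)
    simpa [Metric.ball, dist_eq_norm] using this
  have hne1 : ∀ p : ℂ, ‖p‖ < 1 → ∀ j, p ≠ l j := by
    rintro p hp j rfl; linarith [hmod j]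
  let j0 : Fin N := ⟨0, hN⟩
  obtain ⟨m, hm⟩ := exists_nat_ge ((β j0).re + 1)
  have htay := fun j => aux_taylor (hmod j) (A j) ((hA j).analyticAt (hball j)) m
  choose c R hc hR hAR using htay
  set S : Fin N → ℂ → ℂ := fun j p =>
    ∑ k ∈ Finset.range (m + 1), c j k * (1 - p / l j) ^ (β j - 1 + k) with hS
  set g : ℂ → ℂ := fun p => f p - ∑ j, S j p with hgdef
  have hSan : ∀ j p, ‖p‖ ≤ 1 → p ≠ l j → AnalyticAt ℂ (S j) p := by
    intro j p hp hne
    apply Finset.analyticAt_fun_sum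
    intro k _
    exact analyticAt_const.mul (aux_an _ (aux_slit (hmod j) hp hne))
  have hgan : ∀ p : ℂ, ‖p‖ ≤ 1 → (∀ j, p ≠ l j) → AnalyticAt ℂ g p := by
    intro p hp hne
    exact (hfan p hp hne).sub (Finset.analyticAt_fun_sum _ fun j _ => hSan j p hp (hne j))
  have hbd : ∃ M : ℝ, ∀ p : ℂ, ‖p‖ < 1 → ‖iteratedDeriv m g p‖ ≤ M := by
    apply aux_compact
    intro p hp
    by_cases hne : ∀ j, p ≠ l j
    · have := ((hgan p hp hne).iterated_deriv m).continuousAt.norm.eventually_lt_const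
        (lt_add_one _)
      rw [← iteratedDeriv_eq_iterate] at this
      exact ⟨_, this.mono fun q hq _ => hq.le⟩
    · push Not at hne
      obtain ⟨j, rfl⟩ := hne
      have hH : AnalyticAt ℂ (fun p => B j p - ∑ i ∈ Finset.univ.erase j, S i p) (l j) := by
        refine ((hB j).analyticAt (hball j)).sub (Finset.analyticAt_fun_sum _ fun i hi => ?_)
        exact hSan i _ hp (fun h => (Finset.ne_of_mem_erase hi) (hinj h).symm)
      have hg : ∀ᶠ p in 𝓝 (l j), ‖p‖ < 1 → g p = (1 - p / l j) ^ (β j + m) * R j p +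
          (B j p - ∑ i ∈ Finset.univ.erase j, S i p) := by
        filter_upwards [hball j] with p hpδ hp1
        have hpD : p ∈ D := hDmem p (by linarith)
          (fun i => aux_slit (hmod i) hp1.le (hne1 p hp1 i))
        have hw := Complex.slitPlane_ne_zero (aux_slit (hmod j) hp1.le (hne1 p hp1 j))
        have hSj : S j p = (1 - p / l j) ^ (β j - 1) *
            ∑ k ∈ Finset.range (m + 1), c j k * (1 - p / l j) ^ k := by
          rw [hS, Finset.mul_sum]
          apply Finset.sum_congr rfl
          intro k _
          rw [Complex.cpow_add _ _ hw, Complex.cpow_natCast]; ring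
        have hpow : (1 - p / l j) ^ (β j + m) =
            (1 - p / l j) ^ (β j - 1) * (1 - p / l j) ^ (m + 1) := by
          rw [← Complex.cpow_natCast, ← Complex.cpow_add _ _ hw]
          congr 1; push_cast; ring
        simp only [hgdef]
        rw [hloc j p hpD hpδ, ← Finset.add_sum_erase _ _ (Finset.mem_univ j), hSj, hAR j p, hpow]
        ring
      obtain ⟨R', H', hR', hH', h⟩ := aux_sing (hmod j) _ g _ _ (hR j) hH hg m
      obtain ⟨M, hM⟩ := aux_bdd (hmod j) (β j + m - m) (by simpa using (hβre j).le) R' H' hR' hH'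
      refine ⟨M, ?_⟩
      filter_upwards [h, hM] with q h1 h2 h3
      rw [h1 h3]; exact h2
  obtain ⟨M, hM⟩ := hbd
  have hgO := aux_cauchy g m M (fun p hp => hgan p hp.le (hne1 p hp)) hM
  set P : ℕ → ℂ → ℂ := fun r s => ∏ i ∈ Finset.range r, (s + i) with hP
  let E : ℕ → Fin N → ℂ := fun r j =>
    (∑ k ∈ Finset.range m, c j (k + 1) * (P r (1 - β j - (k + 1 : ℕ)) / P r (1 - β j))) +
      if j = j0 then iteratedDeriv r g 0 * l j ^ (r : ℤ) / P r (1 - β j) else 0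
  have hEO : E =O[atTop] fun r : ℕ => 1 / (r : ℝ) := by
    rw [isBigO_pi]
    intro j
    refine IsBigO.add (IsBigO.fun_sum fun k _ => ?_) ?_
    · exact (aux_ratio (β j) (hβint j) k).const_mul_left _
    · by_cases hj : j = j0
      · simp only [hj, if_true]
        exact aux_rem (β j0) (hβint j0) (l j0) (hmod j0) m hm _ hgO
      · simp only [hj, if_false]
        exact isBigO_zero _ _
  obtain ⟨C, hC0, hC⟩ := hEO.exists_pos
  rw [IsBigOWith, eventually_atTop] at hC
  obtain ⟨r₀, hr₀⟩ := hC
  refine ⟨C, hC0, r₀, fun r hr => ⟨E r, fun j => ?_, ?_⟩⟩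
  · refine (norm_le_pi_norm (E r) j).trans ((hr₀ r hr).trans (le_of_eq ?_))
    rw [Real.norm_of_nonneg (by positivity)]; ring
  have hP0 : ∀ j, P r (1 - β j) ≠ 0 := by
    intro j
    simp only [hP]
    rw [Finset.prod_ne_zero_iff]
    intro i _ h
    exact hβint j (i + 1) (by push_cast; linear_combination -h)
  have hGam : ∀ j, Complex.Gamma ((r : ℂ) - β j + 1) / Complex.Gamma (1 - β j) =
      P r (1 - β j) := by
    intro j
    simp only [hP]
    rw [← aux_gamma (1 - β j) (fun m h => hβint j (m + 1) (by push_cast; linear_combination -h))]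
    congr 2; ring
  have hSr : ∀ j, iteratedDeriv r (S j) 0 = l j ^ (-(r : ℤ)) *
      ∑ k ∈ Finset.range (m + 1), c j k * P r (1 - β j - k) := by
    intro j
    have hs : ∀ k : ℕ, AnalyticAt ℂ (fun p : ℂ => (1 - p / l j) ^ (β j - 1 + k)) 0 :=
      fun k => aux_an _ (aux_slit (hmod j) (by simp) (hl0 j).symm)
    have hs' : ∀ k ∈ Finset.range (m + 1),
        ContDiffAt ℂ r (fun p : ℂ => c j k * (1 - p / l j) ^ (β j - 1 + k)) 0 :=
      fun k _ => (analyticAt_const.mul (hs k)).contDiffAt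
    simp only [hS]
    rw [iteratedDeriv_fun_sum hs', Finset.mul_sum]
    apply Finset.sum_congr rfl
    intro k _
    rw [iteratedDeriv_const_mul_field, aux_main (hmod j) _ _ 0 (by simp)]
    have : -(β j - 1 + (k : ℂ)) = 1 - β j - k := by ring
    simp only [this, hP, zero_div, sub_zero, Complex.one_cpow]
    ring
  have hfr : iteratedDeriv r f 0 = (∑ j, iteratedDeriv r (S j) 0) + iteratedDeriv r g 0 := by
    have h0 : ∀ j, (0 : ℂ) ≠ l j := fun j => (hl0 j).symm
    have hs : ∀ j ∈ Finset.univ, ContDiffAt ℂ r (S j) 0 :=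
      fun j _ => (hSan j 0 (by simp) (h0 j)).contDiffAt
    rw [hgdef, iteratedDeriv_fun_sub (hfan 0 (by simp) h0).contDiffAt
      (ContDiffAt.sum hs), iteratedDeriv_fun_sum hs]
    ring
  have hterm : ∀ j, l j ^ (-(r : ℤ)) *
      (Complex.Gamma ((r : ℂ) - β j + 1) / Complex.Gamma (1 - β j)) * (A j (l j) + E r j) =
      iteratedDeriv r (S j) 0 + if j = j0 then iteratedDeriv r g 0 else 0 := by
    intro j
    rw [hGam, hSr, Finset.sum_range_succ', hc]
    simp only [E]
    have e1 : ∑ k ∈ Finset.range m, c j (k + 1) * (P r (1 - β j - (k + 1 : ℕ)) / P r (1 - β j)) =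
        (∑ k ∈ Finset.range m, c j (k + 1) * P r (1 - β j - (k + 1 : ℕ))) / P r (1 - β j) := by
      rw [Finset.sum_div]
      exact Finset.sum_congr rfl fun k _ => by ring
    rw [e1]
    have hz : l j ^ (-(r : ℤ)) * l j ^ (r : ℤ) = 1 := by
      rw [← zpow_add₀ (hl0 j)]; simp
    have hp := hP0 j
    generalize (∑ k ∈ Finset.range m, c j (k + 1) * P r (1 - β j - (k + 1 : ℕ))) = X
    simp only [Nat.cast_zero, sub_zero]
    generalize P r (1 - β j) = Y at *
    generalize l j ^ (-(r : ℤ)) = Z at *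
    generalize l j ^ (r : ℤ) = W at *
    split_ifs
    · field_simp
      linear_combination (iteratedDeriv r g 0) * hz
    · field_simp
      ring
  rw [Finset.sum_congr rfl fun j _ => hterm j, Finset.sum_add_distrib, hfr]
  simp
end

section
/- Let φ ∈ ℝ, let R ≥ 1 be an integer, and let s ∈ ℂ ∖ {0} satisfy s ∉ {t e^{iφ} : t ≥ 0} and Re(e^{iφ}/s) < 1. Then, as r → ∞ through the positive integers, ∫_0^∞ e^{−tr} (s − t e^{iφ})^{−(r+R)} dt = s^{−(r+R)} · [r (1 − e^{iφ}/s)]^{−1} · (1 + O(r^{−1})). -/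
open MeasureTheory

lemma aux_int (g : ℝ → ℂ) (A b : ℝ) (hb : 0 < b) (hg : ContinuousOn g (Set.Ici 0))
    (hA : ∀ t, 0 ≤ t → ‖g t‖ ≤ A * Real.exp (-b * t)) :
    IntegrableOn g (Set.Ioi 0) ∧ ‖∫ t in Set.Ioi (0:ℝ), g t‖ ≤ A / b := by
  have h1 : IntegrableOn (fun t : ℝ => A * Real.exp (-b * t)) (Set.Ioi 0) :=
    (integrableOn_exp_mul_Ioi (by linarith) 0).const_mul A
  have h2 : ∀ᵐ t ∂(volume.restrict (Set.Ioi (0:ℝ))), ‖g t‖ ≤ A * Real.exp (-b * t) := by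
    filter_upwards [ae_restrict_mem measurableSet_Ioi] with t ht
    exact hA t (le_of_lt ht)
  refine ⟨Integrable.mono' h1 ((hg.mono Set.Ioi_subset_Ici_self).aestronglyMeasurable
    measurableSet_Ioi) h2, ?_⟩
  refine (norm_integral_le_of_norm_le h1 h2).trans (le_of_eq ?_)
  rw [integral_const_mul, integral_exp_mul_Ioi (by linarith)]
  simp [div_eq_mul_inv]

lemma aux_ball (c : ℂ) (ρ L : ℝ) (hρ : 0 < ρ) :
    ∃ z₀ : ℂ, ∃ d : ℝ, Metric.ball z₀ d ⊆ {t : ℂ | (c * t).re < ρ} ∧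
      ∀ t : ℂ, ‖t‖ ≤ L → (c * t).re ≤ 0 → t ∈ Metric.ball z₀ d := by
  obtain ⟨M, hM0, hM⟩ : ∃ M : ℝ, 0 < M ∧ L ^ 2 < 2 * M * ρ := by
    refine ⟨(L ^ 2 + 1) / (2 * ρ), by positivity, ?_⟩
    field_simp
    linarith
  have key : ∀ t : ℂ, ‖t - (-(M : ℂ) * (starRingEnd ℂ) c)‖ ^ 2
      = ‖t‖ ^ 2 + 2 * M * (c * t).re + M ^ 2 * ‖c‖ ^ 2 := by
    intro t
    rw [Complex.sq_norm, Complex.sq_norm, Complex.sq_norm]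
    simp [Complex.normSq_apply]
    ring
  refine ⟨-(M : ℂ) * (starRingEnd ℂ) c, Real.sqrt (M ^ 2 * ‖c‖ ^ 2 + 2 * M * ρ), ?_, ?_⟩
  · intro t ht
    rw [Metric.mem_ball, dist_eq_norm, Real.lt_sqrt (norm_nonneg _), key] at ht
    simp only [Set.mem_ofPred_eq]
    have : 2 * M * (c * t).re < 2 * M * ρ := by nlinarith [sq_nonneg ‖t‖]
    exact lt_of_mul_lt_mul_left this (by positivity)
  · intro t ht hc
    rw [Metric.mem_ball, dist_eq_norm, Real.lt_sqrt (norm_nonneg _), key]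
    have h1 : ‖t‖ ^ 2 ≤ L ^ 2 := pow_le_pow_left₀ (norm_nonneg _) ht 2
    have h2 : 2 * M * (c * t).re ≤ 0 := mul_nonpos_of_nonneg_of_nonpos (by positivity) hc
    linarith

lemma aux_rot (f : ℂ → ℂ) (c w : ℂ) (ρ A b : ℝ) (hρ : 0 < ρ) (hb : 0 < b)
    (hf : DifferentiableOn ℂ f {t | (c * t).re < ρ})
    (hA : ∀ t : ℂ, (c * t).re ≤ 0 → ‖f t‖ ≤ A * Real.exp (-b * t.re))
    (hc : c.re ≤ 0) (hcw : (c * w).re ≤ 0) (hw : 0 < w.re) :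
    IntegrableOn (fun t : ℝ => f t) (Set.Ioi 0) ∧
    ∫ t in Set.Ioi (0:ℝ), f t = ∫ t in Set.Ioi (0:ℝ), w * f (t * w) := by
  have hA0 : 0 ≤ A := by
    have := (norm_nonneg _).trans (hA 0 (by simp))
    simpa using this
  have hopen : IsOpen {t : ℂ | (c * t).re < ρ} :=
    isOpen_lt (by fun_prop) continuous_const
  have hcont : ∀ v : ℂ, (c * v).re ≤ 0 → ContinuousOn (fun t : ℝ => f (t * v)) (Set.Ici 0) := by
    intro v hv
    refine hf.continuousOn.comp (by fun_prop) ?_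
    intro t ht
    have ht : (0:ℝ) ≤ t := ht
    have e : (c * (t * v)).re = t * (c * v).re := by
      rw [show c * (t * v) = (t : ℂ) * (c * v) by ring, Complex.re_ofReal_mul]
    simp only [Set.mem_ofPred_eq, e]
    nlinarith
  have hre : ∀ v : ℂ, (c * v).re ≤ 0 → ∀ t : ℝ, 0 ≤ t → (c * (t * v)).re ≤ 0 := by
    intro v hv t ht
    rw [show c * (t * v) = (t : ℂ) * (c * v) by ring, Complex.re_ofReal_mul]
    exact mul_nonpos_of_nonneg_of_nonpos ht hv
  have i1 : IntegrableOn (fun t : ℝ => f t) (Set.Ioi 0) := by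
    refine (aux_int _ A b hb ?_ ?_).1
    · simpa using hcont 1 (by simpa using hc)
    · intro t ht
      simpa using hA t (by simpa using hre 1 (by simpa using hc) t ht)
  have i2 : IntegrableOn (fun t : ℝ => w * f (t * w)) (Set.Ioi 0) := by
    refine Integrable.const_mul ?_ w
    refine (aux_int _ A (b * w.re) (by positivity) (hcont w hcw) ?_).1
    intro t ht
    convert hA _ (hre w hcw t ht) using 3
    rw [Complex.re_ofReal_mul]; ring
  refine ⟨i1, ?_⟩
  have l1 := intervalIntegral_tendsto_integral_Ioi 0 i1 Filter.tendsto_id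
  have l2 := intervalIntegral_tendsto_integral_Ioi 0 i2 Filter.tendsto_id
  have l3 := l1.sub l2
  set δ := min 1 w.re with hδ
  have hδ0 : 0 < δ := lt_min one_pos hw
  have bound : ∀ T : ℝ, 0 ≤ T →
      ‖(∫ t in (0:ℝ)..T, f t) - ∫ t in (0:ℝ)..T, w * f (t * w)‖
        ≤ A * Real.exp (-(b * δ) * T) * (T * ‖1 - w‖) := by
    intro T hT
    obtain ⟨z₀, d, hsub, hmem⟩ := aux_ball c ρ (T * (1 + ‖w‖)) hρ
    obtain ⟨P, hP⟩ := (hf.mono hsub).isExactOn_ball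
    have hray : ∀ v : ℂ, (c * v).re ≤ 0 → ‖v‖ ≤ 1 + ‖w‖ → ∀ t : ℝ, 0 ≤ t → t ≤ T →
        (t * v : ℂ) ∈ Metric.ball z₀ d := by
      intro v hv hv' t ht htT
      refine hmem _ ?_ (hre v hv t ht)
      rw [norm_mul, Complex.norm_real, Real.norm_of_nonneg ht]
      gcongr
    have hint : ∀ v : ℂ, (c * v).re ≤ 0 → ‖v‖ ≤ 1 + ‖w‖ →
        ∫ t in (0:ℝ)..T, v * f (t * v) = P (T * v) - P 0 := by
      intro v hv hv'
      have := intervalIntegral.integral_eq_sub_of_hasDerivAt (a := 0) (b := T)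
        (f := fun t : ℝ => P (t * v)) (f' := fun t : ℝ => v * f (t * v)) ?_ ?_
      · simpa using this
      · intro t ht
        rw [Set.uIcc_of_le hT] at ht
        have h1 := hP _ (hray v hv hv' t ht.1 ht.2)
        have h2 : HasDerivAt (fun t : ℝ => (t : ℂ) * v) v t := by
          simpa using (Complex.ofRealCLM.hasDerivAt (x := t)).mul_const v
        exact (h1.comp t h2).congr_deriv (mul_comm _ _)
      · apply ContinuousOn.intervalIntegrable
        rw [Set.uIcc_of_le hT]
        exact continuousOn_const.mul ((hcont v hv).mono Set.Icc_subset_Ici_self)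
    have e1 := hint 1 (by simpa using hc) (by simp)
    have e2 := hint w hcw (by simp)
    simp only [one_mul, mul_one] at e1
    rw [e1, e2, sub_sub_sub_cancel_right]
    have hseg : ∀ z ∈ segment ℝ ((T : ℂ) * w) (T : ℂ), z ∈ Metric.ball z₀ d ∧
        ‖f z‖ ≤ A * Real.exp (-(b * δ) * T) := by
      intro z hz
      constructor
      · refine (convex_ball z₀ d).segment_subset (hray w hcw (by simp) T hT le_rfl) ?_ hz
        simpa using hray 1 (by simpa using hc) (by simp) T hT le_rfl
      · obtain ⟨x, y, hx, hy, hxy, rfl⟩ := hz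
        refine (hA _ ?_).trans ?_
        · have := hre w hcw T hT
          have h2 := hre 1 (by simpa using hc) T hT
          rw [mul_one] at h2
          have : (c * (x • ((T : ℂ) * w) + y • (T : ℂ))).re
              = x * (c * (T * w)).re + y * (c * T).re := by
            rw [← Complex.re_ofReal_mul, ← Complex.re_ofReal_mul, ← Complex.add_re]
            congr 1
            simp only [Complex.real_smul]; ring
          rw [this]
          nlinarith
        · refine mul_le_mul_of_nonneg_left (Real.exp_le_exp.mpr ?_) hA0
          have e : (x • ((T : ℂ) * w) + y • (T : ℂ)).re = x * (T * w.re) + y * T := by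
            simp
          rw [e]
          have h3 : δ ≤ 1 := min_le_left _ _
          have h4 : δ ≤ w.re := min_le_right _ _
          have h5 : δ ≤ x * w.re + y := by nlinarith
          have h6 : (b * T) * δ ≤ (b * T) * (x * w.re + y) := by gcongr
          nlinarith
    have := (convex_segment (𝕜 := ℝ) ((T : ℂ) * w) (T : ℂ)).norm_image_sub_le_of_norm_hasDerivWithin_le
      (f := P) (f' := f) (fun z hz => (hP z (hseg z hz).1).hasDerivWithinAt)
      (fun z hz => (hseg z hz).2) (left_mem_segment ℝ _ _) (right_mem_segment ℝ _ _)
    refine this.trans (le_of_eq ?_)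
    rw [show (T : ℂ) - T * w = T * (1 - w) by ring, norm_mul, Complex.norm_real,
      Real.norm_of_nonneg hT]
  have hlim : Filter.Tendsto (fun T : ℝ => A * Real.exp (-(b * δ) * T) * (T * ‖1 - w‖))
      Filter.atTop (nhds 0) := by
    have h := tendsto_rpow_mul_exp_neg_mul_atTop_nhds_zero 1 (b * δ) (by positivity)
    have h' := h.const_mul (A * ‖1 - w‖)
    rw [mul_zero] at h'
    refine h'.congr fun T => ?_
    rw [Real.rpow_one]
    ring
  have l4 : Filter.Tendsto (fun T : ℝ => (∫ t in (0:ℝ)..T, f t) - ∫ t in (0:ℝ)..T, w * f (t * w))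
      Filter.atTop (nhds 0) := by
    apply squeeze_zero_norm' _ hlim
    filter_upwards [Filter.eventually_ge_atTop 0] with T hT
    exact bound T hT
  exact sub_eq_zero.mp (tendsto_nhds_unique l3 l4)

lemma aux_parts (a w : ℂ) (k r : ℕ) (hr : 1 ≤ r) (hw : 0 < w.re) (haw : (a * w).re ≤ 0)
    (ha : a.re < 1) :
    (r : ℂ) * ∫ t in Set.Ioi (0:ℝ), w * (Complex.exp (-(t * w) * r) *
        ((1 - (t * w) * a) ^ (r + k + 1))⁻¹)
      = (1 - a)⁻¹ + ∫ t in Set.Ioi (0:ℝ), Complex.exp (-(t * w) * r) * (a * w * (k *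
        ((1 - (t * w) * a) ^ (r + k + 1))⁻¹ * (1 - (t * w) * a - a)⁻¹ +
        ((1 - (t * w) * a) ^ (r + k))⁻¹ * ((1 - (t * w) * a - a) ^ 2)⁻¹)) ∧
    ‖∫ t in Set.Ioi (0:ℝ), Complex.exp (-(t * w) * r) * (a * w * (k *
        ((1 - (t * w) * a) ^ (r + k + 1))⁻¹ * (1 - (t * w) * a - a)⁻¹ +
        ((1 - (t * w) * a) ^ (r + k))⁻¹ * ((1 - (t * w) * a - a) ^ 2)⁻¹))‖
      ≤ (‖a * w‖ * (k * (1 - a.re)⁻¹ + ((1 - a.re) ^ 2)⁻¹)) / (r * w.re) := by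
  set d := 1 - a.re with hd
  have hd0 : 0 < d := by rw [hd]; linarith
  have hr0 : (0:ℝ) < r := by exact_mod_cast hr
  have hb : 0 < r * w.re := by positivity
  have hBre : ∀ t : ℝ, 0 ≤ t → 1 ≤ (1 - (t * w) * a).re := by
    intro t ht
    rw [show (t * w) * a = (t : ℂ) * (a * w) by ring, Complex.sub_re, Complex.re_ofReal_mul]
    simp only [Complex.one_re]
    nlinarith
  have hBn : ∀ t : ℝ, 0 ≤ t → 1 ≤ ‖1 - (t * w) * a‖ := fun t ht =>
    (hBre t ht).trans (Complex.re_le_norm _)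
  have hDn : ∀ t : ℝ, 0 ≤ t → d ≤ ‖1 - (t * w) * a - a‖ := fun t ht => by
    refine le_trans ?_ (Complex.re_le_norm _)
    have := hBre t ht
    rw [Complex.sub_re]; linarith
  have hB0 : ∀ t : ℝ, 0 ≤ t → 1 - (t * w) * a ≠ 0 := fun t ht h => by
    have := hBn t ht; rw [h] at this; simp at this; linarith
  have hD0 : ∀ t : ℝ, 0 ≤ t → 1 - (t * w) * a - a ≠ 0 := fun t ht h => by
    have := hDn t ht; rw [h] at this; simp at this; linarith
  have hE : ∀ t : ℝ, ‖Complex.exp (-(t * w) * r)‖ = Real.exp (-(r * w.re) * t) := by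
    intro t
    rw [Complex.norm_exp]
    congr 1
    simp; ring
  have hBi : ∀ t : ℝ, 0 ≤ t → ∀ n : ℕ, ‖((1 - (t * w) * a) ^ n)⁻¹‖ ≤ 1 := by
    intro t ht n
    rw [norm_inv, norm_pow]
    exact inv_le_one_of_one_le₀ (one_le_pow₀ (hBn t ht))
  have hDi : ∀ t : ℝ, 0 ≤ t → ‖(1 - (t * w) * a - a)⁻¹‖ ≤ d⁻¹ := by
    intro t ht
    rw [norm_inv]
    exact inv_anti₀ hd0 (hDn t ht)
  have hDi2 : ∀ t : ℝ, 0 ≤ t → ‖((1 - (t * w) * a - a) ^ 2)⁻¹‖ ≤ (d ^ 2)⁻¹ := by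
    intro t ht
    rw [norm_inv, norm_pow]
    exact inv_anti₀ (by positivity) (pow_le_pow_left₀ hd0.le (hDn t ht) 2)
  have cB : ∀ n : ℕ, ContinuousOn (fun t : ℝ => ((1 - (t * w) * a) ^ n)⁻¹) (Set.Ici 0) := by
    intro n
    refine ContinuousOn.inv₀ (by fun_prop) fun t ht => pow_ne_zero _ (hB0 t ht)
  have cD : ∀ n : ℕ, ContinuousOn (fun t : ℝ => ((1 - (t * w) * a - a) ^ n)⁻¹) (Set.Ici 0) := by
    intro n
    refine ContinuousOn.inv₀ (by fun_prop) fun t ht => pow_ne_zero _ (hD0 t ht)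
  have cD1 : ContinuousOn (fun t : ℝ => (1 - (t * w) * a - a)⁻¹) (Set.Ici 0) := by
    simpa using cD 1
  have cE : ContinuousOn (fun t : ℝ => Complex.exp (-(t * w) * r)) (Set.Ici 0) := by fun_prop
  have IF := aux_int (fun t : ℝ => w * (Complex.exp (-(t * w) * r) *
        ((1 - (t * w) * a) ^ (r + k + 1))⁻¹)) ‖w‖ (r * w.re) hb
    (continuousOn_const.mul (cE.mul (cB _))) (by
      intro t ht
      rw [norm_mul, norm_mul, hE]
      gcongr
      exact mul_le_of_le_one_right (by positivity) (hBi t ht _))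
  have IG := aux_int (fun t : ℝ => Complex.exp (-(t * w) * r) * (a * w * (k *
        ((1 - (t * w) * a) ^ (r + k + 1))⁻¹ * (1 - (t * w) * a - a)⁻¹ +
        ((1 - (t * w) * a) ^ (r + k))⁻¹ * ((1 - (t * w) * a - a) ^ 2)⁻¹)))
    (‖a * w‖ * (k * d⁻¹ + (d ^ 2)⁻¹)) (r * w.re) hb
    (cE.mul (continuousOn_const.mul (((continuousOn_const.mul (cB _)).mul cD1).add
      ((cB _).mul (cD 2))))) (by
      intro t ht
      rw [norm_mul, norm_mul (a * w), hE, mul_comm]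
      gcongr
      refine (norm_add_le _ _).trans ?_
      rw [norm_mul, norm_mul, norm_mul, Complex.norm_natCast]
      have h1 := hBi t ht (r + k + 1)
      have h2 := hBi t ht (r + k)
      have h3 := hDi t ht
      have h4 := hDi2 t ht
      gcongr
      · exact mul_le_of_le_one_right (by positivity) h1
      · exact (mul_le_of_le_one_left (by positivity) h2).trans h4)
  refine ⟨?_, IG.2⟩
  have hΦ := integral_Ioi_of_hasDerivAt_of_tendsto' (a := 0) (m := 0)
    (f := fun t : ℝ => Complex.exp (-(t * w) * r) * ((1 - (t * w) * a) ^ (r + k))⁻¹ *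
      (1 - (t * w) * a - a)⁻¹)
    (f' := fun t : ℝ => (Complex.exp (-(t * w) * r) * (a * w * (k *
        ((1 - (t * w) * a) ^ (r + k + 1))⁻¹ * (1 - (t * w) * a - a)⁻¹ +
        ((1 - (t * w) * a) ^ (r + k))⁻¹ * ((1 - (t * w) * a - a) ^ 2)⁻¹))) -
        (r : ℂ) * (w * (Complex.exp (-(t * w) * r) *
        ((1 - (t * w) * a) ^ (r + k + 1))⁻¹))) ?_ (IG.1.sub (IF.1.const_mul _)) ?_
  · rw [integral_sub IG.1 (IF.1.const_mul _), integral_const_mul] at hΦ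
    simp only [Complex.ofReal_zero, zero_mul, neg_zero, Complex.exp_zero, sub_zero, one_pow,
      inv_one, one_mul, zero_sub] at hΦ
    linear_combination -hΦ
  · intro t ht
    have hB := hB0 t ht
    have hD := hD0 t ht
    have d0 : HasDerivAt (fun t : ℝ => (t : ℂ) * w) w t := by
      simpa using (Complex.ofRealCLM.hasDerivAt (x := t)).mul_const w
    have dB : HasDerivAt (fun t : ℝ => 1 - (t : ℂ) * w * a) (-(w * a)) t :=
      (d0.mul_const a).const_sub 1
    have dD : HasDerivAt (fun t : ℝ => 1 - (t : ℂ) * w * a - a) (-(w * a)) t :=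
      dB.sub_const a
    have dE : HasDerivAt (fun t : ℝ => Complex.exp (-(t * w) * r))
        (Complex.exp (-(t * w) * r) * (-w * r)) t := (d0.neg.mul_const (r : ℂ)).cexp
    have := (dE.mul ((dB.pow (r + k)).inv (pow_ne_zero _ hB))).mul (dD.inv hD)
    refine this.congr_deriv ?_
    simp only [Pi.mul_apply, Pi.inv_apply, Pi.pow_apply]
    obtain ⟨n, rfl⟩ : ∃ n, r = n + 1 := ⟨r - 1, by omega⟩
    rw [show n + 1 + k - 1 = n + k by omega, show n + 1 + k + 1 = n + k + 2 by omega,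
      show n + 1 + k = n + k + 1 by omega]
    generalize hBB : 1 - (t : ℂ) * w * a = B at *
    generalize hDD : B - a = D at *
    generalize Complex.exp (-(t * w) * ((n + 1 : ℕ) : ℂ)) = E
    have ea : a = B - D := by rw [← hDD]; ring
    have hp : B ^ (n + k) ≠ 0 := pow_ne_zero _ hB
    simp only [pow_succ B]
    push_cast
    subst ea
    field_simp
    ring
  · have : Filter.Tendsto (fun t : ℝ => d⁻¹ * Real.exp (-(r * w.re) * t)) Filter.atTop (nhds 0) := by
      have h := (tendsto_rpow_mul_exp_neg_mul_atTop_nhds_zero 0 (r * w.re) hb).const_mul d⁻¹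
      simpa using h
    refine squeeze_zero_norm' ?_ this
    filter_upwards [Filter.eventually_ge_atTop 0] with t ht
    rw [norm_mul, norm_mul, hE, mul_comm]
    gcongr
    · exact hDi t ht
    · exact mul_le_of_le_one_right (by positivity) (hBi t ht _)

lemma aux_dir (a : ℂ) (ha : ¬ (0 ≤ a.re ∧ a.im = 0)) :
    ∃ w c : ℂ, 0 < w.re ∧ (a * w).re ≤ 0 ∧ 0 < (c / a).re ∧ c.re ≤ 0 ∧ (c * w).re ≤ 0 := by
  have ha0 : a ≠ 0 := by rintro rfl; simp at ha
  have hn : 0 < Complex.normSq a := Complex.normSq_pos.mpr ha0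
  have hq : ∀ x y : ℝ, 0 < x * a.re + y * a.im → 0 < ((⟨x, y⟩ : ℂ) / a).re := by
    intro x y h
    rw [Complex.div_re, ← add_div]
    exact div_pos h hn
  have hab := le_abs_self a.re
  rcases lt_trichotomy a.im 0 with h | h | h
  · refine ⟨⟨-a.im / (1 + |a.re|), -1⟩, ⟨0, -1⟩, ?_, ?_, hq _ _ (by linarith), by simp, by simp⟩
    · exact div_pos (by linarith) (by positivity)
    · simp only [Complex.mul_re]
      have : a.re * (-a.im / (1 + |a.re|)) ≤ -a.im := by
        rw [mul_div_assoc', div_le_iff₀ (by positivity)]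
        nlinarith
      linarith
  · refine ⟨1, ⟨-1, 0⟩, by simp, ?_, hq _ _ ?_, by simp, by simp⟩
    · have : a.re < 0 := by by_contra h'; exact ha ⟨by linarith, h⟩
      simpa using this.le
    · have : a.re < 0 := by by_contra h'; exact ha ⟨by linarith, h⟩
      linarith
  · refine ⟨⟨a.im / (1 + |a.re|), 1⟩, ⟨0, 1⟩, ?_, ?_, hq _ _ (by linarith), by simp, by simp⟩
    · exact div_pos (by linarith) (by positivity)
    · simp only [Complex.mul_re]
      have : a.re * (a.im / (1 + |a.re|)) ≤ a.im := by
        rw [mul_div_assoc', div_le_iff₀ (by positivity)]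
        nlinarith
      linarith

/-- Steepest-descent estimate: for `s ∉ {t e^{iφ} : t ≥ 0}`, `s ≠ 0`,
`Re(e^{iφ}/s) < 1`, as `r → ∞` through integers,
`∫_0^∞ e^{-tr} (s - t e^{iφ})^{-(r+R)} dt
  = s^{-(r+R)} [r(1 - e^{iφ}/s)]⁻¹ (1 + O(1/r))`. -/
theorem stmt_5 (φ : ℝ) (R : ℕ) (hR : 1 ≤ R) (s : ℂ) (hs : s ≠ 0)
    (hray : ¬ ∃ t : ℝ, 0 ≤ t ∧ s = (t : ℂ) * Complex.exp (Complex.I * φ))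
    (hre : (Complex.exp (Complex.I * φ) / s).re < 1) :
    ∃ C : ℝ, 0 < C ∧ ∃ r₀ : ℕ, ∀ r : ℕ, r₀ ≤ r →
      IntegrableOn (fun t : ℝ =>
        Complex.exp (-(t : ℂ) * r) *
          (s - (t : ℂ) * Complex.exp (Complex.I * φ)) ^ (-((r : ℤ) + R)))
        (Set.Ioi 0) ∧
      ∃ err : ℂ, ‖err‖ ≤ C / r ∧
        (∫ t in Set.Ioi (0 : ℝ),
            Complex.exp (-(t : ℂ) * r) *
              (s - (t : ℂ) * Complex.exp (Complex.I * φ)) ^ (-((r : ℤ) + R))) =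
          s ^ (-((r : ℤ) + R)) *
            ((r : ℂ) * (1 - Complex.exp (Complex.I * φ) / s))⁻¹ * (1 + err) := by
  set E := Complex.exp (Complex.I * φ) with hE
  have hE0 : E ≠ 0 := Complex.exp_ne_zero _
  set a := E / s with ha
  have ha0 : a ≠ 0 := div_ne_zero hE0 hs
  have hdir : ¬ (0 ≤ a.re ∧ a.im = 0) := by
    rintro ⟨h1, h2⟩
    apply hray
    refine ⟨a.re⁻¹, inv_nonneg.mpr h1, ?_⟩
    have : (a.re : ℂ) = a := Complex.ext (by simp) (by simp [h2])
    rw [Complex.ofReal_inv, this, ha]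
    field_simp
  obtain ⟨w, c, hw, haw, hca, hc, hcw⟩ := aux_dir a hdir
  obtain ⟨k, rfl⟩ : ∃ k, R = k + 1 := ⟨R - 1, by omega⟩
  set K := ‖a * w‖ * (k * (1 - a.re)⁻¹ + ((1 - a.re) ^ 2)⁻¹) with hK
  have h1a : 1 - a ≠ 0 := by
    intro h
    have : a = 1 := (sub_eq_zero.mp h).symm
    rw [this] at hre; simp at hre
  have hc0 : c ≠ 0 := by rintro rfl; simp at hca
  have hd0 : 0 < 1 - a.re := by linarith
  refine ⟨‖1 - a‖ * K / w.re + 1, by positivity, 1, fun r hr => ?_⟩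
  have hr0 : (0:ℝ) < r := by exact_mod_cast hr
  have hr0' : (r : ℂ) ≠ 0 := by exact_mod_cast hr0.ne'
  have hz : ∀ z : ℂ, z ^ (-((r : ℤ) + ((k + 1 : ℕ) : ℤ))) = (z ^ (r + k + 1))⁻¹ := by
    intro z
    rw [zpow_neg, ← zpow_natCast]
    push_cast
    rw [add_assoc]
  -- the normalised integrand
  set f : ℂ → ℂ := fun t => Complex.exp (-t * r) * ((1 - t * a) ^ (r + k + 1))⁻¹ with hf
  have hfun : (fun t : ℝ => Complex.exp (-(t : ℂ) * r) *
      (s - (t : ℂ) * E) ^ (-((r : ℤ) + ((k + 1 : ℕ) : ℤ)))) =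
      fun t : ℝ => (s ^ (r + k + 1))⁻¹ * f t := by
    funext t
    rw [hz, hf, show s - (t : ℂ) * E = s * (1 - t * a) by rw [ha]; field_simp, mul_pow, mul_inv]
    ring
  have hfac : ∀ t : ℂ, 1 - t * a = a / c * (c / a - c * t) := by
    intro t; field_simp
  set m := ‖a / c‖ * (c / a).re with hm
  have hm0 : 0 < m := by
    have : 0 < ‖a / c‖ := norm_pos_iff.mpr (div_ne_zero ha0 hc0)
    positivity
  have hrot := aux_rot f c w (c / a).re ((m ^ (r + k + 1))⁻¹) r hca hr0 (by
      intro t ht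
      apply DifferentiableAt.differentiableWithinAt
      have : (1 - t * a) ^ (r + k + 1) ≠ 0 := by
        apply pow_ne_zero
        rw [hfac]
        refine mul_ne_zero (div_ne_zero ha0 hc0) fun h => ?_
        have h' := congrArg Complex.re h
        simp only [Set.mem_ofPred_eq] at ht
        rw [Complex.sub_re, Complex.zero_re] at h'
        linarith
      rw [hf]
      fun_prop (disch := assumption)) (by
      intro t ht
      rw [hf]
      simp only [norm_mul, norm_inv, norm_pow]
      rw [mul_comm, Complex.norm_exp]
      have e : (-t * (r : ℂ)).re = -(r : ℝ) * t.re := by simp; ring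
      rw [e]
      gcongr
      rw [hfac, norm_mul, hm]
      gcongr
      refine le_trans ?_ (Complex.re_le_norm _)
      rw [Complex.sub_re]; linarith) hc hcw hw
  obtain ⟨hp1, hp2⟩ := aux_parts a w k r hr hw haw hre
  rw [hfun]
  refine ⟨hrot.1.const_mul _, ?_⟩
  rw [integral_const_mul, hrot.2, hz]
  rw [← hK] at hp2
  set G := ∫ t in Set.Ioi (0:ℝ), Complex.exp (-(t * w) * r) * (a * w * (k *
        ((1 - (t * w) * a) ^ (r + k + 1))⁻¹ * (1 - (t * w) * a - a)⁻¹ +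
        ((1 - (t * w) * a) ^ (r + k))⁻¹ * ((1 - (t * w) * a - a) ^ 2)⁻¹)) with hG
  refine ⟨(1 - a) * G, ?_, ?_⟩
  · rw [norm_mul]
    calc ‖1 - a‖ * ‖G‖ ≤ ‖1 - a‖ * (K / (r * w.re)) := by gcongr
      _ = (‖1 - a‖ * K / w.re) / r := by field_simp
      _ ≤ _ := by gcongr; linarith
  · have : (∫ t in Set.Ioi (0:ℝ), w * f (t * w)) = (r : ℂ)⁻¹ * ((1 - a)⁻¹ + G) := by
      rw [← hp1, inv_mul_cancel_left₀ hr0']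
    rw [this]
    field_simp
end

section
/- Suppose f has standard singularity data (λ_j, β_j, A_j, B_j, ε, δ) with N singular points, and suppose in addition there are φ ∈ ℝ, η ∈ (0, π/2), C > 0, ν > 0 such that |arg(λ_j e^{−iφ})| > η (mod 2π) for every j, and f extends analytically to U = {p : |p| > 1/2, |arg(p e^{−iφ})| < η} with |f(p)| ≤ C·exp(ν|p|) on U. Set β₀ = min_j Re β_j. Then there exist C′ > 0 and r₀ ∈ ℕ such that for every integer r ≥ r₀, with x = r e^{−iφ}: |∫_0^{∞e^{iφ}} f(p) e^{−xp} dp − ∑_{k=0}^{r} f⁽ᵏ⁾(0) x^{−k−1}| ≤ C′ · r! · r^{−β₀} · r^{−r−1}; that is, truncation of the asymptotic series at the term of index r = |x| approximates the Laplace integral to the order of magnitude of its least term. -/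
open MeasureTheory Real

lemma aux_norm (l z : ℂ) (ρ : ℝ) (hl : ‖l‖ = 1) (hz : ‖z‖ = ρ) :
    ‖z - (ρ:ℂ)^2 * l‖ ^ 2 = ρ ^ 2 * ‖z - l‖ ^ 2 := by
  have h1 : l.re^2 + l.im^2 = 1 := by
    have := Complex.sq_norm l; rw [hl, Complex.normSq_apply] at this; nlinarith
  have h2 : z.re^2 + z.im^2 = ρ^2 := by
    have := Complex.sq_norm z; rw [hz, Complex.normSq_apply] at this; nlinarith
  rw [Complex.sq_norm, Complex.sq_norm, Complex.normSq_apply, Complex.normSq_apply]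
  have e : (ρ:ℂ)^2 * l = ((ρ^2 : ℝ) : ℂ) * l := by push_cast; ring
  rw [e]
  simp only [Complex.sub_re, Complex.sub_im, Complex.re_ofReal_mul, Complex.im_ofReal_mul]
  linear_combination (ρ^4-ρ^2) * h1 + (1-ρ^2)*h2

lemma aux_poisson (l : ℂ) (ρ : ℝ) (hl : ‖l‖ = 1) (h0 : 0 < ρ) (h1 : ρ < 1) :
    ∫ θ in (0:ℝ)..(2*π), (‖circleMap 0 ρ θ - l‖ ^ 2)⁻¹ = 2 * π / (1 - ρ^2) := by
  have hw : (ρ:ℂ)^2 * l ∈ Metric.ball (0:ℂ) ρ := by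
    simp [hl, abs_of_pos h0]; nlinarith
  have h := DiffContOnCl.circleAverage_poissonKernel_smul (f := fun _ : ℂ => (1:ℂ)) (c := 0) (R := ρ)
    (w := (ρ:ℂ)^2 * l) diffContOnCl_const hw
  have key : ∀ θ : ℝ, poissonKernel 0 ((ρ:ℂ)^2 * l) (circleMap 0 ρ θ) = (1 - ρ^2) * (‖circleMap 0 ρ θ - l‖ ^ 2)⁻¹ := by
    intro θ
    have hz : ‖circleMap 0 ρ θ‖ = ρ := by simp [abs_of_pos h0]
    have := aux_norm l (circleMap 0 ρ θ) ρ hl hz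
    have hne : ‖circleMap 0 ρ θ - l‖ ≠ 0 := by
      rw [norm_ne_zero_iff, sub_ne_zero]; intro h'; rw [h', hl] at hz; linarith
    rw [poissonKernel_def]; simp only [sub_zero]; rw [this, hz]
    have : ‖(ρ:ℂ)^2 * l‖ = ρ^2 := by simp [hl]
    rw [this]; field_simp
  rw [Real.circleAverage_def] at h
  simp only [Pi.smul_apply', key, Complex.real_smul, mul_one] at h
  rw [intervalIntegral.integral_ofReal, ← Complex.ofReal_mul] at h
  have h' := Complex.ofReal_injective (h.trans Complex.ofReal_one.symm)
  rw [intervalIntegral.integral_const_mul] at h'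
  have : 1 - ρ^2 ≠ 0 := by nlinarith
  have hpi := Real.pi_pos
  field_simp at h' ⊢
  linarith

lemma aux_coeff {N : ℕ} (l : Fin N → ℂ) (hl : ∀ j, ‖l j‖ = 1) (F : ℂ → ℂ) (M s : ℝ) (hs : 2 ≤ s) (hM : 0 ≤ M)
    (hF : DifferentiableOn ℂ F (Metric.ball 0 1))
    (hb : ∀ p ∈ Metric.ball (0:ℂ) 1, ‖F p‖ ≤ M * ∑ j, ‖p - l j‖ ^ (-s)) (n : ℕ) :
    ‖iteratedDeriv n F 0‖ / n.factorial ≤ Real.exp 1 * M * N * ((n:ℝ)+2) ^ (s - 1) := by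
  set ρ : ℝ := 1 - 1 / (n+2) with hρ
  have hn : (0:ℝ) ≤ n := n.cast_nonneg
  have e1 : 1 - ρ = 1 / (n+2) := by rw [hρ]; ring
  have h0 : 0 < ρ := by
    rw [hρ, sub_pos, div_lt_one (by positivity)]; linarith
  have h1 : ρ < 1 := by
    have : 0 < (1:ℝ)/(n+2) := by positivity
    linarith
  have hsub : Metric.closedBall (0:ℂ) ρ ⊆ Metric.ball 0 1 := Metric.closedBall_subset_ball h1
  have hC := DifferentiableOn.circleIntegral_one_div_sub_center_pow_smul h0 n (hF.mono hsub)
  have hpi := Real.pi_pos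
  have hne : ∀ j θ, circleMap 0 ρ θ - l j ≠ 0 := by
    intro j θ
    rw [sub_ne_zero]; intro h'
    have hz : ‖circleMap 0 ρ θ‖ = ρ := by simp [abs_of_pos h0]
    rw [h', hl] at hz; linarith
  have hge : ∀ j θ, 1 - ρ ≤ ‖circleMap 0 ρ θ - l j‖ := by
    intro j θ
    have hz : ‖circleMap 0 ρ θ‖ = ρ := by simp [abs_of_pos h0]
    have := norm_sub_norm_le (l j) (circleMap 0 ρ θ)
    rw [hl, hz, norm_sub_rev] at this; exact this
  have hpt : ∀ θ : ℝ, ‖deriv (circleMap 0 ρ) θ • ((1 / (circleMap 0 ρ θ - 0) ^ (n+1)) • F (circleMap 0 ρ θ))‖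
      ≤ ρ⁻¹ ^ n * (M * ((1-ρ) ^ (2 - s)) * ∑ j, (‖circleMap 0 ρ θ - l j‖ ^ 2)⁻¹) := by
    intro θ
    have hz : ‖circleMap 0 ρ θ‖ = ρ := by simp [abs_of_pos h0]
    have hF1 : ‖F (circleMap 0 ρ θ)‖ ≤ M * ((1-ρ) ^ (2 - s)) * ∑ j, (‖circleMap 0 ρ θ - l j‖ ^ 2)⁻¹ := by
      refine (hb _ (by simp [hz, h1, abs_of_pos h0])).trans ?_
      rw [mul_assoc, Finset.mul_sum (f := fun j => (‖circleMap 0 ρ θ - l j‖ ^ 2)⁻¹)]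
      refine mul_le_mul_of_nonneg_left (Finset.sum_le_sum fun j _ => ?_) hM
      have hp : 0 < ‖circleMap 0 ρ θ - l j‖ := norm_pos_iff.2 (hne j θ)
      have : ‖circleMap 0 ρ θ - l j‖ ^ (-s) = ‖circleMap 0 ρ θ - l j‖ ^ (2-s) * (‖circleMap 0 ρ θ - l j‖ ^ 2)⁻¹ := by
        rw [← Real.rpow_natCast, ← Real.rpow_neg hp.le, ← Real.rpow_add hp]; congr 1; push_cast; ring
      rw [this]
      refine mul_le_mul_of_nonneg_right ?_ (by positivity)
      exact Real.rpow_le_rpow_of_nonpos (by linarith) (hge j θ) (by linarith)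
    simp only [deriv_circleMap, norm_smul, norm_mul, sub_zero, norm_div, norm_pow, hz, norm_one, Complex.norm_I, mul_one]
    calc _ = ρ⁻¹ ^ n * ‖F (circleMap 0 ρ θ)‖ := by rw [pow_succ, inv_pow]; simp [abs_of_pos h0]; field_simp
      _ ≤ _ := by gcongr
  have hint : ∀ j, IntervalIntegrable (fun θ => (‖circleMap 0 ρ θ - l j‖ ^ 2)⁻¹) volume 0 (2*π) := by
    intro j
    apply Continuous.intervalIntegrable
    refine Continuous.inv₀ (by fun_prop) ?_
    intro θ; exact pow_ne_zero _ (norm_ne_zero_iff.2 (hne j θ))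
  have hI : ‖∮ z in C(0, ρ), (1 / (z - 0) ^ (n+1)) • F z‖ ≤ ρ⁻¹ ^ n * (M * ((1-ρ) ^ (2 - s)) * (N * (2 * π / (1 - ρ^2)))) := by
    rw [circleIntegral]
    refine (intervalIntegral.norm_integral_le_of_norm_le (by positivity) (Filter.Eventually.of_forall fun θ _ => hpt θ) ?_).trans ?_
    · apply IntervalIntegrable.const_mul
      apply IntervalIntegrable.const_mul
      have := IntervalIntegrable.sum Finset.univ (fun j _ => hint j)
      simpa [Finset.sum_fn] using this
    · rw [intervalIntegral.integral_const_mul, intervalIntegral.integral_const_mul, intervalIntegral.integral_finsetSum (fun j _ => hint j)]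
      simp [aux_poisson _ ρ (hl _) h0 h1]
  rw [hC] at hI
  have hfac : (0:ℝ) < n.factorial := by positivity
  have e2 : ‖(2 * π * Complex.I / n.factorial : ℂ) • iteratedDeriv n F 0‖ = 2 * π * (‖iteratedDeriv n F 0‖ / n.factorial) := by
    simp [norm_smul, abs_of_pos hpi]; ring
  rw [e2] at hI
  have h3 : ρ⁻¹ ^ n ≤ Real.exp 1 := by
    have : ρ⁻¹ = 1 + 1/(n+1) := by
      apply inv_eq_of_mul_eq_one_right; rw [hρ]; field_simp; ring
    rw [this]
    calc (1 + 1/((n:ℝ)+1))^n ≤ (Real.exp (1/(n+1)))^n := by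
          gcongr; rw [add_comm]; exact Real.add_one_le_exp _
      _ = Real.exp (n * (1/(n+1))) := by rw [← Real.exp_nat_mul]
      _ ≤ _ := by
        apply Real.exp_le_exp.2; rw [mul_one_div, div_le_one (by positivity)]; linarith
  have h4 : 2 * π / (1-ρ^2) ≤ 2 * π * (1-ρ)⁻¹ := by
    rw [div_eq_mul_inv]; gcongr
    nlinarith
  have h5 : (1-ρ)^(2-s) * (1-ρ)⁻¹ = ((n:ℝ)+2)^(s-1) := by
    have hp : 0 < 1 - ρ := by linarith
    rw [← Real.rpow_neg_one (1-ρ), ← Real.rpow_add hp, e1, one_div, Real.inv_rpow (by positivity), ← Real.rpow_neg (by positivity)]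
    congr 1; ring
  have : 2 * π * (‖iteratedDeriv n F 0‖ / n.factorial) ≤ 2 * π * (Real.exp 1 * M * N * ((n:ℝ)+2) ^ (s - 1)) := by
    refine hI.trans ?_
    calc _ ≤ Real.exp 1 * (M * ((1-ρ) ^ (2 - s)) * (N * (2 * π * (1-ρ)⁻¹))) := by
          have : 0 ≤ (1-ρ)^(2-s) := Real.rpow_nonneg (by linarith) _
          have : 0 < 2 * π / (1-ρ^2) := div_pos (by positivity) (by nlinarith)
          gcongr
      _ = _ := by rw [← h5]; ring
  exact le_of_mul_le_mul_left this (by positivity)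

lemma aux_rpow (d y e : ℝ) (hd : 0 < d) (h1 : d / 2 ≤ y) (h2 : y ≤ 2 * d) : y ^ e ≤ 2 ^ |e| * d ^ e := by
  rcases le_total 0 e with he | he
  · rw [abs_of_nonneg he, ← Real.mul_rpow (by norm_num) hd.le]
    exact Real.rpow_le_rpow (by linarith) h2 he
  · rw [abs_of_nonpos he, Real.rpow_neg (by norm_num), ← Real.inv_rpow (by norm_num), ← Real.mul_rpow (by norm_num) hd.le]
    exact Real.rpow_le_rpow_of_nonpos (by linarith) (by linarith) he

lemma aux_slit_s8 (w v : ℂ) (hw : 0 < w.re) (hv : ‖v - w‖ ≤ ‖w‖ / 2) : v ∈ Complex.slitPlane := by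
  rw [Complex.mem_slitPlane_iff]
  by_contra h
  push Not at h
  have h0 : 0 < ‖w‖ := norm_pos_iff.2 (by rintro rfl; simp at hw)
  have h1 := Complex.sq_norm w
  have h2 := Complex.sq_norm (v - w)
  rw [Complex.normSq_apply] at h1 h2
  simp only [Complex.sub_re, Complex.sub_im, h.2] at h2
  nlinarith [norm_nonneg (v - w), mul_nonneg (sub_nonneg.2 h.1) hw.le, h.1, sq_nonneg v.re]

lemma aux_local (l β : ℂ) (hl : ‖l‖ = 1) (A B : ℂ → ℂ) (δ : ℝ) (hδ0 : 0 < δ) (hδ : δ < 1) (K : ℕ) (β₀ : ℝ)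
    (hβ : β₀ ≤ β.re) (hK : β₀ ≤ K + 1)
    (hA : DifferentiableOn ℂ A {p : ℂ | ‖p - l‖ < δ})
    (hB : DifferentiableOn ℂ B {p : ℂ | ‖p - l‖ < δ}) :
    ∃ M : ℝ, 0 ≤ M ∧ ∀ p : ℂ, ‖p‖ < 1 → ‖p - l‖ < δ / 4 →
      ‖iteratedDeriv K (fun q => (1 - q / l) ^ (β - 1) * A q + B q) p‖ ≤ M * ‖p - l‖ ^ (-((K:ℝ) + 1 - β₀)) := by
  have hball : {p : ℂ | ‖p - l‖ < δ} = Metric.ball l δ := by ext; simp [dist_eq_norm]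
  rw [hball] at hA hB
  have hcb : Metric.closedBall l (δ/2) ⊆ Metric.ball l δ := Metric.closedBall_subset_ball (by linarith)
  obtain ⟨MA, hMA⟩ := (isCompact_closedBall l (δ/2)).exists_bound_of_continuousOn (hA.continuousOn.mono hcb)
  obtain ⟨MB, hMB⟩ := (isCompact_closedBall l (δ/2)).exists_bound_of_continuousOn (hB.continuousOn.mono hcb)
  have hMA0 : 0 ≤ MA := (norm_nonneg _).trans (hMA l (by simp; linarith))
  have hMB0 : 0 ≤ MB := (norm_nonneg _).trans (hMB l (by simp; linarith))
  have hl0 : l ≠ 0 := by rintro rfl; simp at hl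
  set e := β.re - 1 with he
  have hwn : ∀ q : ℂ, ‖1 - q / l‖ = ‖q - l‖ := by
    intro q
    have : 1 - q / l = (l - q) / l := by field_simp
    rw [this, norm_div, hl, div_one, norm_sub_rev]
  refine ⟨K.factorial * (2 ^ |e| * Real.exp (π * |β.im|) * MA) * 2 ^ K + K.factorial * MB / (δ/4)^K, by positivity, ?_⟩
  intro p hp hpl
  have hwre : 0 < (1 - p / l).re := by
    have h1 : ‖p / l‖ < 1 := by rw [norm_div, hl, div_one]; exact hp
    have h2 := (Complex.re_le_norm (p / l))
    simp only [Complex.sub_re, Complex.one_re]; linarith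
  set d := ‖p - l‖ with hd
  have hd0 : 0 < d := by
    rw [hd, ← hwn]; exact norm_pos_iff.2 (by intro h; rw [h] at hwre; simp at hwre)
  have hslit : ∀ q ∈ Metric.closedBall p (d/2), 1 - q / l ∈ Complex.slitPlane := by
    intro q hq
    apply aux_slit_s8 _ _ hwre
    rw [hwn]
    have : 1 - q / l - (1 - p / l) = (p - q) / l := by ring
    rw [this, norm_div, hl, div_one, norm_sub_rev]
    simpa [dist_eq_norm] using hq
  have hdist : ∀ q ∈ Metric.closedBall p (d/2), d / 2 ≤ ‖q - l‖ ∧ ‖q - l‖ ≤ 3/2 * d := by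
    intro q hq
    have h0 : ‖q - p‖ ≤ d/2 := by simpa [dist_eq_norm] using hq
    constructor
    · have := norm_sub_le_norm_sub_add_norm_sub p q l
      rw [norm_sub_rev p q] at this; linarith
    · have := norm_sub_le_norm_sub_add_norm_sub q p l
      linarith
  have hin : ∀ q ∈ Metric.closedBall p (d/2), q ∈ Metric.closedBall l (δ/2) := by
    intro q hq
    have := (hdist q hq).2
    simp [dist_eq_norm]; linarith
  have hG : DifferentiableOn ℂ (fun q => (1 - q / l) ^ (β - 1) * A q) (Metric.closedBall p (d/2)) := by
    refine DifferentiableOn.mul ?_ (hA.mono fun q hq => hcb (hin q hq))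
    refine DifferentiableOn.cpow_const ?_ ?_
    · fun_prop
    · exact hslit
  have hGb : ∀ q ∈ Metric.sphere p (d/2), ‖(1 - q / l) ^ (β - 1) * A q‖ ≤ 2 ^ |e| * Real.exp (π * |β.im|) * MA * d ^ e := by
    intro q hq
    have hq' := Metric.sphere_subset_closedBall hq
    have h1 := hMA q (hin q hq')
    have h2 : ‖(1 - q / l) ^ (β - 1)‖ ≤ 2 ^ |e| * d ^ e * Real.exp (π * |β.im|) := by
      refine (Complex.norm_cpow_le _ _).trans ?_
      rw [hwn, div_eq_mul_inv, ← Real.exp_neg]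
      have h3 := hdist q hq'
      have h4 : ‖q - l‖ ^ (β - 1).re ≤ 2 ^ |e| * d ^ e := by
        have : (β - 1).re = e := by simp [he]
        rw [this]
        exact aux_rpow d _ e hd0 h3.1 (by linarith)
      have h5 : -((1 - q / l).arg * (β - 1).im) ≤ π * |β.im| := by
        refine (neg_le_abs _).trans ?_
        rw [abs_mul]
        have : (β - 1).im = β.im := by simp
        rw [this]
        gcongr
        exact Complex.abs_arg_le_pi _
      gcongr
    rw [norm_mul]
    calc _ ≤ 2 ^ |e| * d ^ e * Real.exp (π * |β.im|) * MA := by gcongr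
      _ = _ := by ring
  have c1 := Complex.norm_iteratedDeriv_le_of_forall_mem_sphere_norm_le K (half_pos hd0)
    (hG.diffContOnCl_ball subset_rfl) hGb
  have hpB : Metric.closedBall p (δ/4) ⊆ Metric.closedBall l (δ/2) := by
    intro q hq
    have h0 : ‖q - p‖ ≤ δ/4 := by simpa [dist_eq_norm] using hq
    have := norm_sub_le_norm_sub_add_norm_sub q p l
    simp [dist_eq_norm]; linarith
  have c2 := Complex.norm_iteratedDeriv_le_of_forall_mem_sphere_norm_le K (show 0 < δ/4 by linarith)
    ((hB.mono (hpB.trans hcb)).diffContOnCl_ball subset_rfl) (fun q hq => hMB q (hpB (Metric.sphere_subset_closedBall hq)))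
  have ca : ContDiffAt ℂ K (fun q => (1 - q / l) ^ (β - 1) * A q) p :=
    (hG.analyticAt (Metric.closedBall_mem_nhds _ (half_pos hd0))).contDiffAt
  have cb : ContDiffAt ℂ K B p :=
    ((hB.mono (hpB.trans hcb)).analyticAt (Metric.closedBall_mem_nhds _ (by linarith))).contDiffAt
  rw [iteratedDeriv_fun_add ca cb]
  refine (norm_add_le _ _).trans ?_
  rw [add_mul]
  have hd1 : d ≤ 1 := by linarith
  refine add_le_add (c1.trans ?_) (c2.trans ?_)
  · have e1 : d ^ e / (d/2)^K = 2 ^ K * d ^ (e - K) := by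
      rw [Real.rpow_sub hd0 e K, Real.rpow_natCast, div_pow]; field_simp
    have e2 : d ^ (e - K) ≤ d ^ (-((K:ℝ) + 1 - β₀)) :=
      Real.rpow_le_rpow_of_exponent_ge hd0 hd1 (by rw [he]; linarith)
    calc _ = K.factorial * (2 ^ |e| * Real.exp (π * |β.im|) * MA) * (d ^ e / (d/2)^K) := by ring
      _ = K.factorial * (2 ^ |e| * Real.exp (π * |β.im|) * MA) * 2 ^ K * d ^ (e - K) := by rw [e1]; ring
      _ ≤ _ := by gcongr
  · apply le_mul_of_one_le_right (by positivity)
    exact Real.one_le_rpow_of_pos_of_le_one_of_nonpos hd0 hd1 (by linarith)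

lemma aux_open {N : ℕ} (l : Fin N → ℂ) (hl : ∀ j, ‖l j‖ = 1) (ε : ℝ) :
    IsOpen ({p : ℂ | ‖p‖ < 1 + ε} \
        ⋃ j, {q : ℂ | ∃ t : ℝ, 1 ≤ t ∧ t < 1 + ε ∧ q = (t : ℂ) * l j}) := by
  have h : ({p : ℂ | ‖p‖ < 1 + ε} \
        ⋃ j, {q : ℂ | ∃ t : ℝ, 1 ≤ t ∧ t < 1 + ε ∧ q = (t : ℂ) * l j}) =
      {p : ℂ | ‖p‖ < 1 + ε} \ ⋃ j, {q : ℂ | 1 ≤ ‖q‖ ∧ q = (‖q‖ : ℂ) * l j} := by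
    ext p
    simp only [Set.mem_sdiff, Set.mem_setOf_eq, Set.mem_iUnion, not_exists]
    refine and_congr_right fun hp => forall_congr' fun j => ?_
    constructor
    · rintro h ⟨h1, h2⟩
      exact h ‖p‖ ⟨h1, hp, h2⟩
    · rintro h t ⟨h1, h2, h3⟩
      have : ‖p‖ = t := by rw [h3, norm_mul, hl]; simp; linarith
      exact h ⟨by rw [this]; exact h1, by rw [this]; exact h3⟩
  rw [h]
  refine (isOpen_lt (by fun_prop) (by fun_prop)).sdiff (isClosed_iUnion_of_finite fun j => ?_)
  have h1 : IsClosed {q : ℂ | 1 ≤ ‖q‖} := isClosed_le (by fun_prop) (by fun_prop)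
  have h2 : IsClosed {q : ℂ | q = (‖q‖ : ℂ) * l j} := isClosed_eq (by fun_prop) (by fun_prop)
  exact h1.inter h2

lemma aux_iter (f : ℂ → ℂ) (D : Set ℂ) (hD : IsOpen D) (hf : DifferentiableOn ℂ f D) (K : ℕ) :
    DifferentiableOn ℂ (iteratedDeriv K f) D := by
  induction K with
  | zero => simpa using hf
  | succ k ih => rw [iteratedDeriv_succ]; exact ih.deriv hD

lemma aux_deriv_bound (N : ℕ) (hN : 1 ≤ N)
    (l β : Fin N → ℂ) (A B : Fin N → ℂ → ℂ) (ε δ : ℝ) (f : ℂ → ℂ)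
    (hmod : ∀ j, ‖l j‖ = 1)
    (hε : 0 < ε) (hεδ : ε < δ) (hδ : δ < 1)
    (D : Set ℂ)
    (hD : D = {p : ℂ | ‖p‖ < 1 + ε} \
        ⋃ j, {q : ℂ | ∃ t : ℝ, 1 ≤ t ∧ t < 1 + ε ∧ q = (t : ℂ) * l j})
    (hf : DifferentiableOn ℂ f D)
    (hA : ∀ j, DifferentiableOn ℂ (A j) {p : ℂ | ‖p - l j‖ < δ})
    (hB : ∀ j, DifferentiableOn ℂ (B j) {p : ℂ | ‖p - l j‖ < δ})
    (hloc : ∀ j, ∀ p ∈ D, ‖p - l j‖ < δ →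
      f p = (1 - p / l j) ^ (β j - 1) * A j p + B j p)
    (β₀ : ℝ) (hβ₀ : ∀ j, β₀ ≤ (β j).re) (K : ℕ) (hK : β₀ ≤ K + 1)
    (hball : ∀ p : ℂ, ‖p‖ ≤ 1 → (∀ j, p ≠ l j) → p ∈ D) :
    ∃ M : ℝ, 0 ≤ M ∧ ∀ p ∈ Metric.ball (0:ℂ) 1, ‖iteratedDeriv K f p‖ ≤ M * ∑ j, ‖p - l j‖ ^ (-((K:ℝ) + 1 - β₀)) := by
  have hDo : IsOpen D := hD ▸ aux_open l hmod ε
  choose M hM0 hM using fun j => aux_local (l j) (β j) (hmod j) (A j) (B j) δ (hε.trans hεδ) hδ K β₀ (hβ₀ j) hK (hA j) (hB j)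
  set S : Set ℂ := Metric.closedBall 0 1 \ ⋃ j, Metric.ball (l j) (δ/4) with hS
  have hSc : IsCompact S := (isCompact_closedBall (0:ℂ) 1).diff (isOpen_iUnion fun j => Metric.isOpen_ball)
  have hSD : S ⊆ D := by
    rintro p ⟨hp1, hp2⟩
    refine hball p (by simpa using hp1) ?_
    rintro j rfl
    exact hp2 (Set.mem_iUnion.2 ⟨j, Metric.mem_ball_self (by linarith)⟩)
  obtain ⟨M₀, hM₀⟩ := hSc.exists_bound_of_continuousOn ((aux_iter f D hDo hf K).continuousOn.mono hSD)
  set s : ℝ := (K:ℝ) + 1 - β₀ with hs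
  have hs0 : 0 ≤ s := by linarith
  have hMs : 0 ≤ ∑ j, M j := Finset.sum_nonneg fun j _ => hM0 j
  refine ⟨∑ j, M j + |M₀| * 2 ^ s, by positivity, ?_⟩
  intro p hp
  have hp1 : ‖p‖ < 1 := by simpa using hp
  have hpos : ∀ j, 0 < ‖p - l j‖ := by
    intro j; rw [norm_pos_iff, sub_ne_zero]; rintro rfl; rw [hmod] at hp1; linarith
  have hpD : p ∈ D := hball p hp1.le (by rintro j rfl; rw [hmod] at hp1; linarith)
  have hterm : ∀ j, ‖p - l j‖ ^ (-s) ≤ ∑ j, ‖p - l j‖ ^ (-s) := fun j =>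
    Finset.single_le_sum (f := fun j => ‖p - l j‖ ^ (-s)) (fun i _ => by positivity) (Finset.mem_univ j)
  by_cases h : ∃ j, ‖p - l j‖ < δ / 4
  · obtain ⟨j, hj⟩ := h
    have hev : f =ᶠ[nhds p] fun q => (1 - q / l j) ^ (β j - 1) * A j q + B j q := by
      have h1 : D ∩ Metric.ball (l j) δ ∈ nhds p :=
        (hDo.inter Metric.isOpen_ball).mem_nhds ⟨hpD, by simp [dist_eq_norm]; linarith⟩
      filter_upwards [h1] with q hq
      exact hloc j q hq.1 (by simpa [dist_eq_norm] using hq.2)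
    rw [hev.iteratedDeriv_eq]
    refine (hM j p hp1 hj).trans ?_
    have : M j ≤ ∑ j, M j := Finset.single_le_sum (fun i _ => hM0 i) (Finset.mem_univ j)
    have h3 : 0 ≤ |M₀| * 2 ^ s := by positivity
    exact mul_le_mul (by linarith) (hterm j) (by positivity) (by linarith)
  · push Not at h
    have hpS : p ∈ S := by
      refine ⟨by simpa using hp1.le, ?_⟩
      simp only [Set.mem_iUnion, not_exists]
      intro j hj
      have := h j
      simp [dist_eq_norm] at hj; linarith
    refine (hM₀ p hpS).trans ?_
    let j : Fin N := ⟨0, hN⟩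
    have h1 : ‖p - l j‖ ≤ 2 := by
      refine (norm_sub_le _ _).trans ?_
      rw [hmod]; linarith
    have h2 : (2:ℝ) ^ (-s) ≤ ‖p - l j‖ ^ (-s) := Real.rpow_le_rpow_of_nonpos (hpos j) h1 (by linarith)
    calc M₀ ≤ |M₀| * 2 ^ s * 2 ^ (-s) := by
          rw [mul_assoc, ← Real.rpow_add (by norm_num)]; simp [le_abs_self]
      _ ≤ |M₀| * 2 ^ s * ∑ j, ‖p - l j‖ ^ (-s) := by
          gcongr; exact h2.trans (hterm j)
      _ ≤ _ := by
          gcongr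
          linarith

lemma aux_coeff_bound (N : ℕ) (hN : 1 ≤ N)
    (l β : Fin N → ℂ) (A B : Fin N → ℂ → ℂ) (ε δ : ℝ) (f : ℂ → ℂ)
    (hmod : ∀ j, ‖l j‖ = 1)
    (hε : 0 < ε) (hεδ : ε < δ) (hδ : δ < 1)
    (D : Set ℂ)
    (hD : D = {p : ℂ | ‖p‖ < 1 + ε} \
        ⋃ j, {q : ℂ | ∃ t : ℝ, 1 ≤ t ∧ t < 1 + ε ∧ q = (t : ℂ) * l j})
    (hf : DifferentiableOn ℂ f D)
    (hA : ∀ j, DifferentiableOn ℂ (A j) {p : ℂ | ‖p - l j‖ < δ})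
    (hB : ∀ j, DifferentiableOn ℂ (B j) {p : ℂ | ‖p - l j‖ < δ})
    (hloc : ∀ j, ∀ p ∈ D, ‖p - l j‖ < δ →
      f p = (1 - p / l j) ^ (β j - 1) * A j p + B j p)
    (β₀ : ℝ) (hβ₀ : ∀ j, β₀ ≤ (β j).re) (hb0 : 0 < β₀)
    (hball : ∀ p : ℂ, ‖p‖ ≤ 1 → (∀ j, p ≠ l j) → p ∈ D) :
    ∃ M : ℝ, 0 < M ∧ ∀ k : ℕ, ‖iteratedDeriv k f 0‖ / k.factorial ≤ M * ((k:ℝ)+1) ^ (-β₀) := by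
  obtain ⟨K, hK⟩ := exists_nat_ge (β₀ + 1)
  obtain ⟨M, hM0, hM⟩ := aux_deriv_bound N hN l β A B ε δ f hmod hε hεδ hδ D hD hf hA hB hloc β₀ hβ₀ K (by linarith) hball
  have hDo : IsOpen D := hD ▸ aux_open l hmod ε
  have hbD : Metric.ball (0:ℂ) 1 ⊆ D := by
    intro p hp
    have hp1 : ‖p‖ < 1 := by simpa using hp
    exact hball p hp1.le (by rintro j rfl; rw [hmod] at hp1; linarith)
  have hc := aux_coeff l hmod (iteratedDeriv K f) M (K + 1 - β₀) (by linarith) hM0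
    ((aux_iter f D hDo hf K).mono hbD) hM
  set M1 := Real.exp 1 * M * N with hM1
  have hM10 : 0 ≤ M1 := by positivity
  -- large indices
  have hlarge : ∀ n : ℕ, ‖iteratedDeriv (n + K) f 0‖ / (n + K).factorial ≤
      (M1 * 2 ^ ((K:ℝ) - β₀) * (K+1) ^ β₀) * (((n + K : ℕ):ℝ)+1) ^ (-β₀) := by
    intro n
    have h1 := hc n
    have e1 : iteratedDeriv n (iteratedDeriv K f) 0 = iteratedDeriv (n + K) f 0 := by
      rw [iteratedDeriv_eq_iterate, iteratedDeriv_eq_iterate, iteratedDeriv_eq_iterate, Function.iterate_add_apply]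
    rw [e1] at h1
    have h2 : ((n.factorial : ℝ) * ((n:ℝ) + 1) ^ K) ≤ (n + K).factorial := by
      exact_mod_cast Nat.factorial_mul_pow_le_factorial
    have hn0 : (0:ℝ) ≤ n := n.cast_nonneg
    have hn1 : (0:ℝ) < (n:ℝ) + 1 := by positivity
    have h3 : ‖iteratedDeriv (n + K) f 0‖ / (n + K).factorial ≤ ‖iteratedDeriv (n + K) f 0‖ / n.factorial / ((n:ℝ)+1)^K := by
      rw [div_div]; gcongr
    have h4 : ((n:ℝ)+2) ^ ((K:ℝ) + 1 - β₀ - 1) ≤ 2 ^ ((K:ℝ) - β₀) * ((n:ℝ)+1)^((K:ℝ) - β₀) := by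
      rw [← Real.mul_rpow (by norm_num) hn1.le]
      have : (K:ℝ) + 1 - β₀ - 1 = K - β₀ := by ring
      rw [this]
      exact Real.rpow_le_rpow (by positivity) (by linarith) (by linarith)
    have h5 : ((n:ℝ)+1)^((K:ℝ) - β₀) / ((n:ℝ)+1)^K = ((n:ℝ)+1)^(-β₀) := by
      rw [← Real.rpow_natCast, ← Real.rpow_sub hn1]; congr 1; ring
    have h6 : ((n:ℝ)+1)^(-β₀) ≤ (K+1) ^ β₀ * (((n + K : ℕ):ℝ)+1) ^ (-β₀) := by
      have hk0 : (0:ℝ) < (K:ℝ) + 1 := by positivity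
      have : ((K:ℝ)+1) ^ β₀ = (((K:ℝ)+1)⁻¹) ^ (-β₀) := by
        rw [Real.inv_rpow hk0.le, Real.rpow_neg hk0.le, inv_inv]
      rw [this, ← Real.mul_rpow (by positivity) (by positivity)]
      apply Real.rpow_le_rpow_of_nonpos (by positivity) _ (by linarith)
      rw [inv_mul_le_iff₀ hk0]; push_cast
      nlinarith [mul_nonneg hn0 (show (0:ℝ) ≤ K by positivity)]
    calc _ ≤ ‖iteratedDeriv (n + K) f 0‖ / n.factorial / ((n:ℝ)+1)^K := h3
      _ ≤ (M1 * (2 ^ ((K:ℝ) - β₀) * ((n:ℝ)+1)^((K:ℝ) - β₀))) / ((n:ℝ)+1)^K := by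
          gcongr
          exact h1.trans (by gcongr)
      _ = M1 * 2 ^ ((K:ℝ) - β₀) * (((n:ℝ)+1)^((K:ℝ) - β₀) / ((n:ℝ)+1)^K) := by ring
      _ = M1 * 2 ^ ((K:ℝ) - β₀) * ((n:ℝ)+1)^(-β₀) := by rw [h5]
      _ ≤ M1 * 2 ^ ((K:ℝ) - β₀) * ((K+1) ^ β₀ * (((n + K : ℕ):ℝ)+1) ^ (-β₀)) := by gcongr
      _ = _ := by ring
  set c : ℕ → ℝ := fun k => ‖iteratedDeriv k f 0‖ / k.factorial with hcdef
  have hc0 : ∀ k, 0 ≤ c k := fun k => by positivity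
  set M2 := ∑ k ∈ Finset.range K, c k * ((k:ℝ)+1)^β₀ with hM2
  have hM20 : 0 ≤ M2 := Finset.sum_nonneg fun k _ => mul_nonneg (hc0 k) (by positivity)
  refine ⟨1 + M1 * 2 ^ ((K:ℝ) - β₀) * (K+1) ^ β₀ + M2, by positivity, ?_⟩
  intro k
  have hkp : (0:ℝ) < ((k:ℝ)+1)^(-β₀) := by positivity
  have hP : 0 ≤ M1 * 2 ^ ((K:ℝ) - β₀) * ((K:ℝ)+1) ^ β₀ := by positivity
  by_cases hk : k < K
  · have h1 : c k * ((k:ℝ)+1)^β₀ ≤ M2 :=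
      Finset.single_le_sum (f := fun k : ℕ => c k * ((k:ℝ)+1)^β₀) (fun k _ => mul_nonneg (hc0 k) (by positivity)) (Finset.mem_range.2 hk)
    have h2 : c k = c k * ((k:ℝ)+1)^β₀ * ((k:ℝ)+1)^(-β₀) := by
      rw [mul_assoc, ← Real.rpow_add (by positivity)]; simp
    change c k ≤ _
    rw [h2]; gcongr; linarith
  · obtain ⟨n, rfl⟩ : ∃ n, k = n + K := ⟨k - K, by omega⟩
    refine (hlarge n).trans ?_
    gcongr; linarith

lemma aux_tail (g : ℂ → ℂ) (a : ℕ → ℂ) (M b : ℝ) (hb : 0 < b) (hM : 0 ≤ M)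
    (ha : ∀ k : ℕ, ‖a k‖ ≤ M * ((k:ℝ)+1)^(-b))
    (hg : ∀ p : ℂ, ‖p‖ < 1 → HasSum (fun k => a k * p ^ k) (g p)) (r : ℕ) (p : ℂ) (hp : ‖p‖ < 1) :
    ‖g p - ∑ k ∈ Finset.range (r+1), a k * p ^ k‖ ≤ M * ((r:ℝ)+1)^(-b) * ‖p‖^(r+1) * (1 - ‖p‖)⁻¹ := by
  have h1 := (hasSum_nat_add_iff' (r+1)).2 (hg p hp)
  have h2 := (hasSum_geometric_of_lt_one (norm_nonneg p) hp).mul_left (M * ((r:ℝ)+1)^(-b) * ‖p‖^(r+1))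
  refine h1.norm_le_of_bounded h2 ?_
  intro n
  rw [norm_mul, norm_pow]
  have h3 : ‖a (n + (r+1))‖ ≤ M * ((r:ℝ)+1)^(-b) := by
    refine (ha _).trans ?_
    refine mul_le_mul_of_nonneg_left ?_ hM
    apply Real.rpow_le_rpow_of_nonpos (by positivity) _ (by linarith)
    push_cast
    have : (0:ℝ) ≤ n := n.cast_nonneg
    linarith
  calc _ ≤ M * ((r:ℝ)+1)^(-b) * ‖p‖ ^ (n + (r+1)) := by gcongr
    _ = _ := by rw [pow_add]; ring

lemma aux_geom (x : ℝ) (hx : 0 < x) (n : ℕ) :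
    x / 2 * ∑ i ∈ Finset.range n, Real.exp (-(x/2)) ^ (i+1) ≤ 1 - Real.exp (-(x/2)) ^ n := by
  induction n with
  | zero => simp
  | succ n ih =>
    rw [Finset.sum_range_succ, mul_add]
    have h1 : Real.exp (-(x/2)) * (1 + x/2) ≤ 1 := by
      have := Real.add_one_le_exp (x/2)
      rw [Real.exp_neg, inv_mul_le_iff₀ (Real.exp_pos _)]; linarith
    have h2 : 0 < Real.exp (-(x/2)) ^ n := by positivity
    have h3 : Real.exp (-(x/2)) ^ n * (Real.exp (-(x/2)) * (1 + x/2)) ≤ Real.exp (-(x/2)) ^ n * 1 := by gcongr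
    rw [pow_succ]
    nlinarith

lemma aux_head (a : ℕ → ℂ) (M b : ℝ) (m : ℕ) (hb : 0 < b) (hm : b ≤ m) (hM : 0 ≤ M)
    (ha : ∀ k : ℕ, ‖a k‖ ≤ M * ((k:ℝ)+1)^(-b)) (r : ℕ) (p : ℂ) (x : ℝ) (hx : 0 < x) (hp : ‖p‖ = Real.exp x) :
    ‖∑ k ∈ Finset.range (r+1), a k * p ^ k‖ * x ^ (m+1) ≤
      M * (2 ^ (m+1) * m.factorial) * ((r:ℝ)+1)^(-b) * Real.exp x ^ (r+1) := by
  set q := Real.exp (-(x/2)) with hq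
  have hq0 : 0 < q := Real.exp_pos _
  have hqx : Real.exp x * q ^ 2 = 1 := by
    rw [hq, ← Real.exp_nat_mul, ← Real.exp_add]; simp; ring
  have h1 : ∀ i ∈ Finset.range (r+1), ‖a (r+1-1-i) * p ^ (r+1-1-i)‖ * x ^ m ≤
      M * ((r:ℝ)+1)^(-b) * Real.exp x ^ (r+1) * (2 ^ m * m.factorial) * q ^ (i+1) := by
    intro i hi
    have hi' : i ≤ r := by simp at hi; omega
    obtain ⟨k, rfl⟩ : ∃ k, r = k + i := ⟨r - i, by omega⟩
    have e0 : k + i + 1 - 1 - i = k := by omega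
    rw [e0, norm_mul, norm_pow, hp]
    have e1 : Real.exp x ^ k = Real.exp x ^ (k+i+1) * q ^ (i+1) * q ^ (i+1) := by
      have : Real.exp x ^ (k+i+1) * q ^ (i+1) * q ^ (i+1) = Real.exp x ^ k * (Real.exp x * q^2)^(i+1) := by
        rw [mul_pow, ← pow_mul]; ring
      rw [this, hqx, one_pow, mul_one]
    have e2 : ((k:ℝ)+1)^(-b) ≤ (((k+i:ℕ):ℝ)+1)^(-b) * ((i:ℝ)+1)^m := by
      have hk : (0:ℝ) ≤ k := k.cast_nonneg
      have hi0 : (0:ℝ) ≤ i := i.cast_nonneg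
      have : ((i:ℝ)+1)^b ≤ ((i:ℝ)+1)^m := by
        rw [← Real.rpow_natCast]
        exact Real.rpow_le_rpow_of_exponent_le (by linarith) hm
      refine le_trans ?_ (mul_le_mul_of_nonneg_left this (by positivity))
      have e3 : ((i:ℝ)+1) ^ b = (((i:ℝ)+1)⁻¹) ^ (-b) := by
        rw [Real.inv_rpow (by positivity), Real.rpow_neg (by positivity), inv_inv]
      rw [e3, ← Real.mul_rpow (by positivity) (by positivity)]
      apply Real.rpow_le_rpow_of_nonpos (by positivity) _ (by linarith)
      rw [mul_inv_le_iff₀ (by positivity)]; push_cast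
      nlinarith [mul_nonneg hk hi0]
    have e4 : (((i:ℝ)+1) * x) ^ m * q ^ (i+1) ≤ 2 ^ m * m.factorial := by
      have := Real.pow_div_factorial_le_exp (((i:ℝ)+1) * x / 2) (by positivity) m
      have e5 : Real.exp (((i:ℝ)+1) * x / 2) * q ^ (i+1) = 1 := by
        rw [hq, ← Real.exp_nat_mul, ← Real.exp_add]; simp; ring
      rw [div_le_iff₀ (by positivity), div_pow, div_le_iff₀ (by positivity)] at this
      calc _ ≤ Real.exp (((i:ℝ)+1) * x / 2) * m.factorial * 2 ^ m * q ^ (i+1) := by gcongr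
        _ = (Real.exp (((i:ℝ)+1) * x / 2) * q ^ (i+1)) * (2 ^ m * m.factorial) := by ring
        _ = _ := by rw [e5, one_mul]
    rw [e1]
    calc _ ≤ M * ((((k+i:ℕ):ℝ)+1)^(-b) * ((i:ℝ)+1)^m) * (Real.exp x ^ (k+i+1) * q ^ (i+1) * q ^ (i+1)) * x ^ m := by
          gcongr
          exact (ha k).trans (by gcongr)
      _ = M * (((k+i:ℕ):ℝ)+1)^(-b) * Real.exp x ^ (k+i+1) * ((((i:ℝ)+1) * x) ^ m * q ^ (i+1)) * q ^ (i+1) := by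
          rw [mul_pow]; ring
      _ ≤ _ := by gcongr
  rw [← Finset.sum_range_reflect]
  set Q := M * ((r:ℝ)+1)^(-b) * Real.exp x ^ (r+1) * (2 ^ m * m.factorial) with hQ
  have hQ0 : 0 ≤ Q := by positivity
  calc _ ≤ (∑ i ∈ Finset.range (r+1), ‖a (r+1-1-i) * p ^ (r+1-1-i)‖) * x ^ (m+1) := by
        gcongr; exact norm_sum_le _ _
    _ = (∑ i ∈ Finset.range (r+1), ‖a (r+1-1-i) * p ^ (r+1-1-i)‖ * x ^ m) * x := by
        rw [← Finset.sum_mul]; ring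
    _ ≤ (∑ i ∈ Finset.range (r+1), Q * q ^ (i+1)) * x := by
        exact mul_le_mul_of_nonneg_right (Finset.sum_le_sum h1) hx.le
    _ = 2 * Q * (x / 2 * ∑ i ∈ Finset.range (r+1), q ^ (i+1)) := by
        rw [← Finset.mul_sum]; ring
    _ ≤ 2 * Q * 1 := by
        gcongr
        refine (aux_geom x hx (r+1)).trans ?_
        have : 0 < q ^ (r+1) := by positivity
        linarith
    _ = _ := by rw [hQ]; ring

lemma aux_strip (g : ℂ → ℂ) (a : ℕ → ℂ) (M b : ℝ) (m : ℕ) (hb : 0 < b) (hm : b ≤ m) (hM : 0 ≤ M)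
    (ha : ∀ k : ℕ, ‖a k‖ ≤ M * ((k:ℝ)+1)^(-b))
    (hg : ∀ p : ℂ, ‖p‖ < 1 → HasSum (fun k => a k * p ^ k) (g p)) (r : ℕ) (z : ℂ)
    (hz : |z.re| ≤ 1/2) (hgz : ‖g (Complex.exp z)‖ ≤ M) :
    ‖g (Complex.exp z) - ∑ k ∈ Finset.range (r+1), a k * Complex.exp z ^ k‖ * |z.re| ^ (m+1) ≤
      M * (Real.exp 1 + (m+1).factorial + 2 ^ (m+1) * m.factorial) * ((r:ℝ)+1)^(-b) * Real.exp z.re ^ (r+1) := by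
  set x := z.re with hx
  have hn : ‖Complex.exp z‖ = Real.exp x := Complex.norm_exp z
  have hR : 0 ≤ M * ((r:ℝ)+1)^(-b) * Real.exp x ^ (r+1) := by positivity
  rcases lt_trichotomy x 0 with h | h | h
  · have h1 : ‖Complex.exp z‖ < 1 := by rw [hn]; simpa using h
    have h2 := aux_tail g a M b hb hM ha hg r _ h1
    rw [hn] at h2 h1
    have hx1 : |x| ^ (m+1) ≤ |x| := by
      apply pow_le_of_le_one (abs_nonneg _) (by linarith) (by omega)
    have h3 : |x| * (1 - Real.exp x)⁻¹ ≤ Real.exp 1 := by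
      rw [mul_inv_le_iff₀ (by linarith), abs_of_neg h, mul_sub, mul_one, ← Real.exp_add]
      have h4 := Real.add_one_le_exp (-x)
      have h5 : Real.exp 1 = Real.exp (-x) * Real.exp (1 + x) := by rw [← Real.exp_add]; ring_nf
      have h6 : Real.exp (1+x) ≥ 1 := Real.one_le_exp (by rw [abs_of_neg h] at hz; linarith)
      have h7 : Real.exp (-x) ≥ 1 := Real.one_le_exp (by linarith)
      nlinarith
    calc _ ≤ (M * ((r:ℝ)+1)^(-b) * Real.exp x^(r+1) * (1 - Real.exp x)⁻¹) * |x| := by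
          gcongr
      _ = M * ((r:ℝ)+1)^(-b) * Real.exp x^(r+1) * (|x| * (1 - Real.exp x)⁻¹) := by ring
      _ ≤ M * ((r:ℝ)+1)^(-b) * Real.exp x^(r+1) * (Real.exp 1 + (m+1).factorial + 2 ^ (m+1) * m.factorial) := by
          gcongr
          have : (0:ℝ) ≤ (m+1).factorial + 2 ^ (m+1) * m.factorial := by positivity
          linarith
      _ = _ := by ring
  · rw [h]; simp; positivity
  · rw [abs_of_pos h]
    have h2 := aux_head a M b m hb hm hM ha r _ x h hn
    have h3 : M * x ^ (m+1) ≤ M * (m+1).factorial * ((r:ℝ)+1)^(-b) * Real.exp x ^ (r+1) := by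
      have := Real.pow_div_factorial_le_exp (((r:ℝ)+1) * x) (by positivity) (m+1)
      rw [div_le_iff₀ (by positivity), mul_pow] at this
      have e1 : Real.exp (((r:ℝ)+1)*x) = Real.exp x ^ (r+1) := by
        rw [← Real.exp_nat_mul]; push_cast; ring_nf
      rw [e1] at this
      have e2 : (((r:ℝ)+1)^(m+1))⁻¹ ≤ ((r:ℝ)+1)^(-b) := by
        rw [← Real.rpow_natCast, ← Real.rpow_neg (by positivity)]
        apply Real.rpow_le_rpow_of_exponent_le
        · have : (0:ℝ) ≤ r := r.cast_nonneg
          linarith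
        · push_cast; linarith
      calc M * x^(m+1) = M * (((r:ℝ)+1)^(m+1) * x^(m+1)) * (((r:ℝ)+1)^(m+1))⁻¹ := by field_simp
        _ ≤ M * (Real.exp x ^ (r+1) * (m+1).factorial) * ((r:ℝ)+1)^(-b) := by gcongr
        _ = _ := by ring
    calc _ ≤ (M + ‖∑ k ∈ Finset.range (r+1), a k * Complex.exp z ^ k‖) * x ^ (m+1) := by
          gcongr
          exact (norm_sub_le _ _).trans (by gcongr)
      _ ≤ M * (m+1).factorial * ((r:ℝ)+1)^(-b) * Real.exp x ^ (r+1) + M * (2 ^ (m+1) * m.factorial) * ((r:ℝ)+1)^(-b) * Real.exp x ^ (r+1) := by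
          rw [add_mul]; exact add_le_add h3 h2
      _ ≤ _ := by
          have : 0 ≤ Real.exp 1 * (M * ((r:ℝ)+1)^(-b) * Real.exp x ^ (r+1)) := by positivity
          nlinarith

lemma aux_riesz (g : ℂ → ℂ) (a : ℕ → ℂ) (M b η : ℝ) (m : ℕ) (hb : 0 < b) (hm : b ≤ m) (hM : 0 ≤ M)
    (hη : 0 < η) (hη1 : η ≤ 1)
    (ha : ∀ k : ℕ, ‖a k‖ ≤ M * ((k:ℝ)+1)^(-b))
    (hg : ∀ p : ℂ, ‖p‖ < 1 → HasSum (fun k => a k * p ^ k) (g p))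
    (hgd : ∀ z : ℂ, |z.re| ≤ 1/2 → |z.im| ≤ η → DifferentiableAt ℂ g (Complex.exp z) ∧ ‖g (Complex.exp z)‖ ≤ M)
    (r : ℕ) (x : ℝ) (hx : |x| ≤ 1/2) :
    ‖g (Real.exp x : ℝ) - ∑ k ∈ Finset.range (r+1), a k * ((Real.exp x : ℝ) : ℂ) ^ k‖ ≤
      M * (Real.exp 1 + (m+1).factorial + 2 ^ (m+1) * m.factorial) * 8 ^ (m+1) * (η^2)⁻¹ ^ (m+1) * ((r:ℝ)+1)^(-b) * Real.exp x ^ (r+1) := by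
  set K := M * (Real.exp 1 + (m+1).factorial + 2 ^ (m+1) * m.factorial) with hK
  have hK0 : 0 ≤ K := by positivity
  set R : Set ℂ := Set.Ioo (-(1/2):ℝ) (1/2) ×ℂ Set.Ioo (-η) η with hR
  set H : ℂ → ℂ := fun z => (g (Complex.exp z) - ∑ k ∈ Finset.range (r+1), a k * Complex.exp z ^ k)
    * (Complex.exp z ^ (r+1))⁻¹ * (z^2 + η^2)^(m+1) with hH
  have hcl : closure R = Set.Icc (-(1/2):ℝ) (1/2) ×ℂ Set.Icc (-η) η := by
    rw [hR, Complex.closure_reProdIm, closure_Ioo (by norm_num), closure_Ioo (by linarith)]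
  have hclm : ∀ z ∈ closure R, |z.re| ≤ 1/2 ∧ |z.im| ≤ η := by
    intro z hz
    rw [hcl, Complex.mem_reProdIm] at hz
    exact ⟨abs_le.2 hz.1, abs_le.2 hz.2⟩
  have hbdd : Bornology.IsBounded R := (Metric.isBounded_Ioo _ _).reProdIm (Metric.isBounded_Ioo _ _)
  have hdiff : DifferentiableOn ℂ H (closure R) := by
    intro z hz
    obtain ⟨h1, h2⟩ := hclm z hz
    have hd := (hgd z h1 h2).1
    have hd1 : DifferentiableAt ℂ (fun z => g (Complex.exp z)) z :=
      DifferentiableAt.comp z hd (by fun_prop)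
    refine DifferentiableAt.differentiableWithinAt ?_
    refine DifferentiableAt.mul (DifferentiableAt.mul (hd1.sub (by fun_prop)) ?_) (by fun_prop)
    exact DifferentiableAt.inv (by fun_prop) (pow_ne_zero _ (Complex.exp_ne_zero z))
  have hfr : ∀ z ∈ frontier R, ‖H z‖ ≤ K * 8 ^ (m+1) * ((r:ℝ)+1)^(-b) := by
    intro z hz
    obtain ⟨h1, h2⟩ := hclm z (frontier_subset_closure hz)
    have h3 := aux_strip g a M b m hb hm hM ha hg r z h1 (hgd z h1 h2).2
    have h4 : ‖z^2 + (η:ℂ)^2‖ ≤ 8 * |z.re| := by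
      have hzn : ‖z‖ ≤ 3/2 := (Complex.norm_le_abs_re_add_abs_im z).trans (by linarith)
      have hηn : ‖(η:ℂ)‖ = η := by simp [abs_of_pos hη]
      rw [hR, Complex.frontier_reProdIm, frontier_Ioo (by linarith), frontier_Ioo (by norm_num)] at hz
      rcases hz with hz | hz
      · have hf1 : z^2 + (η:ℂ)^2 = (z - η * Complex.I) * (z + η * Complex.I) := by
          ring_nf; simp
        have hηI : ‖(η:ℂ) * Complex.I‖ = η := by simp [abs_of_pos hη]
        rw [hf1, norm_mul]
        have hc := hz.2
        simp only [Set.mem_preimage, Set.mem_insert_iff, Set.mem_singleton_iff] at hc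
        rcases hc with hc | hc
        · have e1 : z + η * Complex.I = (z.re : ℂ) := by apply Complex.ext <;> simp [hc]
          rw [e1, Complex.norm_real, Real.norm_eq_abs]
          gcongr
          exact (norm_sub_le _ _).trans (by linarith)
        · have e1 : z - η * Complex.I = (z.re : ℂ) := by apply Complex.ext <;> simp [hc]
          rw [e1, Complex.norm_real, Real.norm_eq_abs, mul_comm]
          gcongr
          exact (norm_add_le _ _).trans (by linarith)
      · have hc := hz.1
        simp only [Set.mem_preimage, Set.mem_insert_iff, Set.mem_singleton_iff] at hc
        have : |z.re| = 1/2 := by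
          rcases hc with hc | hc <;> rw [hc] <;> norm_num [abs_of_pos]
        rw [this]
        refine (norm_add_le _ _).trans ?_
        rw [norm_pow, norm_pow, hηn]
        nlinarith [norm_nonneg z]
    rw [hH]
    simp only [norm_mul, norm_inv, norm_pow, Complex.norm_exp]
    have hE : 0 < Real.exp z.re ^ (r+1) := by positivity
    calc _ ≤ ‖g (Complex.exp z) - ∑ k ∈ Finset.range (r+1), a k * Complex.exp z ^ k‖ * (Real.exp z.re ^ (r+1))⁻¹ * (8 * |z.re|)^(m+1) := by gcongr
      _ = (‖g (Complex.exp z) - ∑ k ∈ Finset.range (r+1), a k * Complex.exp z ^ k‖ * |z.re|^(m+1)) * ((Real.exp z.re ^ (r+1))⁻¹ * 8^(m+1)) := by rw [mul_pow]; ring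
      _ ≤ (K * ((r:ℝ)+1)^(-b) * Real.exp z.re ^ (r+1)) * ((Real.exp z.re ^ (r+1))⁻¹ * 8^(m+1)) := by gcongr
      _ = _ := by field_simp
  have hxm : (x:ℂ) ∈ closure R := by
    rw [hcl, Complex.mem_reProdIm]
    simp only [Complex.ofReal_re, Complex.ofReal_im]
    exact ⟨abs_le.1 hx, by constructor <;> linarith⟩
  have hfin := Complex.norm_le_of_forall_mem_frontier_norm_le hbdd hdiff.diffContOnCl hfr hxm
  rw [hH] at hfin
  simp only [norm_mul, norm_inv, norm_pow, Complex.norm_exp, Complex.ofReal_re] at hfin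
  rw [← Complex.ofReal_exp] at hfin
  have e1 : ‖(x:ℂ)^2 + (η:ℂ)^2‖ = x^2 + η^2 := by
    rw [← Complex.ofReal_pow, ← Complex.ofReal_pow, ← Complex.ofReal_add, Complex.norm_real, Real.norm_of_nonneg (by positivity)]
  rw [e1] at hfin
  set X := ‖g (Real.exp x : ℝ) - ∑ k ∈ Finset.range (r+1), a k * ((Real.exp x : ℝ) : ℂ) ^ k‖ with hX
  have hX0 : 0 ≤ X := norm_nonneg _
  have hE : 0 < Real.exp x ^ (r+1) := by positivity
  have h5 : (η^2)^(m+1) ≤ (x^2+η^2)^(m+1) := by gcongr; nlinarith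
  have h6 : X * (Real.exp x ^ (r+1))⁻¹ * (η^2)^(m+1) ≤ K * 8 ^ (m+1) * ((r:ℝ)+1)^(-b) :=
    le_trans (by gcongr) hfin
  calc X = (X * (Real.exp x ^ (r+1))⁻¹ * (η^2)^(m+1)) * ((η^2)⁻¹^(m+1) * Real.exp x ^ (r+1)) := by
        rw [inv_pow]; field_simp
    _ ≤ (K * 8 ^ (m+1) * ((r:ℝ)+1)^(-b)) * ((η^2)⁻¹^(m+1) * Real.exp x ^ (r+1)) := by gcongr
    _ = _ := by ring

lemma aux_pointwise (g : ℂ → ℂ) (a : ℕ → ℂ) (M b η : ℝ) (hb : 0 < b) (hM : 0 ≤ M)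
    (hη : 0 < η) (hη1 : η ≤ 1)
    (ha : ∀ k : ℕ, ‖a k‖ ≤ M * ((k:ℝ)+1)^(-b))
    (hg : ∀ p : ℂ, ‖p‖ < 1 → HasSum (fun k => a k * p ^ k) (g p))
    (hgd : ∀ z : ℂ, |z.re| ≤ 1/2 → |z.im| ≤ η → DifferentiableAt ℂ g (Complex.exp z) ∧ ‖g (Complex.exp z)‖ ≤ M) :
    ∃ K : ℝ, 0 < K ∧ ∀ (r : ℕ) (t : ℝ), 0 < t →
      ‖g t - ∑ k ∈ Finset.range (r+1), a k * (t : ℂ) ^ k‖ ≤ 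
        K * ((r:ℝ)+1)^(-b) * t ^ (r+1) + Set.indicator (Set.Ioi (Real.exp (1/2))) (fun t : ℝ => ‖g t‖) t := by
  obtain ⟨m, hm⟩ := exists_nat_ge b
  have hq : Real.exp (-(1/2)) < 1 := by simp
  have hq' : 0 < 1 - Real.exp (-(1/2)) := by linarith
  set K1 := M * (1 - Real.exp (-(1/2)))⁻¹ with hK1
  set K2 := M * (Real.exp 1 + (m+1).factorial + 2 ^ (m+1) * m.factorial) * 8 ^ (m+1) * (η^2)⁻¹ ^ (m+1) with hK2
  set K3 := M * (2 ^ (m+1) * m.factorial) * 2 ^ (m+1) with hK3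
  have h1 : 0 ≤ K1 := by positivity
  have h2 : 0 ≤ K2 := by positivity
  have h3 : 0 ≤ K3 := by positivity
  refine ⟨1 + K1 + K2 + K3, by positivity, ?_⟩
  intro r t ht
  have hP : 0 ≤ ((r:ℝ)+1)^(-b) * t ^ (r+1) := by positivity
  have hind : 0 ≤ Set.indicator (Set.Ioi (Real.exp (1/2))) (fun t : ℝ => ‖g t‖) t :=
    Set.indicator_nonneg (fun _ _ => norm_nonneg _) _
  have htn : ‖(t:ℂ)‖ = t := by simp [abs_of_pos ht]
  rcases lt_or_ge t (Real.exp (-(1/2))) with hc | hc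
  · have := aux_tail g a M b hb hM ha hg r t (by rw [htn]; linarith)
    rw [htn] at this
    have h4 : M * ((r:ℝ)+1)^(-b) * t^(r+1) * (1 - t)⁻¹ ≤ K1 * (((r:ℝ)+1)^(-b) * t ^ (r+1)) := by
      calc _ ≤ M * ((r:ℝ)+1)^(-b) * t^(r+1) * (1 - Real.exp (-(1/2)))⁻¹ := by gcongr
        _ = _ := by rw [hK1]; ring
    nlinarith
  rcases le_or_gt t (Real.exp (1/2)) with hc2 | hc2
  · have hx : |Real.log t| ≤ 1/2 := by
      rw [abs_le]
      exact ⟨(Real.le_log_iff_exp_le ht).2 hc, (Real.log_le_iff_le_exp ht).2 hc2⟩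
    have := aux_riesz g a M b η m hb hm hM hη hη1 ha hg hgd r _ hx
    rw [Real.exp_log ht] at this
    nlinarith
  · rw [Set.indicator_of_mem (show t ∈ Set.Ioi (Real.exp (1/2)) from hc2)]
    have hx : 1/2 < Real.log t := (Real.lt_log_iff_exp_lt ht).2 hc2
    have h4 := aux_head a M b m hb hm hM ha r t (Real.log t) (by linarith) (by rw [htn, Real.exp_log ht])
    rw [Real.exp_log ht] at h4
    set S := ‖∑ k ∈ Finset.range (r+1), a k * (t : ℂ) ^ k‖ with hS
    have h5 : S * (1/2)^(m+1) ≤ S * Real.log t ^ (m+1) := by gcongr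
    have h6 : S ≤ K3 * (((r:ℝ)+1)^(-b) * t ^ (r+1)) := by
      calc S = S * (1/2)^(m+1) * 2^(m+1) := by rw [one_div, inv_pow]; field_simp
        _ ≤ (M * (2 ^ (m+1) * m.factorial) * ((r:ℝ)+1)^(-b) * t ^ (r+1)) * 2^(m+1) := by
          exact mul_le_mul_of_nonneg_right (h5.trans h4) (by positivity)
        _ = _ := by rw [hK3]; ring
    refine (norm_sub_le _ _).trans ?_
    nlinarith

lemma aux_gamma_s8 (k : ℕ) (r : ℝ) (hr : 0 < r) :
    IntegrableOn (fun t : ℝ => t ^ k * Real.exp (-(r * t))) (Set.Ioi 0) ∧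
    ∫ t in Set.Ioi (0:ℝ), t ^ k * Real.exp (-(r * t)) = k.factorial / r ^ (k+1) := by
  constructor
  · have h := integrableOn_rpow_mul_exp_neg_mul_rpow (p := 1) (s := k) (b := r) (by
      have : (0:ℝ) ≤ k := k.cast_nonneg
      linarith) one_pos hr
    simpa [Real.rpow_natCast] using h
  · have h := Real.integral_rpow_mul_exp_neg_mul_Ioi (a := (k:ℝ)+1) (r := r) (by positivity) hr
    rw [Real.Gamma_nat_eq_factorial] at h
    simp only [add_sub_cancel_right, Real.rpow_natCast] at h
    rw [h]
    have : (1/r) ^ ((k:ℝ)+1) = (1/r)^(k+1) := by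
      rw [← Real.rpow_natCast]; push_cast; rfl
    rw [this, one_div, inv_pow]; field_simp

lemma aux_final_exp (b ν T : ℝ) (hb : 0 < b) (hT : 1 < T) :
    ∃ C : ℝ, 0 < C ∧ ∀ r : ℕ, 1 ≤ r → Real.exp ((ν - r) * T) ≤
      C * (r.factorial * (r:ℝ)^(-b) * ((r:ℝ)^(r+1))⁻¹) := by
  obtain ⟨n, hn⟩ := exists_nat_ge (b + 1)
  refine ⟨Real.exp (ν * T) * (n.factorial * ((T-1)^n)⁻¹), ?_, ?_⟩
  · have : 0 < T - 1 := by linarith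
    positivity
  intro r hr
  have hc : 0 < T - 1 := by linarith
  have hr1 : (1:ℝ) ≤ r := by exact_mod_cast hr
  have hr0 : (0:ℝ) < r := by linarith
  have h1 := Real.pow_div_factorial_le_exp (r:ℝ) hr0.le r
  have h2 := Real.pow_div_factorial_le_exp ((r:ℝ) * (T-1)) (by positivity) n
  have e1 : Real.exp ((ν - r) * T) = Real.exp (ν*T) * (Real.exp r)⁻¹ * (Real.exp (r * (T-1)))⁻¹ := by
    rw [← Real.exp_neg, ← Real.exp_neg, ← Real.exp_add, ← Real.exp_add]; congr 1; ring
  have h3 : (Real.exp r)⁻¹ ≤ r.factorial * ((r:ℝ)^r)⁻¹ := by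
    calc _ ≤ ((r:ℝ)^r / r.factorial)⁻¹ := by gcongr
      _ = _ := by rw [inv_div]; ring
  have h4 : (Real.exp (r * (T-1)))⁻¹ ≤ n.factorial * ((T-1)^n)⁻¹ * ((r:ℝ)^(-b) * (r:ℝ)⁻¹) := by
    have e2 : ((r:ℝ)^n)⁻¹ ≤ (r:ℝ)^(-b) * (r:ℝ)⁻¹ := by
      rw [← Real.rpow_neg_one (r:ℝ), ← Real.rpow_add hr0, ← Real.rpow_natCast, ← Real.rpow_neg hr0.le]
      exact Real.rpow_le_rpow_of_exponent_le hr1 (by linarith)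
    calc _ ≤ (((r:ℝ) * (T-1))^n / n.factorial)⁻¹ := by gcongr
      _ = n.factorial * ((T-1)^n)⁻¹ * ((r:ℝ)^n)⁻¹ := by rw [inv_div, mul_pow]; field_simp
      _ ≤ _ := by gcongr
  rw [e1]
  calc _ ≤ Real.exp (ν*T) * (r.factorial * ((r:ℝ)^r)⁻¹) * (n.factorial * ((T-1)^n)⁻¹ * ((r:ℝ)^(-b) * (r:ℝ)⁻¹)) := by gcongr
    _ = _ := by rw [pow_succ, mul_inv]; ring

lemma aux_laplace (g : ℂ → ℂ) (a : ℕ → ℂ) (b K C ν : ℝ) (hb : 0 < b) (hK : 0 < K) (hC : 0 < C) (hν : 0 < ν)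
    (hcont : ContinuousOn (fun t : ℝ => g t) (Set.Ici 0))
    (hgC : ∀ t : ℝ, 1/2 < t → ‖g t‖ ≤ C * Real.exp (ν * t))
    (hpt : ∀ (r : ℕ) (t : ℝ), 0 < t →
      ‖g t - ∑ k ∈ Finset.range (r+1), a k * (t : ℂ) ^ k‖ ≤ 
        K * ((r:ℝ)+1)^(-b) * t ^ (r+1) + Set.indicator (Set.Ioi (Real.exp (1/2))) (fun t : ℝ => ‖g t‖) t) :
    ∃ C' : ℝ, 0 < C' ∧ ∃ r₀ : ℕ, 1 ≤ r₀ ∧ ∀ r : ℕ, r₀ ≤ r →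
      ‖(∫ t in Set.Ioi (0:ℝ), g t * ((Real.exp (-(r * t)) : ℝ) : ℂ)) -
        ∑ k ∈ Finset.range (r+1), a k * (k.factorial / (r:ℂ)^(k+1))‖ ≤
        C' * (r.factorial * (r:ℝ)^(-b) * ((r:ℝ)^(r+1))⁻¹) := by
  set T := Real.exp (1/2) with hT
  have hT1 : 1 < T := by rw [hT]; simp
  obtain ⟨C3, hC30, hC3⟩ := aux_final_exp b ν T hb hT1
  obtain ⟨r₀, hr₀⟩ := exists_nat_ge (ν + 1)
  obtain ⟨M0, hM0⟩ := (isCompact_Icc (a := (0:ℝ)) (b := 1)).exists_bound_of_continuousOn (hcont.mono Set.Icc_subset_Ici_self)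
  have hr₀1 : 1 ≤ r₀ := by
    have : (1:ℝ) ≤ r₀ := by linarith
    exact_mod_cast this
  refine ⟨2 * K + C * C3, by positivity, r₀, hr₀1, ?_⟩
  intro r hr
  have hrν : ν + 1 ≤ r := hr₀.trans (by exact_mod_cast hr)
  have hr0 : (0:ℝ) < r := by linarith
  have hr1 : (1:ℝ) ≤ r := by linarith
  have hgall : ∀ t : ℝ, 0 < t → ‖g t‖ ≤ (|M0| + C) * Real.exp (ν * t) := by
    intro t ht
    have h1 : 1 ≤ Real.exp (ν * t) := Real.one_le_exp (by positivity)
    rcases le_or_gt t 1 with h | h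
    · have := hM0 t ⟨ht.le, h⟩
      nlinarith [le_abs_self M0, abs_nonneg M0]
    · have := hgC t (by linarith)
      nlinarith [abs_nonneg M0]
  have hgi : IntegrableOn (fun t : ℝ => g t * ((Real.exp (-(r * t)) : ℝ) : ℂ)) (Set.Ioi 0) := by
    have hi := (exp_neg_integrableOn_Ioi 0 (b := r - ν) (by linarith)).const_mul (|M0| + C)
    refine Integrable.mono' hi ?_ ?_
    · refine ContinuousOn.aestronglyMeasurable ?_ measurableSet_Ioi
      refine (hcont.mono Set.Ioi_subset_Ici_self).mul ?_
      fun_prop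
    · refine (ae_restrict_iff' measurableSet_Ioi).2 (Filter.Eventually.of_forall fun t ht => ?_)
      rw [norm_mul, Complex.norm_real, Real.norm_of_nonneg (Real.exp_pos _).le]
      calc _ ≤ (|M0| + C) * Real.exp (ν * t) * Real.exp (-(r * t)) := by
            gcongr; exact hgall t ht
        _ = _ := by rw [mul_assoc, ← Real.exp_add]; congr 2; ring
  have hmono : ∀ k : ℕ, IntegrableOn (fun t : ℝ => a k * (t:ℂ) ^ k * ((Real.exp (-(r * t)) : ℝ) : ℂ)) (Set.Ioi 0) ∧
      ∫ t in Set.Ioi (0:ℝ), a k * (t:ℂ) ^ k * ((Real.exp (-(r * t)) : ℝ) : ℂ) = a k * (k.factorial / (r:ℂ)^(k+1)) := by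
    intro k
    obtain ⟨h1, h2⟩ := aux_gamma_s8 k r hr0
    have e : (fun t : ℝ => a k * (t:ℂ) ^ k * ((Real.exp (-(r * t)) : ℝ) : ℂ)) = fun t : ℝ => a k * ((t ^ k * Real.exp (-(r*t)) : ℝ) : ℂ) := by
      funext t; push_cast; ring
    rw [e]
    refine ⟨(Integrable.ofReal h1).const_mul (a k), ?_⟩
    rw [integral_const_mul, integral_complex_ofReal, h2]; push_cast; rfl
  have hdiff : (∫ t in Set.Ioi (0:ℝ), g t * ((Real.exp (-(r * t)) : ℝ) : ℂ)) -
        ∑ k ∈ Finset.range (r+1), a k * (k.factorial / (r:ℂ)^(k+1)) =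
      ∫ t in Set.Ioi (0:ℝ), (g t - ∑ k ∈ Finset.range (r+1), a k * (t : ℂ) ^ k) * ((Real.exp (-(r * t)) : ℝ) : ℂ) := by
    simp only [sub_mul, Finset.sum_mul]
    rw [integral_sub hgi (integrable_finsetSum _ fun k _ => (hmono k).1), integral_finsetSum _ (fun k _ => (hmono k).1)]
    congr 1
    exact Finset.sum_congr rfl fun k _ => (hmono k).2.symm
  rw [hdiff]
  obtain ⟨g1, g2⟩ := aux_gamma_s8 (r+1) r hr0
  have hI1 : IntegrableOn (fun t : ℝ => K * ((r:ℝ)+1)^(-b) * (t^(r+1) * Real.exp (-(r*t)))) (Set.Ioi 0) := g1.const_mul _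
  have hTi : IntegrableOn (fun t : ℝ => C * Real.exp ((ν - r) * t)) (Set.Ioi T) := by
    have := (exp_neg_integrableOn_Ioi T (b := r - ν) (by linarith)).const_mul C
    have e : (fun x : ℝ => C * Real.exp (-(r - ν) * x)) = fun t : ℝ => C * Real.exp ((ν - r) * t) := by
      funext t; congr 2; ring
    rw [← e]; exact this
  have hI2 : Integrable (Set.indicator (Set.Ioi T) (fun t : ℝ => C * Real.exp ((ν - r) * t))) :=
    hTi.integrable_indicator measurableSet_Ioi
  have hbd : ∀ᵐ (t : ℝ) ∂(volume.restrict (Set.Ioi (0:ℝ))), ‖(g t - ∑ k ∈ Finset.range (r+1), a k * (t : ℂ) ^ k) * ((Real.exp (-(r * t)) : ℝ) : ℂ)‖ ≤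
      K * ((r:ℝ)+1)^(-b) * (t^(r+1) * Real.exp (-(r*t))) + Set.indicator (Set.Ioi T) (fun t : ℝ => C * Real.exp ((ν - r) * t)) t := by
    refine (ae_restrict_iff' measurableSet_Ioi).2 (Filter.Eventually.of_forall fun t ht => ?_)
    rw [norm_mul, Complex.norm_real, Real.norm_of_nonneg (Real.exp_pos _).le]
    refine (mul_le_mul_of_nonneg_right (hpt r t ht) (Real.exp_pos _).le).trans ?_
    rw [add_mul]
    refine add_le_add (le_of_eq (by ring)) ?_
    by_cases h : t ∈ Set.Ioi T
    · rw [Set.indicator_of_mem h, Set.indicator_of_mem h]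
      have h' : T < t := h
      calc _ ≤ C * Real.exp (ν * t) * Real.exp (-(r * t)) := by
            gcongr; exact hgC t (by linarith)
        _ = _ := by rw [mul_assoc, ← Real.exp_add]; congr 2; ring
    · rw [Set.indicator_of_notMem h, Set.indicator_of_notMem h, zero_mul]
  refine (norm_integral_le_of_norm_le (hI1.add hI2.integrableOn) hbd).trans ?_
  have hsplit := integral_add hI1 hI2.integrableOn
  refine hsplit.le.trans ?_
  rw [integral_const_mul, g2, setIntegral_indicator measurableSet_Ioi]
  have hset : Set.Ioi (0:ℝ) ∩ Set.Ioi T = Set.Ioi T := by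
    rw [Set.Ioi_inter_Ioi]; congr 1; exact max_eq_right (by linarith)
  rw [hset, integral_const_mul, integral_exp_mul_Ioi (by linarith), add_mul]
  refine add_le_add ?_ ?_
  · have h1 : ((r:ℝ)+1)^(-b) ≤ (r:ℝ)^(-b) :=
      Real.rpow_le_rpow_of_nonpos hr0 (by linarith) (by linarith)
    have h2 : (((r+1).factorial : ℕ) : ℝ) / (r:ℝ)^(r+1+1) ≤ 2 * (r.factorial * ((r:ℝ)^(r+1))⁻¹) := by
      rw [Nat.factorial_succ, pow_succ (r:ℝ) (r+1)]; push_cast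
      have : ((r:ℝ)+1) / r ≤ 2 := by rw [div_le_iff₀ hr0]; linarith
      calc _ = ((r:ℝ)+1) / r * (r.factorial * ((r:ℝ)^(r+1))⁻¹) := by field_simp
        _ ≤ _ := by gcongr
    calc _ ≤ K * (r:ℝ)^(-b) * (2 * (r.factorial * ((r:ℝ)^(r+1))⁻¹)) := by gcongr
      _ = _ := by ring
  · have h1 : -Real.exp ((ν - r) * T) / (ν - r) ≤ Real.exp ((ν - r) * T) := by
      rw [neg_div, ← div_neg]
      apply div_le_self (Real.exp_pos _).le; linarith
    rw [mul_assoc C C3]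
    gcongr
    exact h1.trans (hC3 r (hr₀1.trans hr))

/-- Optimal truncation in a regular direction: if `f` has standard
singularity data with `N` singular points of modulus one, and extends
analytically with exponential bound to a sector around the ray `arg p = φ`
which avoids all singular directions, then with `x = r e^{-iφ}` the
truncation of the asymptotic series at index `r = |x|` approximates the
Laplace integral to the order of the least term:
`|∫_0^{∞e^{iφ}} f(p)e^{-xp}dp - ∑_{k≤r} f⁽ᵏ⁾(0)x^{-k-1}|
  ≤ C' r! r^{-β₀} r^{-r-1}` where `β₀ = min_j Re β_j`. -/
theorem stmt_8 (N : ℕ) (hN : 1 ≤ N)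
    (l β : Fin N → ℂ) (A B : Fin N → ℂ → ℂ) (ε δ : ℝ) (f : ℂ → ℂ)
    (hmod : ∀ j, ‖l j‖ = 1) (hinj : Function.Injective l)
    (hε : 0 < ε) (hεδ : ε < δ) (hδ : δ < 1)
    (hβre : ∀ j, 0 < (β j).re) (hβint : ∀ j, ∀ n : ℤ, β j ≠ (n : ℂ))
    (D : Set ℂ)
    (hD : D = {p : ℂ | ‖p‖ < 1 + ε} \
        ⋃ j, {q : ℂ | ∃ t : ℝ, 1 ≤ t ∧ t < 1 + ε ∧ q = (t : ℂ) * l j})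
    (hf : DifferentiableOn ℂ f D)
    (hA : ∀ j, DifferentiableOn ℂ (A j) {p : ℂ | ‖p - l j‖ < δ})
    (hB : ∀ j, DifferentiableOn ℂ (B j) {p : ℂ | ‖p - l j‖ < δ})
    (hloc : ∀ j, ∀ p ∈ D, ‖p - l j‖ < δ →
      f p = (1 - p / l j) ^ (β j - 1) * A j p + B j p)
    (φ η C ν : ℝ) (hη : η ∈ Set.Ioo 0 (π / 2)) (hC : 0 < C) (hν : 0 < ν)
    (hdir : ∀ j, η < |Complex.arg (l j * Complex.exp (-Complex.I * φ))|)
    (U : Set ℂ)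
    (hU : U = {p : ℂ | 1 / 2 < ‖p‖ ∧
        |Complex.arg (p * Complex.exp (-Complex.I * φ))| < η})
    (hfU : DifferentiableOn ℂ f (D ∪ U))
    (hbound : ∀ p ∈ U, ‖f p‖ ≤ C * Real.exp (ν * ‖p‖))
    (β₀ : ℝ)
    (hβ₀ : β₀ = Finset.univ.inf' ⟨⟨0, hN⟩, Finset.mem_univ _⟩
      (fun j => (β j).re)) :
    ∃ C' : ℝ, 0 < C' ∧ ∃ r₀ : ℕ, ∀ r : ℕ, r₀ ≤ r →
      ‖(∫ t in Set.Ioi (0 : ℝ),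
            f ((t : ℂ) * Complex.exp (Complex.I * φ)) *
              Complex.exp (-((r : ℂ) * Complex.exp (-Complex.I * φ)) *
                ((t : ℂ) * Complex.exp (Complex.I * φ))) *
              Complex.exp (Complex.I * φ)) -
          ∑ k ∈ Finset.range (r + 1),
            iteratedDeriv k f 0 /
              ((r : ℂ) * Complex.exp (-Complex.I * φ)) ^ (k + 1)‖ ≤
        C' * (Nat.factorial r : ℝ) * (r : ℝ) ^ (-β₀) * (r : ℝ) ^ (-(r : ℝ) - 1) := by
  classical
  have hη0 : 0 < η := hη.1
  have hηpi : η < π / 2 := hη.2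
  have hb : ∀ j, β₀ ≤ (β j).re := fun j => by
    rw [hβ₀]; exact Finset.inf'_le (fun j => (β j).re) (Finset.mem_univ j)
  have hb0 : 0 < β₀ := by
    rw [hβ₀]
    exact (Finset.lt_inf'_iff _).2 fun j _ => hβre j
  have hball : ∀ p : ℂ, ‖p‖ ≤ 1 → (∀ j, p ≠ l j) → p ∈ D := by
    intro p hp hne
    rw [hD]
    refine ⟨?_, ?_⟩
    · show ‖p‖ < 1 + ε
      linarith
    · intro hmem
      obtain ⟨j, t, ht1, ht2, hpt⟩ := Set.mem_iUnion.1 hmem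
      have hn : ‖p‖ = t := by
        rw [hpt, norm_mul, hmod, mul_one, Complex.norm_real, Real.norm_of_nonneg (by linarith)]
      have ht : t = 1 := by linarith
      apply hne j
      rw [hpt, ht]; simp
  have hball1 : ∀ p : ℂ, ‖p‖ < 1 → p ∈ D := by
    intro p hp
    refine hball p hp.le fun j h => ?_
    rw [h, hmod] at hp
    exact lt_irrefl _ hp
  obtain ⟨M, hM0, hM⟩ := aux_coeff_bound N hN l β A B ε δ f hmod hε hεδ hδ D hD hf hA hB hloc β₀ hb hb0 hball
  set E : ℂ := Complex.exp (Complex.I * φ) with hE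
  have hE' : Complex.exp (-Complex.I * φ) = E⁻¹ := by
    rw [hE, ← Complex.exp_neg]; congr 1; ring
  have hE0 : E ≠ 0 := Complex.exp_ne_zero _
  have hEn : ‖E‖ = 1 := by
    rw [hE, mul_comm]; exact Complex.norm_exp_ofReal_mul_I φ
  rw [hE'] at hU
  simp only [hE']
  let g : ℂ → ℂ := fun p => f (p * E)
  let a : ℕ → ℂ := fun k => iteratedDeriv k f 0 / (k.factorial : ℂ) * E ^ k
  have hmemU : ∀ w : ℂ, 1 / 2 < ‖w‖ → |Complex.arg w| < η → w * E ∈ U := by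
    intro w h1 h2
    rw [hU]
    refine ⟨?_, ?_⟩
    · rw [norm_mul, hEn, mul_one]; exact h1
    · rw [mul_assoc, mul_inv_cancel₀ hE0, mul_one]; exact h2
  have hre : ∀ t : ℝ, 0 < t → Complex.arg (t : ℂ) = 0 := fun t ht => Complex.arg_ofReal_of_nonneg ht.le
  have hnt : ∀ t : ℝ, 0 ≤ t → ‖(t : ℂ)‖ = t := fun t ht => by
    rw [Complex.norm_real, Real.norm_of_nonneg ht]
  have hha : ∀ k, ‖a k‖ ≤ (M + C * Real.exp (ν * 2)) * ((k:ℝ)+1)^(-β₀) := by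
    intro k
    have h1 : ‖a k‖ = ‖iteratedDeriv k f 0‖ / k.factorial := by
      simp only [a, norm_mul, norm_div, norm_pow, hEn, one_pow, mul_one, Complex.norm_natCast]
    rw [h1]
    refine (hM k).trans ?_
    have : 0 < C * Real.exp (ν * 2) := by positivity
    gcongr
    linarith
  have hg : ∀ p : ℂ, ‖p‖ < 1 → HasSum (fun k => a k * p ^ k) (g p) := by
    intro p hp
    have hd : DifferentiableOn ℂ f (Metric.ball 0 1) := hf.mono fun q hq => hball1 q (by simpa using hq)
    have hpE : p * E ∈ Metric.ball (0:ℂ) 1 := by simpa [hEn] using hp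
    have h := Complex.hasSum_taylorSeries_on_ball hd hpE
    have hfe : (fun k => a k * p ^ k) = fun n : ℕ => ((n.factorial : ℂ))⁻¹ • (p * E - 0) ^ n • iteratedDeriv n f 0 := by
      funext k
      simp only [a, sub_zero, smul_eq_mul, mul_pow]
      ring
    rw [hfe]
    exact h
  have hgd : ∀ z : ℂ, |z.re| ≤ 1/2 → |z.im| ≤ η / 2 →
      DifferentiableAt ℂ g (Complex.exp z) ∧ ‖g (Complex.exp z)‖ ≤ M + C * Real.exp (ν * 2) := by
    intro z h1 h2
    have h1' := abs_le.1 h1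
    have h2' := abs_le.1 h2
    have hpi := Real.pi_pos
    have hlow : 1 / 2 < ‖Complex.exp z‖ := by
      rw [Complex.norm_exp]
      have := Real.add_one_lt_exp (x := -(1/2)) (by norm_num)
      have h3 := Real.exp_le_exp.2 h1'.1
      linarith
    have hup : ‖Complex.exp z‖ ≤ 2 := by
      rw [Complex.norm_exp]
      have h3 := Real.exp_le_exp.2 h1'.2
      have h4 : Real.exp (1/2) ≤ 2 := by
        have h5 : Real.exp (1/2) * Real.exp (1/2) = Real.exp 1 := by
          rw [← Real.exp_add]; norm_num
        have h6 := Real.exp_one_lt_d9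
        nlinarith [Real.exp_pos (1/2)]
      linarith
    have harg : Complex.arg (Complex.exp z) = z.im :=
      by
        rw [Complex.arg_exp, toIocMod_eq_self]
        constructor <;> linarith
    have hargη : |Complex.arg (Complex.exp z)| < η := by rw [harg]; linarith
    have hm := hmemU _ hlow hargη
    have hslit : Complex.exp z ∈ Complex.slitPlane := by
      rw [Complex.mem_slitPlane_iff_arg]
      refine ⟨?_, Complex.exp_ne_zero _⟩
      rw [harg]; linarith
    refine ⟨?_, ?_⟩
    · have hnhds : ∀ᶠ w in nhds (Complex.exp z), w * E ∈ U := by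
        have e1 : ∀ᶠ w in nhds (Complex.exp z), 1 / 2 < ‖w‖ :=
          (continuous_norm.continuousAt (x := Complex.exp z)).eventually (lt_mem_nhds hlow)
        have e2 : ∀ᶠ w in nhds (Complex.exp z), |Complex.arg w| < η :=
          ((Complex.continuousAt_arg hslit).abs).eventually (gt_mem_nhds hargη)
        filter_upwards [e1, e2] with w k1 k2 using hmemU w k1 k2
      have hgon : DifferentiableOn ℂ g {w | w * E ∈ U} := by
        refine hfU.comp (f := fun w => w * E) (by fun_prop) ?_
        intro w hw
        exact Or.inr hw
      exact hgon.differentiableAt hnhds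
    · have h3 := hbound _ hm
      rw [norm_mul, hEn, mul_one] at h3
      have h4 : C * Real.exp (ν * ‖Complex.exp z‖) ≤ C * Real.exp (ν * 2) := by gcongr
      show ‖f (Complex.exp z * E)‖ ≤ _
      linarith
  obtain ⟨K, hK, hpt⟩ := aux_pointwise g a (M + C * Real.exp (ν * 2)) β₀ (η / 2) hb0 (by positivity) (by linarith)
    (by linarith [Real.pi_lt_four]) hha hg hgd
  have hcont : ContinuousOn (fun t : ℝ => g t) (Set.Ici 0) := by
    refine hfU.continuousOn.comp (f := fun t : ℝ => (t : ℂ) * E) (by fun_prop) ?_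
    intro t ht
    have ht : 0 ≤ t := ht
    by_cases h : t ≤ 1 / 2
    · left
      apply hball1
      rw [norm_mul, hEn, mul_one, hnt t ht]; linarith
    · right
      push Not at h
      refine hmemU _ ?_ ?_
      · rw [hnt t ht]; exact h
      · rw [hre t (by linarith)]; simpa using hη0
  have hgC : ∀ t : ℝ, 1/2 < t → ‖g t‖ ≤ C * Real.exp (ν * t) := by
    intro t ht
    have h3 := hbound _ (hmemU (t : ℂ) (by rw [hnt t (by linarith)]; exact ht)
      (by rw [hre t (by linarith)]; simpa using hη0))
    rw [norm_mul, hEn, mul_one, hnt t (by linarith)] at h3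
    exact h3
  obtain ⟨C', hC', r₀, hr₀, hfin⟩ := aux_laplace g a β₀ K C ν hb0 hK hC hν hcont hgC hpt
  refine ⟨C', hC', r₀, fun r hr => ?_⟩
  have hr1 : 1 ≤ r := hr₀.trans hr
  have hrpos : (0:ℝ) < r := by exact_mod_cast hr1
  have hrc : (r : ℂ) ≠ 0 := by exact_mod_cast hrpos.ne'
  have e1 : ∀ t : ℝ, f ((t : ℂ) * E) * Complex.exp (-((r : ℂ) * E⁻¹) * ((t : ℂ) * E)) * E =
      (g t * ((Real.exp (-(r * t)) : ℝ) : ℂ)) * E := by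
    intro t
    have : -((r : ℂ) * E⁻¹) * ((t : ℂ) * E) = ((-(r * t) : ℝ) : ℂ) := by
      push_cast; field_simp
    rw [this, ← Complex.ofReal_exp]
  have e2 : ∀ k : ℕ, iteratedDeriv k f 0 / ((r : ℂ) * E⁻¹) ^ (k + 1) =
      a k * (k.factorial / (r:ℂ)^(k+1)) * E := by
    intro k
    have hk : (k.factorial : ℂ) ≠ 0 := by exact_mod_cast k.factorial_ne_zero
    simp only [a]
    rw [mul_pow, inv_pow]
    field_simp
    ring
  simp only [e1, e2]
  rw [integral_mul_const, ← Finset.sum_mul, ← sub_mul, norm_mul, hEn, mul_one]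
  refine (hfin r hr).trans (le_of_eq ?_)
  have e3 : (r:ℝ) ^ (-(r : ℝ) - 1) = ((r:ℝ)^(r+1))⁻¹ := by
    rw [← Real.rpow_natCast, ← Real.rpow_neg hrpos.le]
    congr 1; push_cast; ring
  rw [e3]; ring
end

section
/- Let δ ∈ (0, π/2), M > 2, let r₁ ≥ 1 be an integer, α ∈ ℝ, and Ω ≤ 0 a real number. For each positive integer r set x_r = r·e^{iΩ/√r} and define g_α(r) = α ∫_{[0, M e^{iδ}]} e^{−p x_r} (1 − p)^{−(r+r₁)} dp + (1 − α) ∫_{[0, M e^{−iδ}]} e^{−p x_r} (1 − p)^{−(r+r₁)} dp, the integrals being taken along the straight segments from 0 to M e^{±iδ}. Then lim_{r→∞} √r · e^{−Ω²/2} · g_α(r) = i·√(π/2)·(erf(Ω/√2) − 1 + 2α). -/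
open MeasureTheory Real

/-- The error function `erf(y) = (2/√π) ∫_0^y e^{-t²} dt`. -/
noncomputable def erf (y : ℝ) : ℝ :=
  (2 / Real.sqrt π) * ∫ t in (0 : ℝ)..y, Real.exp (-t ^ 2)

lemma contour_aux (δ M C : ℝ) (h0 : 0 < δ) (h1 : δ < π / 2) (hM : 0 < M) (f : ℂ → ℂ)
    (hf : DifferentiableOn ℂ f {p : ℂ | p ≠ 1})
    (hC : ∀ θ ∈ Set.Icc δ (π / 2), ‖f (M * Complex.exp (Complex.I * θ))‖ ≤ C) :
    ‖(∫ t in (0 : ℝ)..M, f ((t : ℂ) * Complex.exp (Complex.I * δ)) * Complex.exp (Complex.I * δ))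
      - ∫ t in (0 : ℝ)..M, f ((t : ℂ) * Complex.I) * Complex.I‖ ≤ C * M * (π / 2) := by
  set H : Set ℂ := {p : ℂ | -Real.sin δ < p.im * Real.cos δ - p.re * Real.sin δ} with hH
  have hs : 0 < Real.sin δ := Real.sin_pos_of_pos_of_lt_pi h0 (by linarith [Real.pi_pos])
  have hc : 0 < Real.cos δ := Real.cos_pos_of_mem_Ioo ⟨by linarith, h1⟩
  have Hopen : IsOpen H := isOpen_lt (by fun_prop) (by fun_prop)
  have Hconv : Convex ℝ H := by
    intro p hp q hq a b ha hb hab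
    simp only [hH, Set.mem_ofPred_eq] at hp hq ⊢
    simp only [Complex.add_im, Complex.add_re, Complex.real_smul, Complex.mul_im, Complex.mul_re,
      Complex.ofReal_re, Complex.ofReal_im, zero_mul, sub_zero, add_zero]
    have hb' : b = 1 - a := by linarith
    subst hb'
    rcases eq_or_lt_of_le ha with h | h
    · subst h; simpa using hq
    · nlinarith [mul_lt_mul_of_pos_left hp h, mul_le_mul_of_nonneg_left hq.le hb]
  have Hsub : H ⊆ {p : ℂ | p ≠ 1} := by
    intro p hp h
    subst h
    simp [hH] at hp
  obtain ⟨F, hF⟩ := Hconv.exists_forall_hasDerivWithinAt (hf.mono Hsub)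
  have hF' : ∀ p ∈ H, HasDerivAt F (f p) p := fun p hp => (hF p hp).hasDerivAt (Hopen.mem_nhds hp)
  have fcont : ContinuousOn f H := (hf.mono Hsub).continuousOn
  have mem : ∀ t : ℝ, 0 ≤ t → ∀ θ ∈ Set.Icc δ (π / 2), (t : ℂ) * Complex.exp (Complex.I * θ) ∈ H := by
    intro t ht θ hθ
    have : 0 ≤ Real.sin (θ - δ) := Real.sin_nonneg_of_nonneg_of_le_pi (by linarith [hθ.1]) (by linarith [hθ.2, Real.pi_pos])
    rw [Real.sin_sub] at this
    have h2 := mul_nonneg ht this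
    simp only [hH, Set.mem_ofPred_eq]
    rw [mul_comm Complex.I]
    simp only [Complex.mul_im, Complex.mul_re, Complex.ofReal_re, Complex.ofReal_im,
      Complex.exp_ofReal_mul_I_re, Complex.exp_ofReal_mul_I_im]
    nlinarith
  have ray : ∀ θ ∈ Set.Icc δ (π / 2), (∫ t in (0 : ℝ)..M, f ((t : ℂ) * Complex.exp (Complex.I * θ)) * Complex.exp (Complex.I * θ)) = F (M * Complex.exp (Complex.I * θ)) - F 0 := by
    intro θ hθ
    have := intervalIntegral.integral_eq_sub_of_hasDerivAt (a := 0) (b := M)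
      (f := fun t : ℝ => F (t * Complex.exp (Complex.I * θ)))
      (f' := fun t : ℝ => f ((t : ℂ) * Complex.exp (Complex.I * θ)) * Complex.exp (Complex.I * θ)) ?_ ?_
    · rw [this]; simp
    · intro t ht
      rw [Set.uIcc_of_le hM.le] at ht
      have h3 : HasDerivAt (fun t : ℝ => (t : ℂ) * Complex.exp (Complex.I * θ)) (Complex.exp (Complex.I * θ)) t := by
        simpa using (Complex.ofRealCLM.hasDerivAt (x := t)).mul_const (Complex.exp (Complex.I * θ))
      exact (hF' _ (mem t ht.1 θ hθ)).comp t h3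
    · apply ContinuousOn.intervalIntegrable
      rw [Set.uIcc_of_le hM.le]
      refine ContinuousOn.mul (fcont.comp (by fun_prop) ?_) continuousOn_const
      intro t ht
      exact mem t ht.1 θ hθ
  have r1 := ray δ ⟨le_rfl, h1.le⟩
  have r2 := ray (π / 2) ⟨h1.le, le_rfl⟩
  have e : Complex.exp (Complex.I * (π / 2 : ℝ)) = Complex.I := by
    rw [mul_comm]; push_cast; exact Complex.exp_pi_div_two_mul_I
  rw [e] at r2
  rw [r1, r2, sub_sub_sub_cancel_right]
  have := Convex.norm_image_sub_le_of_norm_hasDerivWithin_le (𝕜 := ℝ) (s := Set.Icc δ (π / 2))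
    (f := fun θ : ℝ => F (M * Complex.exp (Complex.I * θ)))
    (f' := fun θ : ℝ => f (M * Complex.exp (Complex.I * θ)) * (M * (Complex.exp (Complex.I * θ) * Complex.I)))
    (C := C * M) (x := π / 2) (y := δ) ?_ ?_ (convex_Icc _ _) ⟨h1.le, le_rfl⟩ ⟨le_rfl, h1.le⟩
  · simp only [e] at this
    refine this.trans ?_
    have hC0 : 0 ≤ C := (norm_nonneg _).trans (hC δ ⟨le_rfl, h1.le⟩)
    gcongr
    rw [Real.norm_eq_abs, abs_le]; constructor <;> linarith
  · intro θ hθ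
    have h3 : HasDerivAt (fun t : ℝ => (M : ℂ) * Complex.exp (Complex.I * t)) (M * (Complex.exp (Complex.I * θ) * Complex.I)) θ := by
      have h4 : HasDerivAt (fun t : ℝ => Complex.I * (t : ℂ)) Complex.I θ := by
        simpa using (Complex.ofRealCLM.hasDerivAt (x := θ)).const_mul Complex.I
      exact h4.cexp.const_mul _
    exact ((hF' _ (mem M hM.le θ hθ)).comp θ h3).hasDerivWithinAt
  · intro θ hθ
    rw [norm_mul, norm_mul, norm_mul, mul_comm Complex.I, Complex.norm_exp_ofReal_mul_I, mul_comm (θ:ℂ)]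
    simp only [Complex.norm_I, mul_one, Complex.norm_real, Real.norm_eq_abs, abs_of_pos hM]
    gcongr
    exact hC θ hθ

lemma gauss_aux (Ω : ℝ) : ∫ s in Set.Ioi (0 : ℝ), Real.exp (-s ^ 2 / 2 + s * Ω) =
    Real.exp (Ω ^ 2 / 2) * (Real.sqrt (π / 2) * (erf (Ω / Real.sqrt 2) + 1)) := by
  have hint : Integrable (fun v : ℝ => Real.exp (-v ^ 2)) := by
    simpa using integrable_exp_neg_mul_sq (b := 1) one_pos
  have h2 : 0 < Real.sqrt 2 := by positivity
  have hsq : Real.sqrt 2 ^ 2 = 2 := Real.sq_sqrt (by norm_num)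
  have e1 : ∫ s in Set.Ioi (0 : ℝ), Real.exp (-s ^ 2 / 2 + s * Ω)
      = Real.exp (Ω ^ 2 / 2) * ∫ s in Set.Ioi (0:ℝ), Real.exp (-(s / Real.sqrt 2 - Ω / Real.sqrt 2) ^ 2) := by
    rw [← integral_const_mul]
    congr 1
    ext s
    rw [← Real.exp_add]
    congr 1
    rw [← sub_div, div_pow, hsq]; ring
  have e2 := integral_comp_mul_left_Ioi (fun s : ℝ => Real.exp (-(s - Ω / Real.sqrt 2) ^ 2)) 0 (inv_pos.2 h2)
  have e3 : ∫ s in Set.Ioi (0:ℝ), Real.exp (-(s - Ω / Real.sqrt 2) ^ 2) =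
      ∫ v in Set.Ioi (-(Ω / Real.sqrt 2)), Real.exp (-v ^ 2) := by
    rw [← integral_indicator measurableSet_Ioi, ← integral_indicator measurableSet_Ioi,
      ← integral_sub_right_eq_self ((Set.Ioi (-(Ω / Real.sqrt 2))).indicator fun v : ℝ => Real.exp (-v ^ 2)) (Ω / Real.sqrt 2)]
    congr 1
    ext s
    simp [Set.indicator]
  have e4 := intervalIntegral.integral_interval_add_Ioi (a := -(Ω / Real.sqrt 2)) (b := 0) hint.integrableOn hint.integrableOn
  have e5 : ∫ v in Set.Ioi (0:ℝ), Real.exp (-v ^ 2) = Real.sqrt π / 2 := by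
    simpa using integral_gaussian_Ioi 1
  have e6 : ∫ v in (-(Ω / Real.sqrt 2))..0, Real.exp (-v ^ 2) = ∫ v in (0:ℝ)..(Ω / Real.sqrt 2), Real.exp (-v ^ 2) := by
    have := intervalIntegral.integral_comp_neg (a := 0) (b := Ω / Real.sqrt 2) (fun v : ℝ => Real.exp (-v ^ 2))
    simpa using this.symm
  simp only [inv_inv, mul_zero, smul_eq_mul, inv_mul_eq_div] at e2
  rw [e1, e2, e3, ← e4, e5, e6, erf, Real.sqrt_div pi_pos.le]
  have : 0 < Real.sqrt π := by positivity
  field_simp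
  rw [hsq]

lemma decay_aux (a b : ℝ) (hb : 0 < b) :
    Filter.Tendsto (fun r : ℕ => Real.sqrt r * (Real.exp (a * Real.sqrt r) * Real.exp (-(b * r)))) Filter.atTop (nhds 0) := by
  have hq : Filter.Tendsto (fun r : ℕ => Real.sqrt r) Filter.atTop Filter.atTop :=
    Real.tendsto_sqrt_atTop.comp tendsto_natCast_atTop_atTop
  have h1 : Filter.Tendsto (fun q : ℝ => q ^ 1 * Real.exp (-q)) Filter.atTop (nhds 0) :=
    Real.tendsto_pow_mul_exp_neg_atTop_nhds_zero 1
  refine squeeze_zero' (Filter.Eventually.of_forall fun r => by positivity) ?_ (h1.comp hq)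
  filter_upwards [hq.eventually_ge_atTop ((a + 1) / b)] with r hr
  simp only [Function.comp, pow_one]
  gcongr
  rw [← Real.exp_add]
  gcongr
  have h2 : (r : ℝ) = Real.sqrt r * Real.sqrt r := (Real.mul_self_sqrt (Nat.cast_nonneg r)).symm
  rw [div_le_iff₀ hb] at hr
  nlinarith [Real.sqrt_nonneg r]

lemma ptwise_aux (Ω s : ℝ) (r₁ : ℕ) :
    Filter.Tendsto (fun r : ℕ => Complex.exp (-(((s / Real.sqrt r : ℝ) : ℂ) * Complex.I) * ((r : ℂ) *
      Complex.exp (Complex.I * (Ω / Real.sqrt r)))) * (1 - ((s / Real.sqrt r : ℝ) : ℂ) * Complex.I) ^ (-((r : ℤ) + r₁)))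
      Filter.atTop (nhds ((Real.exp (-s ^ 2 / 2 + s * Ω) : ℝ) : ℂ)) := by
  have hq : Filter.Tendsto (fun r : ℕ => Real.sqrt r) Filter.atTop Filter.atTop :=
    Real.tendsto_sqrt_atTop.comp tendsto_natCast_atTop_atTop
  have hy : Filter.Tendsto (fun r : ℕ => (Real.sqrt r)⁻¹) Filter.atTop (nhds 0) := hq.inv_tendsto_atTop
  have hyc : Filter.Tendsto (fun r : ℕ => (((Real.sqrt r)⁻¹ : ℝ) : ℂ)) Filter.atTop (nhds 0) := by
    simpa [Function.comp_def] using (Complex.continuous_ofReal.tendsto 0).comp hy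
  -- log piece
  have hz : Filter.Tendsto (fun r : ℕ => -(((s / Real.sqrt r : ℝ) : ℂ) * Complex.I)) Filter.atTop (nhds 0) := by
    have := (hyc.const_mul (-(s : ℂ) * Complex.I))
    rw [mul_zero] at this
    refine this.congr fun r => ?_
    push_cast; ring
  have hlog : Filter.Tendsto (fun r : ℕ => (r : ℂ) * (Complex.log (1 + -(((s / Real.sqrt r : ℝ) : ℂ) * Complex.I)) - (-(((s / Real.sqrt r : ℝ) : ℂ) * Complex.I)) - s ^ 2 / (2 * r))) Filter.atTop (nhds 0) := by
    have hzn : Filter.Tendsto (fun r : ℕ => ‖-(((s / Real.sqrt r : ℝ) : ℂ) * Complex.I)‖) Filter.atTop (nhds 0) := by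
      simpa using hz.norm
    have hb : Filter.Tendsto (fun r : ℕ => s ^ 2 * ‖-(((s / Real.sqrt r : ℝ) : ℂ) * Complex.I)‖ * (1 - ‖-(((s / Real.sqrt r : ℝ) : ℂ) * Complex.I)‖)⁻¹ / 3) Filter.atTop (nhds 0) := by
      have h1 : Filter.Tendsto (fun r : ℕ => (1 - ‖-(((s / Real.sqrt r : ℝ) : ℂ) * Complex.I)‖)⁻¹) Filter.atTop (nhds (1 - 0)⁻¹) :=
        (tendsto_const_nhds.sub hzn).inv₀ (by norm_num)
      simpa using ((hzn.const_mul (s ^ 2)).mul h1).div_const 3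
    refine squeeze_zero_norm' ?_ hb
    filter_upwards [hzn.eventually_lt_const one_pos, Filter.eventually_gt_atTop 0] with r hr hr0
    have hr0' : (0 : ℝ) < r := by exact_mod_cast hr0
    have hrc : (r : ℂ) ≠ 0 := by exact_mod_cast hr0.ne'
    have hsq : (Real.sqrt r) ^ 2 = r := Real.sq_sqrt hr0'.le
    have hsqc : ((Real.sqrt r : ℝ) : ℂ) ^ 2 = r := by exact_mod_cast hsq
    have := Complex.norm_log_sub_logTaylor_le 2 hr
    simp only [Complex.logTaylor_succ, Complex.logTaylor_zero] at this
    rw [norm_mul, Complex.norm_natCast]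
    have e : (s : ℂ) ^ 2 / (2 * r) = - (-(((s / Real.sqrt r : ℝ) : ℂ) * Complex.I)) ^ 2 / 2 := by
      rw [neg_sq, mul_pow, Complex.I_sq]; push_cast; rw [div_pow, hsqc]; field_simp
    have en : ‖-(((s / Real.sqrt r : ℝ) : ℂ) * Complex.I)‖ ^ 2 * r = s ^ 2 := by
      rw [norm_neg, norm_mul, Complex.norm_I, Complex.norm_real, mul_one, Real.norm_eq_abs, sq_abs, div_pow, hsq]; field_simp
    rw [e]
    generalize -(((s / Real.sqrt r : ℝ) : ℂ) * Complex.I) = z at *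
    have h5 : ‖Complex.log (1 + z) - z - -z ^ 2 / 2‖ ≤ ‖z‖ ^ 3 * (1 - ‖z‖)⁻¹ / 3 := by
      convert this using 2
      · simp; ring
      · norm_num
    calc (r : ℝ) * ‖Complex.log (1 + z) - z - -z ^ 2 / 2‖ ≤ r * (‖z‖ ^ 3 * (1 - ‖z‖)⁻¹ / 3) := by gcongr
      _ = _ := by rw [← en]; ring
  have hexp : Filter.Tendsto (fun r : ℕ => (Real.sqrt r : ℂ) * (Complex.exp (Complex.I * (Ω / Real.sqrt r)) - 1)) Filter.atTop (nhds (Complex.I * Ω)) := by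
    have hd : HasDerivAt (fun y : ℂ => Complex.exp (Complex.I * Ω * y)) (Complex.I * Ω) 0 := by
      have := ((hasDerivAt_id (0:ℂ)).const_mul (Complex.I * Ω)).cexp
      simpa using this
    rw [hasDerivAt_iff_tendsto_slope] at hd
    have hyc' : Filter.Tendsto (fun r : ℕ => (((Real.sqrt r)⁻¹ : ℝ) : ℂ)) Filter.atTop (nhdsWithin 0 {0}ᶜ) := by
      rw [tendsto_nhdsWithin_iff]
      refine ⟨hyc, ?_⟩
      filter_upwards [Filter.eventually_gt_atTop 0] with r hr
      have : (0:ℝ) < r := by exact_mod_cast hr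
      have : Real.sqrt r ≠ 0 := by positivity
      simpa using this
    refine (hd.comp hyc').congr fun r => ?_
    simp [slope_def_field, div_eq_mul_inv]
    ring_nf
  have h1 : Filter.Tendsto (fun r : ℕ => (1 - ((s / Real.sqrt r : ℝ) : ℂ) * Complex.I) ^ (-(r₁ : ℤ))) Filter.atTop (nhds 1) := by
    have : Filter.Tendsto (fun r : ℕ => (1 - ((s / Real.sqrt r : ℝ) : ℂ) * Complex.I)) Filter.atTop (nhds 1) := by
      simpa [sub_eq_add_neg] using hz.const_add 1
    simpa using this.zpow₀ (-(r₁ : ℤ)) (Or.inl one_ne_zero)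
  have hmain := ((((hexp.const_mul (-(s:ℂ) * Complex.I)).sub hlog).sub_const ((s:ℂ) ^ 2 / 2)).cexp).mul h1
  have hval : Complex.exp (-(s:ℂ) * Complex.I * (Complex.I * Ω) - 0 - (s:ℂ) ^ 2 / 2) * 1 = ((Real.exp (-s ^ 2 / 2 + s * Ω) : ℝ) : ℂ) := by
    rw [mul_one]; push_cast; congr 1
    linear_combination (-(s:ℂ) * Ω) * Complex.I_sq
  rw [hval] at hmain
  refine hmain.congr' ?_
  filter_upwards [Filter.eventually_gt_atTop 0] with r hr0
  have hr0' : (0 : ℝ) < r := by exact_mod_cast hr0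
  have hrc : (r : ℂ) ≠ 0 := by exact_mod_cast hr0.ne'
  have hsq : (Real.sqrt r) ^ 2 = r := Real.sq_sqrt hr0'.le
  have hsqc : ((Real.sqrt r : ℝ) : ℂ) ^ 2 = r := by exact_mod_cast hsq
  have hsq0 : ((Real.sqrt r : ℝ) : ℂ) ≠ 0 := by
    intro h; rw [h] at hsqc; apply hrc; rw [← hsqc]; simp
  have hne : (1 - ((s / Real.sqrt r : ℝ) : ℂ) * Complex.I) ≠ 0 := by
    intro h
    have := congrArg Complex.re h
    simp at this
  have hpow : (1 - ((s / Real.sqrt r : ℝ) : ℂ) * Complex.I) ^ (-(r : ℤ)) =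
      Complex.exp (-(r * Complex.log (1 + -(((s / Real.sqrt r : ℝ) : ℂ) * Complex.I)))) := by
    rw [← sub_eq_add_neg, Complex.exp_neg, Complex.exp_nat_mul, Complex.exp_log hne, zpow_neg, zpow_natCast]
  rw [neg_add, zpow_add₀ hne, hpow, ← mul_assoc (Complex.exp (-(((s / Real.sqrt r : ℝ) : ℂ) * Complex.I) * _)), ← Complex.exp_add]
  congr 2
  generalize Complex.log (1 + -(((s / Real.sqrt r : ℝ) : ℂ) * Complex.I)) = L
  generalize Complex.exp (Complex.I * (Ω / Real.sqrt r)) = E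
  push_cast
  rw [← hsqc]
  field_simp
  ring

lemma bound_aux (Ω M s : ℝ) (hM : 0 < M) (r r₁ : ℕ) (hr : 0 < r) (hs : 0 ≤ s) (hsM : s ≤ M * Real.sqrt r) :
    ‖Complex.exp (-(((s / Real.sqrt r : ℝ) : ℂ) * Complex.I) * ((r : ℂ) *
      Complex.exp (Complex.I * (Ω / Real.sqrt r)))) * (1 - ((s / Real.sqrt r : ℝ) : ℂ) * Complex.I) ^ (-((r : ℤ) + r₁))‖
     ≤ Real.exp (-(1 / (2 * (1 + M ^ 2))) * s ^ 2 + |Ω| * s) := by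
  have hr0 : (0 : ℝ) < r := by exact_mod_cast hr
  have hq : 0 < Real.sqrt r := by positivity
  have hqq : Real.sqrt r * Real.sqrt r = r := Real.mul_self_sqrt hr0.le
  set t := s / Real.sqrt r with ht
  have ht0 : 0 ≤ t := by positivity
  have htM : t ≤ M := by rw [ht, div_le_iff₀ hq]; exact hsM
  have hst : s = t * Real.sqrt r := by rw [ht]; field_simp
  rw [norm_mul, norm_zpow, Complex.norm_exp]
  have hre : (-((t : ℂ) * Complex.I) * ((r : ℂ) * Complex.exp (Complex.I * (Ω / Real.sqrt r)))).re
      = t * r * Real.sin (Ω / Real.sqrt r) := by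
    have : Complex.I * ((Ω : ℂ) / Real.sqrt r) = ((Ω / Real.sqrt r : ℝ) : ℂ) * Complex.I := by
      push_cast; ring
    rw [this, show ∀ E : ℂ, -((t : ℂ) * Complex.I) * ((r : ℂ) * E) = ((t * r : ℝ) : ℂ) * (-(Complex.I * E)) by
      intro E; push_cast; ring, Complex.re_ofReal_mul]
    simp only [Complex.neg_re, Complex.mul_re, Complex.I_re, Complex.I_im, Complex.exp_ofReal_mul_I_im]
    ring
  have h1 : t * r * Real.sin (Ω / Real.sqrt r) ≤ |Ω| * s := by
    have : Real.sin (Ω / Real.sqrt r) ≤ |Ω| / Real.sqrt r := by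
      refine (le_abs_self _).trans ((Real.abs_sin_le_abs).trans ?_)
      rw [abs_div, abs_of_pos hq]
    calc t * r * Real.sin (Ω / Real.sqrt r) ≤ t * r * (|Ω| / Real.sqrt r) := by gcongr
      _ = |Ω| * s := by
          rw [hst]; field_simp; rw [Real.sq_sqrt hr0.le]; ring
  rw [hre]
  have hn : ‖1 - (t : ℂ) * Complex.I‖ ^ 2 = 1 + t ^ 2 := by
    rw [← Complex.normSq_eq_norm_sq, Complex.normSq_apply]; simp; ring
  set N := ‖1 - (t : ℂ) * Complex.I‖ with hN
  have hN0 : 0 ≤ N := norm_nonneg _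
  have hN1 : 1 ≤ N := by nlinarith [sq_nonneg t]
  have hNe : Real.exp (1 / (2 * (1 + M ^ 2)) * t ^ 2) ≤ N := by
    rw [← abs_of_nonneg hN0, ← abs_of_pos (Real.exp_pos _)]
    apply sq_le_sq.1
    rw [hn, ← Real.exp_nat_mul]
    have h3 : ((2:ℕ):ℝ) * (1 / (2 * (1 + M ^ 2)) * t ^ 2) ≤ t ^ 2 / (1 + t ^ 2) := by
      push_cast
      rw [show (2:ℝ) * (1 / (2 * (1 + M ^ 2)) * t ^ 2) = t ^ 2 / (1 + M ^ 2) by field_simp]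
      gcongr
    refine (Real.exp_le_exp.2 h3).trans ?_
    have h4 := Real.add_one_le_exp (-(t ^ 2 / (1 + t ^ 2)))
    have h5 : -(t ^ 2 / (1 + t ^ 2)) + 1 = (1 + t ^ 2)⁻¹ := by field_simp; ring
    rw [h5, Real.exp_neg] at h4
    exact (inv_le_inv₀ (by positivity) (Real.exp_pos _)).1 h4
  have hpow : N ^ (-((r : ℤ) + r₁)) ≤ Real.exp (-(1 / (2 * (1 + M ^ 2))) * s ^ 2) := by
    have e1 : N ^ (-((r : ℤ) + r₁)) = (N ^ (r + r₁))⁻¹ := by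
      rw [zpow_neg]; norm_cast
    rw [e1, neg_mul, Real.exp_neg]
    apply inv_anti₀ (Real.exp_pos _)
    calc Real.exp (1 / (2 * (1 + M ^ 2)) * s ^ 2) = Real.exp (1 / (2 * (1 + M ^ 2)) * t ^ 2) ^ r := by
          rw [← Real.exp_nat_mul, hst, mul_pow, Real.sq_sqrt hr0.le]; ring_nf
      _ ≤ N ^ r := by gcongr
      _ ≤ N ^ (r + r₁) := pow_le_pow_right₀ hN1 (by omega)
  rw [Real.exp_add, mul_comm]
  gcongr

lemma imag_aux (Ω M : ℝ) (hM : 0 < M) (r₁ : ℕ) :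
    Filter.Tendsto (fun r : ℕ => (Real.sqrt r : ℂ) * ∫ t in (0:ℝ)..M, Complex.exp (-((t : ℂ) * Complex.I) * ((r : ℂ) *
      Complex.exp (Complex.I * (Ω / Real.sqrt r)))) * (1 - (t : ℂ) * Complex.I) ^ (-((r : ℤ) + r₁)) * Complex.I)
      Filter.atTop (nhds (((∫ s in Set.Ioi (0 : ℝ), Real.exp (-s ^ 2 / 2 + s * Ω) : ℝ) : ℂ) * Complex.I)) := by
  have hq : Filter.Tendsto (fun r : ℕ => Real.sqrt r) Filter.atTop Filter.atTop :=
    Real.tendsto_sqrt_atTop.comp tendsto_natCast_atTop_atTop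
  let G : ℕ → ℝ → ℂ := fun r t => Complex.exp (-((t : ℂ) * Complex.I) * ((r : ℂ) *
      Complex.exp (Complex.I * (Ω / Real.sqrt r)))) * (1 - (t : ℂ) * Complex.I) ^ (-((r : ℤ) + r₁))
  have hGc : ∀ r, Continuous (G r) := by
    intro r
    refine Continuous.mul (by fun_prop) (Continuous.zpow₀ (by fun_prop) _ ?_)
    intro t; left; intro h
    have := congrArg Complex.re h
    simp at this
  have key : Filter.Tendsto (fun r : ℕ => ∫ s in Set.Ioi (0:ℝ), (Set.Iic (M * Real.sqrt r)).indicator (fun s => G r (s / Real.sqrt r)) s)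
      Filter.atTop (nhds (∫ s in Set.Ioi (0 : ℝ), ((Real.exp (-s ^ 2 / 2 + s * Ω) : ℝ) : ℂ))) := by
    refine tendsto_integral_filter_of_dominated_convergence
      (fun s => Real.exp (-(1 / (2 * (1 + M ^ 2))) * s ^ 2 + |Ω| * s)) ?_ ?_ ?_ ?_
    · refine Filter.Eventually.of_forall fun r => ?_
      exact (((hGc r).comp (continuous_id.div_const _)).stronglyMeasurable.indicator measurableSet_Iic).aestronglyMeasurable
    · filter_upwards [Filter.eventually_gt_atTop 0] with r hr
      rw [ae_restrict_iff' measurableSet_Ioi]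
      refine Filter.Eventually.of_forall fun s hs => ?_
      by_cases h : s ∈ Set.Iic (M * Real.sqrt r)
      · rw [Set.indicator_of_mem h]
        exact bound_aux Ω M s hM r r₁ hr (le_of_lt hs) h
      · rw [Set.indicator_of_notMem h, norm_zero]
        positivity
    · have := integrable_cexp_quadratic (b := ((1 / (2 * (1 + M ^ 2)) : ℝ) : ℂ)) (by rw [Complex.ofReal_re]; positivity) (|Ω| : ℝ) 0
      have h2 := this.norm
      refine (h2.congr (Filter.Eventually.of_forall fun s => ?_)).integrableOn
      simp only
      rw [Complex.norm_exp]
      congr 1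
      have : (-((1 / (2 * (1 + M ^ 2)) : ℝ) : ℂ) * (s:ℂ) ^ 2 + ((|Ω| : ℝ) : ℂ) * s + 0) = ((-(1 / (2 * (1 + M ^ 2))) * s ^ 2 + |Ω| * s : ℝ) : ℂ) := by
        push_cast; ring
      rw [this, Complex.ofReal_re]
    · refine Filter.Eventually.of_forall fun s => ?_
      refine (ptwise_aux Ω s r₁).congr' ?_
      filter_upwards [(hq.const_mul_atTop hM).eventually_ge_atTop s] with r hr
      rw [Set.indicator_of_mem (Set.mem_Iic.2 hr)]
  have hio : ∫ s in Set.Ioi (0 : ℝ), ((Real.exp (-s ^ 2 / 2 + s * Ω) : ℝ) : ℂ) =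
      ((∫ s in Set.Ioi (0 : ℝ), Real.exp (-s ^ 2 / 2 + s * Ω) : ℝ) : ℂ) := integral_ofReal
  rw [hio] at key
  refine (key.mul_const Complex.I).congr' ?_
  filter_upwards [Filter.eventually_gt_atTop 0] with r hr
  have hr0 : (0 : ℝ) < r := by exact_mod_cast hr
  have hq0 : 0 < Real.sqrt r := by positivity
  rw [intervalIntegral.integral_mul_const, ← mul_assoc]
  congr 1
  have := intervalIntegral.integral_comp_div (a := 0) (b := M * Real.sqrt r) (G r) hq0.ne'
  rw [zero_div, mul_div_cancel_right₀ _ hq0.ne', Complex.real_smul] at this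
  rw [← this, intervalIntegral.integral_of_le (by positivity), setIntegral_indicator measurableSet_Iic,
    Set.Ioi_inter_Iic]

lemma upper_aux (δ M : ℝ) (hδ : δ ∈ Set.Ioo 0 (π / 2)) (hM : 2 < M) (r₁ : ℕ) (Ω : ℝ) :
    Filter.Tendsto (fun r : ℕ => (Real.sqrt r : ℂ) * ∫ t in (0 : ℝ)..M,
        Complex.exp (-((t : ℂ) * Complex.exp (Complex.I * δ)) * ((r : ℂ) *
      Complex.exp (Complex.I * (Ω / Real.sqrt r)))) *
          (1 - (t : ℂ) * Complex.exp (Complex.I * δ)) ^ (-((r : ℤ) + r₁)) *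
          Complex.exp (Complex.I * δ))
      Filter.atTop (nhds (((Real.exp (Ω ^ 2 / 2) * (Real.sqrt (π / 2) * (erf (Ω / Real.sqrt 2) + 1)) : ℝ) : ℂ) * Complex.I)) := by
  have h1 := imag_aux Ω M (by linarith) r₁
  rw [gauss_aux] at h1
  have hb : 0 < Real.log (M - 1) := Real.log_pos (by linarith)
  have hd := (decay_aux (M * |Ω|) (Real.log (M - 1)) hb).mul_const (M * (π / 2))
  rw [zero_mul] at hd
  refine tendsto_of_tendsto_of_dist h1 ?_
  refine squeeze_zero' (Filter.Eventually.of_forall fun r => dist_nonneg) ?_ hd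
  filter_upwards [Filter.eventually_gt_atTop 0] with r hr
  have hr0 : (0 : ℝ) < r := by exact_mod_cast hr
  have hq0 : 0 < Real.sqrt r := by positivity
  have hqq : Real.sqrt r * Real.sqrt r = r := Real.mul_self_sqrt hr0.le
  rw [dist_comm, dist_eq_norm, ← mul_sub, norm_mul, Complex.norm_real, Real.norm_eq_abs, abs_of_pos hq0, mul_assoc (Real.sqrt r)]
  gcongr
  rw [← mul_assoc]
  refine contour_aux δ M _ hδ.1 hδ.2 (by linarith) (fun p => Complex.exp (-p * ((r : ℂ) *
      Complex.exp (Complex.I * (Ω / Real.sqrt r)))) * (1 - p) ^ (-((r : ℤ) + r₁))) ?_ ?_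
  · intro p hp
    apply DifferentiableAt.differentiableWithinAt
    refine DifferentiableAt.mul (by fun_prop) (DifferentiableAt.zpow (by fun_prop) (Or.inl ?_))
    exact sub_ne_zero.2 (Ne.symm hp)
  · intro θ hθ
    rw [norm_mul, norm_zpow, Complex.norm_exp]
    have hcos : 0 ≤ Real.cos θ := Real.cos_nonneg_of_mem_Icc ⟨by linarith [hθ.1, hδ.1, Real.pi_pos], hθ.2⟩
    have hre : (-((M : ℂ) * Complex.exp (Complex.I * θ)) * ((r : ℂ) * Complex.exp (Complex.I * (Ω / Real.sqrt r)))).re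
      = -(M * r * Real.cos (θ + Ω / Real.sqrt r)) := by
      have : -((M : ℂ) * Complex.exp (Complex.I * θ)) * ((r : ℂ) * Complex.exp (Complex.I * (Ω / Real.sqrt r))) =
        ((-(M * r) : ℝ) : ℂ) * Complex.exp (((θ + Ω / Real.sqrt r : ℝ) : ℂ) * Complex.I) := by
        rw [show (((θ + Ω / Real.sqrt r : ℝ) : ℂ) * Complex.I) = Complex.I * θ + Complex.I * (Ω / Real.sqrt r) by push_cast; ring, Complex.exp_add]
        push_cast; ring
      rw [this, Complex.re_ofReal_mul, Complex.exp_ofReal_mul_I_re]; ring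
    have hcos2 : -(|Ω| / Real.sqrt r) ≤ Real.cos (θ + Ω / Real.sqrt r) := by
      have h5 : |Real.sin (Ω / Real.sqrt r)| ≤ |Ω| / Real.sqrt r := by
        refine (Real.abs_sin_le_abs).trans ?_
        rw [abs_div, abs_of_pos hq0]
      have h6 := Real.abs_cos_sub_cos_le (θ + Ω / Real.sqrt r) θ
      rw [add_sub_cancel_left, abs_div, abs_of_pos hq0, abs_le] at h6
      linarith [h6.1]
    have hN : M - 1 ≤ ‖1 - (M : ℂ) * Complex.exp (Complex.I * θ)‖ := by
      have := norm_sub_norm_le ((M : ℂ) * Complex.exp (Complex.I * θ)) 1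
      rw [norm_sub_rev, norm_mul, mul_comm Complex.I, Complex.norm_exp_ofReal_mul_I, Complex.norm_real, Real.norm_eq_abs, abs_of_pos (by linarith), mul_one, norm_one, mul_comm _ Complex.I] at this
      exact this
    rw [hre]
    gcongr
    · calc -(M * r * Real.cos (θ + Ω / Real.sqrt r)) = M * r * -Real.cos (θ + Ω / Real.sqrt r) := by ring
        _ ≤ M * r * (|Ω| / Real.sqrt r) := by gcongr; linarith
        _ = M * |Ω| * Real.sqrt r := by
          field_simp; rw [Real.sq_sqrt hr0.le]; ring
    · set N := ‖1 - (M : ℂ) * Complex.exp (Complex.I * θ)‖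
      have e1 : N ^ (-((r : ℤ) + r₁)) = (N ^ (r + r₁))⁻¹ := by
        rw [zpow_neg]; norm_cast
      rw [e1, Real.exp_neg]
      apply inv_anti₀ (Real.exp_pos _)
      calc Real.exp (Real.log (M - 1) * r) = (M - 1) ^ r := by
            rw [mul_comm, Real.exp_nat_mul, Real.exp_log (by linarith)]
        _ ≤ N ^ r := by gcongr; linarith
        _ ≤ N ^ (r + r₁) := pow_le_pow_right₀ (by linarith) (by omega)

lemma erf_neg_aux (y : ℝ) : erf (-y) = -erf y := by
  have := intervalIntegral.integral_comp_neg (a := 0) (b := y) (fun v : ℝ => Real.exp (-v ^ 2))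
  simp only [neg_sq, neg_zero] at this
  rw [erf, erf, intervalIntegral.integral_symm, ← this]; ring

lemma lower_aux (δ M : ℝ) (hδ : δ ∈ Set.Ioo 0 (π / 2)) (hM : 2 < M) (r₁ : ℕ) (Ω : ℝ) :
    Filter.Tendsto (fun r : ℕ => (Real.sqrt r : ℂ) * ∫ t in (0 : ℝ)..M,
        Complex.exp (-((t : ℂ) * Complex.exp (-Complex.I * δ)) * ((r : ℂ) *
      Complex.exp (Complex.I * (Ω / Real.sqrt r)))) *
          (1 - (t : ℂ) * Complex.exp (-Complex.I * δ)) ^ (-((r : ℤ) + r₁)) *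
          Complex.exp (-Complex.I * δ))
      Filter.atTop (nhds (((Real.exp (Ω ^ 2 / 2) * (Real.sqrt (π / 2) * (1 - erf (Ω / Real.sqrt 2))) : ℝ) : ℂ) * -Complex.I)) := by
  have h := (Complex.continuous_conj.tendsto _).comp (upper_aux δ M hδ hM r₁ (-Ω))
  have e : (((Real.exp (Ω ^ 2 / 2) * (Real.sqrt (π / 2) * (1 - erf (Ω / Real.sqrt 2))) : ℝ) : ℂ) * -Complex.I) =
    (starRingEnd ℂ) (((Real.exp ((-Ω) ^ 2 / 2) * (Real.sqrt (π / 2) * (erf (-Ω / Real.sqrt 2) + 1)) : ℝ) : ℂ) * Complex.I) := by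
    rw [map_mul, Complex.conj_ofReal, Complex.conj_I, neg_sq, neg_div, erf_neg_aux]
    congr 5
    ring
  rw [e]
  refine h.congr fun r => ?_
  simp only [Function.comp, map_mul, Complex.conj_ofReal]
  congr 1
  rw [← intervalIntegral.intervalIntegral_conj]
  congr 1
  ext t
  simp only [map_mul, map_zpow₀, map_sub, map_one, map_neg, ← Complex.exp_conj, Complex.conj_ofReal, Complex.conj_I,
    map_div₀, map_natCast, Complex.ofReal_neg]
  congr 6
  ring

theorem stmt_9 (δ M : ℝ) (hδ : δ ∈ Set.Ioo 0 (π / 2)) (hM : 2 < M)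
    (r₁ : ℕ) (hr₁ : 1 ≤ r₁) (α Ω : ℝ) (hΩ : Ω ≤ 0)
    (x : ℕ → ℂ) (hx : ∀ r : ℕ, x r = (r : ℂ) *
      Complex.exp (Complex.I * (Ω / Real.sqrt r)))
    (g : ℕ → ℂ)
    (hg : ∀ r : ℕ, g r =
      (α : ℂ) * (∫ t in (0 : ℝ)..M,
        Complex.exp (-((t : ℂ) * Complex.exp (Complex.I * δ)) * x r) *
          (1 - (t : ℂ) * Complex.exp (Complex.I * δ)) ^ (-((r : ℤ) + r₁)) *
          Complex.exp (Complex.I * δ)) +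
      (1 - (α : ℂ)) * ∫ t in (0 : ℝ)..M,
        Complex.exp (-((t : ℂ) * Complex.exp (-Complex.I * δ)) * x r) *
          (1 - (t : ℂ) * Complex.exp (-Complex.I * δ)) ^ (-((r : ℤ) + r₁)) *
          Complex.exp (-Complex.I * δ)) :
    Filter.Tendsto
      (fun r : ℕ => (Real.sqrt r : ℂ) * Real.exp (-Ω ^ 2 / 2) * g r)
      Filter.atTop
      (nhds (Complex.I * (Real.sqrt (π / 2) : ℂ) *
        ((erf (Ω / Real.sqrt 2) : ℂ) - 1 + 2 * α))) := by
  have hu := (upper_aux δ M hδ hM r₁ Ω).const_mul ((Real.exp (-Ω ^ 2 / 2) : ℂ) * α)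
  have hl := (lower_aux δ M hδ hM r₁ Ω).const_mul ((Real.exp (-Ω ^ 2 / 2) : ℂ) * (1 - α))
  have hs := hu.add hl
  have hE : ((Real.exp (-Ω ^ 2 / 2) : ℝ) : ℂ) * (Real.exp (Ω ^ 2 / 2) : ℝ) = 1 := by
    rw [← Complex.ofReal_mul, ← Real.exp_add]
    simp [neg_div]
  convert hs using 2
  · rw [hg, hx]; ring
  · simp only [Complex.ofReal_mul, Complex.ofReal_add, Complex.ofReal_sub, Complex.ofReal_one]
    linear_combination (-(Complex.I * (Real.sqrt (π / 2) : ℂ) *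
        ((erf (Ω / Real.sqrt 2) : ℂ) - 1 + 2 * α))) * hE
end
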